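/- arXiv:0708.1726 — 4 statements merged into one kernel-verified Lean document; each statement's English description precedes it below -/
import Mathlib

section
/- Let Ω be an open subset of ℂ and let E ⊂ Ω be a polar set. Then there exists a subharmonic function μ on Ω, not identically −∞ on any connected component of Ω, such that E ⊂ μ⁻¹(−∞). In other words, local polarity implies global polarity. -/
open MeasureTheory Metric Set

noncomputable section

/-- Subharmonicity on an open set `U ⊆ ℂ` for `[−∞,∞)`-valued functions:
upper semicontinuous, never `+∞`, and satisfying the sub-mean value inequality
on every closed disc contained in `U` (formulated against continuous majorants
on the boundary circle, which for upper semicontinuous functions is equivalent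
to the usual mean value inequality). -/
def SubharmonicERealOn (lam : ℂ → EReal) (U : Set ℂ) : Prop :=
  UpperSemicontinuousOn lam U ∧ (∀ z ∈ U, lam z ≠ ⊤) ∧
  ∀ (c : ℂ) (r : ℝ), 0 < r → Metric.closedBall c r ⊆ U →
    ∀ g : ℝ → ℝ, Continuous g →
      (∀ θ : ℝ, lam (circleMap c r θ) ≤ (g θ : EReal)) →
      lam c ≤ (((2 * Real.pi)⁻¹ * ∫ θ in (0:ℝ)..(2 * Real.pi), g θ : ℝ) : EReal)

/-- Subharmonicity on an open set `U ⊆ ℂ` for real-valued functions: upper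
semicontinuous and satisfying the sub-mean value inequality on closed discs. -/
def SubharmonicRealOn (v : ℂ → ℝ) (U : Set ℂ) : Prop :=
  UpperSemicontinuousOn v U ∧
  ∀ (c : ℂ) (r : ℝ), 0 < r → Metric.closedBall c r ⊆ U →
    v c ≤ (2 * Real.pi)⁻¹ * ∫ θ in (0:ℝ)..(2 * Real.pi), v (circleMap c r θ)

/-- `E` is a polar subset of the open set `Ω ⊆ ℂ`: every `z ∈ Ω` has an open
neighborhood `V` carrying a subharmonic function `λ`, not identically `−∞` near
`z`, with `E ∩ V ⊆ λ⁻¹(−∞)`. -/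
def PolarIn (E Ω : Set ℂ) : Prop :=
  ∀ z ∈ Ω, ∃ V : Set ℂ, IsOpen V ∧ z ∈ V ∧
    ∃ lam : ℂ → EReal, SubharmonicERealOn lam V ∧
      (∀ t ∈ nhds z, ∃ w ∈ t ∩ V, lam w ≠ ⊥) ∧
      E ∩ V ⊆ lam ⁻¹' {⊥}

namespace PG
open Filter Topology

open Filter Topology

/-- Sub-mean value inequality on the circle of center `c` and radius `r`. -/
def SM (f : ℂ → EReal) (c : ℂ) (r : ℝ) : Prop :=
  ∀ G : ℂ → ℝ, Continuous G → (∀ w ∈ sphere c r, f w < (G w : EReal)) →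
    f c ≤ ((Real.circleAverage G c r : ℝ) : EReal)

/-- Working version of subharmonicity. -/
def SH (f : ℂ → EReal) (U : Set ℂ) : Prop :=
  (∀ z ∈ U, UpperSemicontinuousAt f z) ∧ (∀ z ∈ U, f z ≠ ⊤) ∧
  ∀ (c : ℂ) (r : ℝ), 0 < r → closedBall c r ⊆ U → SM f c r

theorem lt_nhds {X : Type*} [TopologicalSpace X] {K : Set X} {x : X} {f : X → EReal} {G : X → ℝ}
    (hf : UpperSemicontinuousWithinAt f K x) (hG : ContinuousWithinAt G K x)
    (h : f x < (G x : EReal)) : ∀ᶠ y in 𝓝[K] x, f y < (G y : EReal) := by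
  obtain ⟨q, h1, h2⟩ := EReal.lt_iff_exists_real_btwn.1 h
  have h2' : q < G x := by exact_mod_cast h2
  filter_upwards [hf _ h1, hG.eventually (lt_mem_nhds h2')] with y hy1 hy2
  exact hy1.trans (by exact_mod_cast hy2)

theorem dini {X ι : Type*} [TopologicalSpace X] [Nonempty ι] {K : Set X} (hK : IsCompact K)
    (f : ι → X → EReal)
    (hdir : ∀ i j, ∃ k, ∀ x ∈ K, f k x ≤ f i x ∧ f k x ≤ f j x)
    (husc : ∀ i, ∀ x ∈ K, UpperSemicontinuousWithinAt (f i) K x)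
    (G : X → ℝ) (hG : ContinuousOn G K)
    (h : ∀ x ∈ K, ∃ i, f i x < (G x : EReal)) :
    ∃ i, ∀ x ∈ K, f i x < (G x : EReal) := by
  have key : ∃ i, ∀ x ∈ K, x ∈ K → f i x < (G x : EReal) := by
    refine hK.induction_on (p := fun s => ∃ i, ∀ x ∈ s, x ∈ K → f i x < (G x : EReal)) ?_ ?_ ?_ ?_
    · exact ⟨Classical.arbitrary ι, by simp⟩
    · rintro s t hst ⟨i, hi⟩
      exact ⟨i, fun x hx => hi x (hst hx)⟩
    · rintro s t ⟨i, hi⟩ ⟨j, hj⟩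
      obtain ⟨k, hk⟩ := hdir i j
      refine ⟨k, ?_⟩
      rintro x (hx | hx) hxK
      · exact (hk x hxK).1.trans_lt (hi x hx hxK)
      · exact (hk x hxK).2.trans_lt (hj x hx hxK)
    · intro x hx
      obtain ⟨i, hi⟩ := h x hx
      exact ⟨_, lt_nhds (husc i x hx) (hG x hx) hi, i, fun y hy _ => hy⟩
  obtain ⟨i, hi⟩ := key
  exact ⟨i, fun x hx => hi x hx hx⟩

theorem exists_bound {X : Type*} [TopologicalSpace X] {K : Set X} (hK : IsCompact K)
    {f : X → EReal} (husc : ∀ x ∈ K, UpperSemicontinuousWithinAt f K x)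
    (htop : ∀ x ∈ K, f x ≠ ⊤) : ∃ M : ℝ, ∀ x ∈ K, f x < (M : EReal) := by
  refine hK.induction_on (p := fun s => ∃ M : ℝ, ∀ x ∈ s, f x < (M : EReal)) ?_ ?_ ?_ ?_
  · exact ⟨0, by simp⟩
  · rintro s t hst ⟨i, hi⟩
    exact ⟨i, fun x hx => hi x (hst hx)⟩
  · rintro s t ⟨i, hi⟩ ⟨j, hj⟩
    refine ⟨max i j, ?_⟩
    rintro x (hx | hx)
    · exact (hi x hx).trans_le (by exact_mod_cast le_max_left _ _)
    · exact (hj x hx).trans_le (by exact_mod_cast le_max_right _ _)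
  · intro x hx
    obtain ⟨q, h1, h2⟩ := EReal.lt_iff_exists_real_btwn.1 (lt_top_iff_ne_top.2 (htop x hx))
    exact ⟨_, husc x hx _ h1, q, fun y hy => hy⟩

/-- usc functions on compacts are infima of continuous functions. -/
theorem exists_majorant {K : Set ℂ} (hK : IsCompact K)
    {f : ℂ → EReal} (husc : ∀ x ∈ K, UpperSemicontinuousWithinAt f K x)
    (htop : ∀ x ∈ K, f x ≠ ⊤) {x : ℂ} (hx : x ∈ K) {a : ℝ} (ha : f x < (a : EReal)) :
    ∃ G : ℂ → ℝ, Continuous G ∧ (∀ y ∈ K, f y < (G y : EReal)) ∧ G x = a := by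
  obtain ⟨M, hM⟩ := exists_bound hK husc htop
  have h1 := husc x hx _ ha
  obtain ⟨δ, hδ, hball⟩ := Metric.mem_nhdsWithin_iff.1 h1
  have hC : 0 ≤ |M - a| / δ := by positivity
  refine ⟨fun y => a + |M - a| / δ * dist y x, by fun_prop, ?_, by simp⟩
  intro y hy
  by_cases hyx : dist y x < δ
  · have : f y < (a : EReal) := hball ⟨hyx, hy⟩
    refine this.trans_le ?_
    have : a ≤ a + |M - a| / δ * dist y x := by
      have : 0 ≤ |M - a| / δ * dist y x := by positivity
      linarith
    exact_mod_cast this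
  · refine (hM y hy).trans_le ?_
    push Not at hyx
    have h3 : |M - a| ≤ |M - a| / δ * dist y x := by
      rw [div_mul_eq_mul_div, le_div_iff₀ hδ]
      exact mul_le_mul_of_nonneg_left hyx (abs_nonneg _)
    have : M ≤ a + |M - a| / δ * dist y x := by linarith [le_abs_self (M - a)]
    exact_mod_cast this

/-- The type of continuous strict majorants on a set. -/
def Maj (f : ℂ → EReal) (K : Set ℂ) : Type :=
  {G : ℂ → ℝ // Continuous G ∧ ∀ y ∈ K, f y < (G y : EReal)}

theorem maj_nonempty {K : Set ℂ} (hK : IsCompact K)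
    {f : ℂ → EReal} (husc : ∀ x ∈ K, UpperSemicontinuousWithinAt f K x)
    (htop : ∀ x ∈ K, f x ≠ ⊤) : Nonempty (Maj f K) := by
  obtain ⟨M, hM⟩ := exists_bound hK husc htop
  exact ⟨⟨fun _ => M, continuous_const, hM⟩⟩

def Maj.inf {f : ℂ → EReal} {K : Set ℂ} (G H : Maj f K) : Maj f K :=
  ⟨fun z => min (G.1 z) (H.1 z), G.2.1.min H.2.1, fun y hy => by
    rcases min_choice (G.1 y) (H.1 y) with h | h
    · simp only [h]; exact G.2.2 y hy
    · simp only [h]; exact H.2.2 y hy⟩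

theorem usc_coe {X : Type*} [TopologicalSpace X] {G : X → ℝ} {K : Set X} {x : X}
    (hG : ContinuousWithinAt G K x) :
    UpperSemicontinuousWithinAt (fun x => (G x : EReal)) K x := by
  have : ContinuousWithinAt (fun x => (G x : EReal)) K x :=
    continuous_coe_real_ereal.continuousAt.comp_continuousWithinAt hG
  exact this.upperSemicontinuousWithinAt

theorem circleIntegrable {G : ℂ → ℝ} (hG : Continuous G) (c : ℂ) (r : ℝ) :
    CircleIntegrable G c r := hG.continuousOn.circleIntegrable'

theorem le_of_forall_eps {x : EReal} {a : ℝ} (h : ∀ ε : ℝ, 0 < ε → x ≤ ((a + ε : ℝ) : EReal)) :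
    x ≤ (a : EReal) := by
  refine le_of_forall_gt fun y hy => ?_
  obtain ⟨q, h1, h2⟩ := EReal.lt_iff_exists_real_btwn.1 hy
  have h1' : a < q := by exact_mod_cast h1
  have := h (q - a) (by linarith)
  rw [add_sub_cancel] at this
  exact this.trans_lt h2

theorem SH.of_sub {f : ℂ → EReal} {U : Set ℂ} (hU : IsOpen U) (h : SubharmonicERealOn f U) :
    SH f U := by
  refine ⟨fun z hz => ?_, h.2.1, fun c r hr hcr G hG hfG => ?_⟩
  · intro y hy
    have := h.1 z hz y hy
    rwa [hU.nhdsWithin_eq hz] at this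
  · have := h.2.2 c r hr hcr (fun θ => G (circleMap c r θ)) (by fun_prop)
      (fun θ => (hfG _ (circleMap_mem_sphere c hr.le θ)).le)
    simpa [Real.circleAverage] using this

theorem SH.to_sub {f : ℂ → EReal} {U : Set ℂ} (h : SH f U) :
    SubharmonicERealOn f U := by
  refine ⟨fun z hz y hy => (h.1 z hz y hy).filter_mono nhdsWithin_le_nhds, h.2.1,
    fun c r hr hcr g hg hfg => ?_⟩
  have hsub : sphere c r ⊆ U := sphere_subset_closedBall.trans hcr
  have husc : ∀ x ∈ sphere c r, UpperSemicontinuousWithinAt f (sphere c r) x :=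
    fun x hx y hy => (h.1 x (hsub hx) y hy).filter_mono nhdsWithin_le_nhds
  have htop : ∀ x ∈ sphere c r, f x ≠ ⊤ := fun x hx => h.2.1 x (hsub hx)
  have := maj_nonempty (isCompact_sphere c r) husc htop
  apply le_of_forall_eps
  intro ε hε
  obtain ⟨G, hG⟩ := dini (isCompact_Icc (a := (0:ℝ)) (b := 2 * Real.pi))
    (fun (G : Maj f (sphere c r)) θ => (G.1 (circleMap c r θ) : EReal))
    (fun i j => ⟨i.inf j, fun x _ => ⟨by exact_mod_cast min_le_left _ _,
      by exact_mod_cast min_le_right _ _⟩⟩)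
    (fun i x _ => usc_coe (i.2.1.comp (continuous_circleMap c r)).continuousWithinAt)
    (fun θ => g θ + ε) (by fun_prop) (by
      intro θ _
      have h1 : f (circleMap c r θ) < ((g θ + ε / 2 : ℝ) : EReal) :=
        (hfg θ).trans_lt (by exact_mod_cast (by linarith))
      obtain ⟨G, hG, hG2, hG3⟩ := exists_majorant (isCompact_sphere c r) husc htop
        (circleMap_mem_sphere c hr.le θ) h1
      refine ⟨⟨G, hG, hG2⟩, ?_⟩
      simp only [hG3]
      exact_mod_cast (by linarith))
  refine (h.2.2 c r hr hcr G.1 G.2.1 G.2.2).trans ?_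
  have hpi := Real.pi_pos
  have hle : (∫ θ in (0:ℝ)..(2 * Real.pi), G.1 (circleMap c r θ)) ≤
      ∫ θ in (0:ℝ)..(2 * Real.pi), (g θ + ε) := by
    apply intervalIntegral.integral_mono_on (by positivity)
    · exact (G.2.1.comp (continuous_circleMap c r)).intervalIntegrable _ _
    · exact (hg.add continuous_const).intervalIntegrable _ _
    · intro x hx
      have := hG x hx
      exact_mod_cast this.le
  rw [intervalIntegral.integral_add (hg.intervalIntegrable _ _) (by simp)] at hle
  simp only [intervalIntegral.integral_const, sub_zero, smul_eq_mul] at hle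
  rw [Real.circleAverage_def, smul_eq_mul]
  have : (2 * Real.pi)⁻¹ * (∫ θ in (0:ℝ)..(2 * Real.pi), G.1 (circleMap c r θ)) ≤
      (2 * Real.pi)⁻¹ * (∫ θ in (0:ℝ)..(2 * Real.pi), g θ) + ε := by
    calc _ ≤ (2 * Real.pi)⁻¹ * ((∫ θ in (0:ℝ)..(2 * Real.pi), g θ) + 2 * Real.pi * ε) := by
          gcongr
      _ = _ := by field_simp
  exact_mod_cast this

/-- Density of real parts of entire functions among the continuous functions on a circle. -/
theorem approx {c : ℂ} {r : ℝ} (hr : 0 < r) {G : ℂ → ℝ} (hG : Continuous G) {ε : ℝ} (hε : 0 < ε) :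
    ∃ Q : ℂ → ℂ, Differentiable ℂ Q ∧ ∀ z ∈ sphere c r, |(Q z).re - G z| < ε := by
  have : Fact (0 < 2 * Real.pi) := ⟨by positivity⟩
  let F : C(AddCircle (2 * Real.pi), ℂ) :=
    ⟨fun t => (G (c + r * (fourier 1 t : ℂ)) : ℂ), by fun_prop⟩
  have hF : F ∈ (Submodule.span ℂ (range <| @fourier (2 * Real.pi))).topologicalClosure := by
    rw [span_fourier_closure_eq_top]; trivial
  obtain ⟨q, hq, hqF⟩ := Metric.mem_closure_iff.1 hF ε hε
  have hrc : (r : ℂ) ≠ 0 := by exact_mod_cast hr.ne'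
  have hpow : ∀ (k : ℕ) (t : AddCircle (2 * Real.pi)),
      (fourier (k : ℤ) t : ℂ) = (fourier 1 t : ℂ) ^ k := by
    intro k t
    simp [fourier_apply, AddCircle.toCircle_nsmul]
  have key : ∀ a : ℂ, ∃ Q : ℂ → ℂ, Differentiable ℂ Q ∧
      ∀ t, (Q (c + r * (fourier 1 t : ℂ))).re = (a * q t).re := by
    refine Submodule.span_induction (p := fun q _ => ∀ a : ℂ, ∃ Q : ℂ → ℂ, Differentiable ℂ Q ∧
      ∀ t, (Q (c + r * (fourier 1 t : ℂ))).re = (a * q t).re) ?_ ?_ ?_ ?_ hq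
    · rintro _ ⟨n, rfl⟩ a
      obtain ⟨k, rfl | rfl⟩ := n.eq_nat_or_neg
      · refine ⟨fun z => a * ((z - c) / r) ^ k, by fun_prop, fun t => ?_⟩
        beta_reduce
        rw [hpow, add_sub_cancel_left, mul_div_cancel_left₀ _ hrc]
      · refine ⟨fun z => (starRingEnd ℂ) a * ((z - c) / r) ^ k, by fun_prop, fun t => ?_⟩
        beta_reduce
        rw [fourier_neg, hpow, add_sub_cancel_left, mul_div_cancel_left₀ _ hrc, ← Complex.conj_re]
        simp
    · intro a
      exact ⟨fun _ => 0, by fun_prop, by simp⟩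
    · intro x y _ _ hx hy a
      obtain ⟨Q1, h1, h1'⟩ := hx a
      obtain ⟨Q2, h2, h2'⟩ := hy a
      refine ⟨fun z => Q1 z + Q2 z, by fun_prop, fun t => ?_⟩
      rw [Complex.add_re, h1', h2', ← Complex.add_re, ContinuousMap.add_apply, mul_add]
    · intro b x _ hx a
      obtain ⟨Q1, h1, h1'⟩ := hx (a * b)
      refine ⟨Q1, h1, fun t => ?_⟩
      rw [h1', ContinuousMap.smul_apply, smul_eq_mul, mul_assoc]
  obtain ⟨Q, hQ, hQq⟩ := key 1
  refine ⟨Q, hQ, fun z hz => ?_⟩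
  obtain ⟨θ, -, rfl⟩ : z ∈ circleMap c r '' Ioc 0 (2 * Real.pi) := by
    rw [image_circleMap_Ioc, abs_of_pos hr]; exact hz
  have hθ : circleMap c r θ = c + r * (fourier 1 (θ : AddCircle (2 * Real.pi)) : ℂ) := by
    rw [fourier_coe_apply, circleMap]
    congr 3
    have : (Real.pi : ℂ) ≠ 0 := by exact_mod_cast Real.pi_pos.ne'
    push_cast
    field_simp
  rw [hθ, hQq, one_mul]
  have h3 : dist (F θ) (q θ) < ε := (ContinuousMap.dist_apply_le_dist _).trans_lt hqF
  rw [dist_comm, Complex.dist_eq] at h3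
  refine lt_of_le_of_lt ?_ h3
  have := Complex.abs_re_le_norm (q θ - F θ)
  simpa [F] using this


theorem mean_re {Q : ℂ → ℂ} (hQ : Differentiable ℂ Q) (c : ℂ) (r : ℝ) :
    Real.circleAverage (fun z => (Q z).re) c r = (Q c).re := by
  have h1 : Real.circleAverage Q c r = Q c := DiffContOnCl.circleAverage hQ.diffContOnCl
  have h2 := Complex.reCLM.circleAverage_comp_comm (f := Q) (c := c) (R := r)
    hQ.continuous.continuousOn.circleIntegrable'
  rw [h1] at h2
  exact h2

def LocSM (f : ℂ → EReal) (z : ℂ) : Prop :=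
  ∃ ε : ℝ, 0 < ε ∧ ∀ s, 0 < s → s < ε → SM f z s

theorem SH.locSM {f : ℂ → EReal} {U : Set ℂ} (hU : IsOpen U) (h : SH f U) {z : ℂ} (hz : z ∈ U) :
    LocSM f z := by
  obtain ⟨ε, hε, hb⟩ := Metric.isOpen_iff.1 hU z hz
  exact ⟨ε, hε, fun s hs hsε => h.2.2 z s hs ((closedBall_subset_ball hsε).trans hb)⟩

theorem LocSM.congr {f g : ℂ → EReal} {z : ℂ} (hf : LocSM f z) (hfg : f =ᶠ[𝓝 z] g) :
    LocSM g z := by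
  obtain ⟨ε, hε, h⟩ := hf
  obtain ⟨δ, hδ, hb⟩ := Metric.eventually_nhds_iff.1 hfg
  refine ⟨min ε δ, lt_min hε hδ, fun s hs hs2 G hG hgG => ?_⟩
  rw [← hb (by simpa using hδ)]
  refine h s hs (hs2.trans_le (min_le_left _ _)) G hG fun w hw => ?_
  rw [hb (by rw [mem_sphere.1 hw]; exact hs2.trans_le (min_le_right _ _))]
  exact hgG w hw

theorem usc_add {X : Type*} [TopologicalSpace X] {K : Set X} {x : X} {f g : X → EReal}
    (hf : UpperSemicontinuousWithinAt f K x) (hg : UpperSemicontinuousWithinAt g K x)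
    (h1 : f x ≠ ⊤) (h2 : g x ≠ ⊤) :
    UpperSemicontinuousWithinAt (fun x => f x + g x) K x :=
  hf.add' hg (EReal.continuousAt_add (.inl h1) (.inr h2))

theorem maxp {f : ℂ → EReal} {c : ℂ} {r : ℝ} (hr : 0 < r)
    (husc : ∀ z ∈ closedBall c r, UpperSemicontinuousWithinAt f (closedBall c r) z)
    (htop : ∀ z ∈ closedBall c r, f z ≠ ⊤)
    (hloc : ∀ z ∈ ball c r, LocSM f z) {Q : ℂ → ℂ} (hQ : Differentiable ℂ Q)
    (hb : ∀ z ∈ sphere c r, f z < ((Q z).re : EReal)) :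
    ∀ z ∈ closedBall c r, f z ≤ ((Q z).re : EReal) := by
  by_contra hcon
  push Not at hcon
  obtain ⟨z1, hz1, hlt⟩ := hcon
  have hQc := hQ.continuous
  have hsub : sphere c r ⊆ closedBall c r := sphere_subset_closedBall
  -- uniform gap on the circle
  obtain ⟨δ, hδ, hgap⟩ : ∃ δ : ℝ, 0 < δ ∧ ∀ z ∈ sphere c r, f z + ((-(Q z).re : ℝ) : EReal) <
      ((-δ : ℝ) : EReal) := by
    have hne : (sphere c r).Nonempty := NormedSpace.sphere_nonempty.2 hr.le
    obtain ⟨w, hw, hmax⟩ := UpperSemicontinuousOn.exists_isMaxOn hne (isCompact_sphere c r)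
      (f := fun z => f z + ((-(Q z).re : ℝ) : EReal)) (fun z hz => usc_add
        ((husc z (hsub hz)).mono hsub) (usc_coe (by fun_prop)) (htop z (hsub hz)) (by simp))
    have h0 : f w + ((-(Q w).re : ℝ) : EReal) < ((0 : ℝ) : EReal) := by
      have := EReal.add_lt_add_right_coe (hb w hw) (-(Q w).re)
      rwa [← EReal.coe_add, add_neg_cancel] at this
    obtain ⟨q, h1, h2⟩ := EReal.lt_iff_exists_real_btwn.1 h0
    have h2' : q < 0 := by exact_mod_cast h2
    exact ⟨-q, by linarith, fun z hz => by rw [neg_neg]; exact (hmax hz).trans_lt h1⟩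
  set η : ℝ := δ / r ^ 2 with hη
  have hηpos : 0 < η := by positivity
  obtain ⟨z0, hz0, hmax⟩ := UpperSemicontinuousOn.exists_isMaxOn ⟨z1, hz1⟩ (isCompact_closedBall c r)
      (f := fun z => f z + ((-(Q z).re + η * ‖z - c‖ ^ 2 : ℝ) : EReal)) (fun z hz => usc_add
        (husc z hz) (usc_coe (by fun_prop)) (htop z hz) (EReal.coe_ne_top _))
  have hpos : (0 : EReal) < f z0 + ((-(Q z0).re + η * ‖z0 - c‖ ^ 2 : ℝ) : EReal) := by
    refine lt_of_lt_of_le ?_ (hmax hz1)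
    have := EReal.add_lt_add_right_coe hlt (-(Q z1).re + η * ‖z1 - c‖ ^ 2)
    refine lt_of_le_of_lt ?_ this
    rw [← EReal.coe_add]
    have : 0 ≤ (Q z1).re + (-(Q z1).re + η * ‖z1 - c‖ ^ 2) := by
      have : 0 ≤ η * ‖z1 - c‖ ^ 2 := by positivity
      linarith
    exact_mod_cast this
  have hfb : f z0 ≠ ⊥ := by
    intro h
    rw [h, EReal.bot_add] at hpos
    exact absurd hpos (by simp)
  obtain ⟨m, hm⟩ : ∃ m : ℝ, f z0 = m := ⟨(f z0).toReal, (EReal.coe_toReal (htop z0 hz0) hfb).symm⟩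
  have hz0b : z0 ∈ ball c r := by
    by_contra hnb
    have hs : z0 ∈ sphere c r := by
      rw [mem_sphere]
      rw [mem_ball, not_lt] at hnb
      exact le_antisymm hz0 hnb
    have h1 := hgap z0 hs
    have hn : ‖z0 - c‖ = r := by rw [← dist_eq_norm]; exact hs
    rw [hm, ← EReal.coe_add, EReal.coe_lt_coe_iff] at h1
    rw [hm, ← EReal.coe_add, hn, ← EReal.coe_zero, EReal.coe_lt_coe_iff] at hpos
    have : η * r ^ 2 = δ := by rw [hη]; field_simp
    linarith
  obtain ⟨ε, hε, hSM⟩ := hloc z0 hz0b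
  set s : ℝ := min (ε / 2) (r - dist z0 c) with hs
  have hspos : 0 < s := lt_min (by linarith) (by rw [mem_ball] at hz0b; linarith)
  have hsε : s < ε := (min_le_left _ _).trans_lt (by linarith)
  -- majorant
  let Q' : ℂ → ℂ := fun w => (m : ℂ) + (Q w - Q z0) - η * (s ^ 2 / 2 + 2 * ((w - z0) *
    (starRingEnd ℂ) (z0 - c)))
  have hQ' : Differentiable ℂ Q' := by fun_prop
  have h1 := hSM s hspos hsε (fun w => (Q' w).re) (Complex.continuous_re.comp hQ'.continuous) (by
    intro w hw
    have hwn : ‖w - z0‖ = s := by rw [← dist_eq_norm]; exact hw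
    have hwb : w ∈ closedBall c r := by
      rw [mem_closedBall]
      have h2 : dist w z0 = s := hw
      have h3 : s ≤ r - dist z0 c := min_le_right _ _
      linarith [dist_triangle w z0 c]
    have h2 : f w + ((-(Q w).re + η * ‖w - c‖ ^ 2 : ℝ) : EReal) ≤
      f z0 + ((-(Q z0).re + η * ‖z0 - c‖ ^ 2 : ℝ) : EReal) := hmax hwb
    rw [hm] at h2
    have hid : ‖w - c‖ ^ 2 = s ^ 2 + ‖z0 - c‖ ^ 2 +
        2 * ((w - z0) * (starRingEnd ℂ) (z0 - c)).re := by
      rw [← hwn]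
      have : w - c = (w - z0) + (z0 - c) := by ring
      rw [this, ← Complex.normSq_eq_norm_sq, ← Complex.normSq_eq_norm_sq,
        ← Complex.normSq_eq_norm_sq, Complex.normSq_add]
    have hre : (Q' w).re = m + ((Q w).re - (Q z0).re) - η * (s ^ 2 / 2 + 2 * ((w - z0) *
        (starRingEnd ℂ) (z0 - c)).re) := by
      have e : Q' w = ((m : ℝ) : ℂ) + (Q w - Q z0) - ((η : ℝ) : ℂ) * (((s ^ 2 / 2 : ℝ) : ℂ) +
          ((2 : ℝ) : ℂ) * ((w - z0) * (starRingEnd ℂ) (z0 - c))) := by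
        simp only [Q']; push_cast; ring
      rw [e]
      simp only [Complex.add_re, Complex.sub_re, Complex.ofReal_re, Complex.re_ofReal_mul]
    rw [hre]
    rcases eq_or_ne (f w) ⊥ with hbot | hbot
    · rw [hbot]; exact EReal.bot_lt_coe _
    obtain ⟨k, hk⟩ : ∃ k : ℝ, f w = k := ⟨(f w).toReal, (EReal.coe_toReal (htop w hwb) hbot).symm⟩
    rw [hk] at h2 ⊢
    rw [← EReal.coe_add, ← EReal.coe_add, EReal.coe_le_coe_iff, hid] at h2
    rw [EReal.coe_lt_coe_iff]
    have : 0 < η * (s ^ 2 / 2) := by positivity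
    nlinarith)
  rw [mean_re hQ', hm, EReal.coe_le_coe_iff] at h1
  have hre : (Q' z0).re = m - η * (s ^ 2 / 2) := by
    have e : Q' z0 = ((m - η * (s ^ 2 / 2) : ℝ) : ℂ) := by
      simp only [Q']; push_cast; ring
    rw [e, Complex.ofReal_re]
  rw [hre] at h1
  have : 0 < η * (s ^ 2 / 2) := by positivity
  linarith

theorem usc_within {f : ℂ → EReal} {z : ℂ} (h : UpperSemicontinuousAt f z) (K : Set ℂ) :
    UpperSemicontinuousWithinAt f K z :=
  fun y hy => (h y hy).filter_mono nhdsWithin_le_nhds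

/-- Majorant by real parts of entire functions. -/
theorem exists_entire {c : ℂ} {r : ℝ} (hr : 0 < r) {G : ℂ → ℝ} (hG : Continuous G) {ε : ℝ}
    (hε : 0 < ε) : ∃ Q : ℂ → ℂ, Differentiable ℂ Q ∧
      ∀ z ∈ sphere c r, G z < (Q z).re ∧ (Q z).re < G z + ε := by
  obtain ⟨Q, hQ, h⟩ := approx (c := c) hr (G := fun z => G z + ε / 2) (by fun_prop) (half_pos hε)
  refine ⟨Q, hQ, fun z hz => ?_⟩
  have := abs_lt.1 (h z hz)
  constructor <;> linarith

theorem SH.of_local {f : ℂ → EReal} {U : Set ℂ} (h1 : ∀ z ∈ U, UpperSemicontinuousAt f z)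
    (h2 : ∀ z ∈ U, f z ≠ ⊤) (h3 : ∀ z ∈ U, LocSM f z) : SH f U := by
  refine ⟨h1, h2, fun c r hr hcr G hG hfG => ?_⟩
  apply le_of_forall_eps
  intro ε hε
  obtain ⟨Q, hQ, hQG⟩ := exists_entire (c := c) hr hG hε
  have := maxp hr (fun z hz => usc_within (h1 z (hcr hz)) _) (fun z hz => h2 z (hcr hz))
    (fun z hz => h3 z (hcr (ball_subset_closedBall hz))) hQ
    (fun z hz => (hfG z hz).trans (by exact_mod_cast (hQG z hz).1)) c (by simp [hr.le])
  refine this.trans ?_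
  rw [← mean_re hQ c r]
  have hle : Real.circleAverage (fun z => (Q z).re) c r ≤
      Real.circleAverage (fun z => G z + ε) c r := by
    apply Real.circleAverage_mono
    · exact circleIntegrable (Complex.continuous_re.comp hQ.continuous) _ _
    · exact circleIntegrable (hG.add continuous_const) _ _
    · intro z hz
      rw [abs_of_pos hr] at hz
      exact (hQG z hz).2.le
  rw [Real.circleAverage_fun_add (circleIntegrable hG _ _) (circleIntegrable continuous_const _ _),
    Real.circleAverage_const] at hle
  exact_mod_cast hle

/-- Gluing: subharmonicity is local. -/
theorem SH.glue {f : ℂ → EReal} {U : Set ℂ}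
    (h : ∀ z ∈ U, ∃ (g : ℂ → EReal) (W : Set ℂ), IsOpen W ∧ z ∈ W ∧ SH g W ∧ f =ᶠ[𝓝 z] g) :
    SH f U := by
  apply SH.of_local
  · intro z hz y hy
    obtain ⟨g, W, hW, hzW, hg, hfg⟩ := h z hz
    rw [hfg.eq_of_nhds] at hy
    filter_upwards [hg.1 z hzW y hy, hfg] with w hw1 hw2
    rwa [hw2]
  · intro z hz
    obtain ⟨g, W, hW, hzW, hg, hfg⟩ := h z hz
    rw [hfg.eq_of_nhds]
    exact hg.2.1 z hzW
  · intro z hz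
    obtain ⟨g, W, hW, hzW, hg, hfg⟩ := h z hz
    exact (hg.locSM hW hzW).congr hfg.symm

theorem SH.mono {f : ℂ → EReal} {U V : Set ℂ} (h : SH f U) (hVU : V ⊆ U) : SH f V :=
  ⟨fun z hz => h.1 z (hVU hz), fun z hz => h.2.1 z (hVU hz),
    fun c r hr hcr => h.2.2 c r hr (hcr.trans hVU)⟩

theorem SH.sup {f g : ℂ → EReal} {U : Set ℂ} (hf : SH f U) (hg : SH g U) :
    SH (fun z => max (f z) (g z)) U := by
  refine ⟨fun z hz => (hf.1 z hz).sup (hg.1 z hz), fun z hz => ?_, fun c r hr hcr G hG h => ?_⟩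
  · beta_reduce
    rcases max_choice (f z) (g z) with h | h <;> rw [h]
    · exact hf.2.1 z hz
    · exact hg.2.1 z hz
  · exact max_le (hf.2.2 c r hr hcr G hG fun w hw => (le_max_left _ _).trans_lt (h w hw))
      (hg.2.2 c r hr hcr G hG fun w hw => (le_max_right _ _).trans_lt (h w hw))

theorem SH.iInf {ι : Type*} [Nonempty ι] {f : ι → ℂ → EReal} {U : Set ℂ} (hf : ∀ i, SH (f i) U)
    (hdir : ∀ i j, ∃ k, ∀ x ∈ U, f k x ≤ f i x ∧ f k x ≤ f j x) :
    SH (fun z => ⨅ i, f i z) U := by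
  refine ⟨fun z hz => upperSemicontinuousAt_iInf fun i => (hf i).1 z hz, fun z hz => ?_,
    fun c r hr hcr G hG h => ?_⟩
  · refine ne_top_of_le_ne_top ((hf (Classical.arbitrary ι)).2.1 z hz) (iInf_le _ _)
  · have hsub : sphere c r ⊆ U := sphere_subset_closedBall.trans hcr
    obtain ⟨i, hi⟩ := dini (isCompact_sphere c r) f
      (fun i j => (hdir i j).imp fun k hk x hx => hk x (hsub hx))
      (fun i x hx => usc_within ((hf i).1 x (hsub hx)) _) G hG.continuousOn
      (fun x hx => iInf_lt_iff.1 (h x hx))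
    exact (iInf_le _ i).trans ((hf i).2.2 c r hr hcr G hG hi)

theorem exists_split {x y : EReal} {a : ℝ} (hx : x ≠ ⊤) (hy : y ≠ ⊤) (h : x + y < (a : EReal)) :
    ∃ b d : ℝ, x < (b : EReal) ∧ y < (d : EReal) ∧ b + d < a := by
  induction x with
  | top => exact absurd rfl hx
  | bot =>
    obtain ⟨q, h1, -⟩ := EReal.lt_iff_exists_real_btwn.1 (lt_top_iff_ne_top.2 hy)
    exact ⟨a - q - 1, q, EReal.bot_lt_coe _, h1, by linarith⟩
  | coe x =>
    induction y with
    | top => exact absurd rfl hy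
    | bot => exact ⟨x + 1, a - x - 2, by exact_mod_cast (by linarith), EReal.bot_lt_coe _,
        by linarith⟩
    | coe y =>
      have h' : x + y < a := by exact_mod_cast h
      exact ⟨x + (a - x - y) / 3, y + (a - x - y) / 3, by exact_mod_cast (by linarith),
        by exact_mod_cast (by linarith), by linarith⟩

theorem SH.add {f g : ℂ → EReal} {U : Set ℂ} (hf : SH f U) (hg : SH g U) :
    SH (fun z => f z + g z) U := by
  refine ⟨fun z hz => ?_, fun z hz => ?_, fun c r hr hcr G hG h => ?_⟩
  · exact (hf.1 z hz).add' (hg.1 z hz)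
      (EReal.continuousAt_add (.inl (hf.2.1 z hz)) (.inr (hg.2.1 z hz)))
  · exact EReal.add_ne_top (hf.2.1 z hz) (hg.2.1 z hz)
  · have hsub : sphere c r ⊆ U := sphere_subset_closedBall.trans hcr
    have u1 := fun x (hx : x ∈ sphere c r) => usc_within (hf.1 x (hsub hx)) (sphere c r)
    have u2 := fun x (hx : x ∈ sphere c r) => usc_within (hg.1 x (hsub hx)) (sphere c r)
    have t1 := fun x (hx : x ∈ sphere c r) => hf.2.1 x (hsub hx)
    have t2 := fun x (hx : x ∈ sphere c r) => hg.2.1 x (hsub hx)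
    have := maj_nonempty (isCompact_sphere c r) u1 t1
    have := maj_nonempty (isCompact_sphere c r) u2 t2
    obtain ⟨⟨A, B⟩, hAB⟩ := dini (ι := Maj f (sphere c r) × Maj g (sphere c r))
      (isCompact_sphere c r) (fun p z => ((p.1.1 z + p.2.1 z : ℝ) : EReal))
      (fun i j => ⟨⟨i.1.inf j.1, i.2.inf j.2⟩, fun x _ =>
        ⟨EReal.coe_le_coe_iff.2 (add_le_add (min_le_left _ _) (min_le_left _ _)),
          EReal.coe_le_coe_iff.2 (add_le_add (min_le_right _ _) (min_le_right _ _))⟩⟩)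
      (fun i x _ => usc_coe (i.1.2.1.add i.2.2.1).continuousWithinAt) G hG.continuousOn (by
        intro x hx
        obtain ⟨b, d, hb, hd, hbd⟩ := exists_split (t1 x hx) (t2 x hx) (h x hx)
        obtain ⟨A, hA1, hA2, hA3⟩ := exists_majorant (isCompact_sphere c r) u1 t1 hx hb
        obtain ⟨B, hB1, hB2, hB3⟩ := exists_majorant (isCompact_sphere c r) u2 t2 hx hd
        refine ⟨⟨⟨A, hA1, hA2⟩, ⟨B, hB1, hB2⟩⟩, ?_⟩
        simp only [hA3, hB3]
        exact_mod_cast hbd)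
    have h1 := hf.2.2 c r hr hcr A.1 A.2.1 A.2.2
    have h2 := hg.2.2 c r hr hcr B.1 B.2.1 B.2.2
    refine (add_le_add h1 h2).trans ?_
    rw [← EReal.coe_add, EReal.coe_le_coe_iff, ← Real.circleAverage_fun_add
      (circleIntegrable A.2.1 _ _) (circleIntegrable B.2.1 _ _)]
    apply Real.circleAverage_mono
    · exact circleIntegrable (A.2.1.add B.2.1) _ _
    · exact circleIntegrable hG _ _
    · intro z hz
      rw [abs_of_pos hr] at hz
      exact EReal.coe_le_coe_iff.1 (hAB z hz).le

theorem affine_lt {x : EReal} {a b y : ℝ} (ha : 0 < a) :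
    (a : EReal) * x + (b : EReal) < (y : EReal) ↔ x < (((y - b) / a : ℝ) : EReal) := by
  induction x with
  | top => simp [EReal.coe_mul_top_of_pos ha]
  | bot => simp [EReal.coe_mul_bot_of_pos ha, EReal.bot_lt_coe]
  | coe x =>
    rw [← EReal.coe_mul, ← EReal.coe_add, EReal.coe_lt_coe_iff, EReal.coe_lt_coe_iff,
      lt_div_iff₀ ha]
    constructor <;> intro h <;> nlinarith

theorem SH.affine {f : ℂ → EReal} {U : Set ℂ} (hf : SH f U) {a : ℝ} (ha : 0 < a) (b : ℝ) :
    SH (fun z => (a : EReal) * f z + (b : EReal)) U := by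
  have htop : ∀ z ∈ U, (a : EReal) * f z + (b : EReal) ≠ ⊤ := by
    intro z hz
    have := hf.2.1 z hz
    induction h : f z with
    | top => exact absurd h this
    | bot => simp [EReal.coe_mul_bot_of_pos ha]
    | coe x => rw [← EReal.coe_mul, ← EReal.coe_add]; exact EReal.coe_ne_top _
  refine ⟨fun z hz y hy => ?_, htop, fun c r hr hcr G hG h => ?_⟩
  · obtain ⟨q, h1, h2⟩ := EReal.lt_iff_exists_real_btwn.1 hy
    filter_upwards [hf.1 z hz _ ((affine_lt ha).1 h1)] with w hw
    exact ((affine_lt ha).2 hw).trans h2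
  · have h1 := hf.2.2 c r hr hcr (fun z => (G z - b) / a) (by fun_prop)
      (fun w hw => (affine_lt ha).1 (h w hw))
    have e : Real.circleAverage (fun z => (G z - b) / a) c r = (Real.circleAverage G c r - b) / a := by
      have e1 : (fun z => (G z - b) / a) = fun z => a⁻¹ • (G z + -b) := by
        funext z; rw [smul_eq_mul]; field_simp; ring
      rw [e1, Real.circleAverage_fun_smul, Real.circleAverage_fun_add (circleIntegrable hG _ _)
        (circleIntegrable continuous_const _ _), Real.circleAverage_const, smul_eq_mul]
      field_simp; ring
    rw [e] at h1
    apply le_of_forall_eps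
    intro ε hε
    refine ((affine_lt ha).2 (h1.trans_lt ?_)).le
    rw [EReal.coe_lt_coe_iff]
    gcongr
    linarith


theorem SH_entire {Q : ℂ → ℂ} (hQ : Differentiable ℂ Q) (U : Set ℂ) :
    SH (fun z => ((Q z).re : EReal)) U := by
  have hc : Continuous fun z => (Q z).re := Complex.continuous_re.comp hQ.continuous
  refine ⟨fun z _ => ?_, fun z _ => EReal.coe_ne_top _, fun c r hr _ G hG h => ?_⟩
  · exact (continuous_coe_real_ereal.comp hc).upperSemicontinuous z
  · rw [EReal.coe_le_coe_iff, ← mean_re hQ c r]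
    apply Real.circleAverage_mono (circleIntegrable hc _ _) (circleIntegrable hG _ _)
    intro z hz
    rw [abs_of_pos hr] at hz
    exact EReal.coe_le_coe_iff.1 (h z hz).le

theorem SH.maxp {f : ℂ → EReal} {U : Set ℂ} (hU : IsOpen U) (hf : SH f U) {c : ℂ} {r : ℝ}
    (hr : 0 < r) (hcr : closedBall c r ⊆ U) {Q : ℂ → ℂ} (hQ : Differentiable ℂ Q)
    (hb : ∀ z ∈ sphere c r, f z < ((Q z).re : EReal)) :
    ∀ z ∈ closedBall c r, f z ≤ ((Q z).re : EReal) :=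
  PG.maxp hr (fun z hz => usc_within (hf.1 z (hcr hz)) _) (fun z hz => hf.2.1 z (hcr hz))
    (fun z hz => hf.locSM hU (hcr (ball_subset_closedBall hz))) hQ hb

theorem between {f : ℂ → EReal} {c : ℂ} {r : ℝ} (hr : 0 < r)
    (husc : ∀ x ∈ sphere c r, UpperSemicontinuousWithinAt f (sphere c r) x)
    (htop : ∀ x ∈ sphere c r, f x ≠ ⊤) {G : ℂ → ℝ} (hG : Continuous G)
    (h : ∀ x ∈ sphere c r, f x < (G x : EReal)) :
    ∃ Q : ℂ → ℂ, Differentiable ℂ Q ∧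
      ∀ z ∈ sphere c r, f z < ((Q z).re : EReal) ∧ (Q z).re < G z := by
  have := maj_nonempty (isCompact_sphere c r) husc htop
  obtain ⟨A, hA⟩ := dini (isCompact_sphere c r)
    (fun (A : Maj f (sphere c r)) z => (A.1 z : EReal))
    (fun i j => ⟨i.inf j, fun x _ => ⟨EReal.coe_le_coe_iff.2 (min_le_left _ _),
      EReal.coe_le_coe_iff.2 (min_le_right _ _)⟩⟩)
    (fun i x _ => usc_coe i.2.1.continuousWithinAt) G hG.continuousOn (by
      intro x hx
      obtain ⟨q, h1, h2⟩ := EReal.lt_iff_exists_real_btwn.1 (h x hx)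
      obtain ⟨A, hA1, hA2, hA3⟩ := exists_majorant (isCompact_sphere c r) husc htop hx h1
      exact ⟨⟨A, hA1, hA2⟩, by simp only [hA3]; exact h2⟩)
  have hne : (sphere c r).Nonempty := NormedSpace.sphere_nonempty.2 hr.le
  obtain ⟨w, hw, hmin⟩ := (isCompact_sphere c r).exists_isMinOn hne
    (hG.sub A.2.1).continuousOn
  have hgap : 0 < G w - A.1 w := by
    have := EReal.coe_lt_coe_iff.1 (hA w hw)
    linarith
  obtain ⟨Q, hQ, hQA⟩ := exists_entire (c := c) hr A.2.1 hgap
  refine ⟨Q, hQ, fun z hz => ⟨(A.2.2 z hz).trans (EReal.coe_lt_coe_iff.2 (hQA z hz).1), ?_⟩⟩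
  have h1 : G w - A.1 w ≤ G z - A.1 z := hmin hz
  have h2 := (hQA z hz).2
  linarith

theorem poisson_mod {f : ℂ → EReal} {U : Set ℂ} (hU : IsOpen U) (hf : SH f U) {c : ℂ} {ρ : ℝ}
    (hρ : 0 < ρ) (hcb : closedBall c ρ ⊆ U) (hc : f c ≠ ⊥) :
    ∃ f' : ℂ → EReal, SH f' U ∧ (∀ z, f z ≤ f' z) ∧ (∀ z, z ∉ ball c ρ → f' z = f z) ∧
      ∃ m : ℝ, ∀ z ∈ ball c (ρ / 2), (m : EReal) ≤ f' z := by
  classical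
  have hsub : sphere c ρ ⊆ U := sphere_subset_closedBall.trans hcb
  have husc : ∀ x ∈ sphere c ρ, UpperSemicontinuousWithinAt f (sphere c ρ) x :=
    fun x hx => usc_within (hf.1 x (hsub hx)) _
  have htop : ∀ x ∈ sphere c ρ, f x ≠ ⊤ := fun x hx => hf.2.1 x (hsub hx)
  obtain ⟨M, hM⟩ := exists_bound (isCompact_sphere c ρ) husc htop
  let ι := {Q : ℂ → ℂ // Differentiable ℂ Q ∧
    ∀ z ∈ sphere c ρ, f z < ((Q z).re : EReal) ∧ (Q z).re < M}
  have mk : ∀ G : ℂ → ℝ, Continuous G → (∀ x ∈ sphere c ρ, f x < (G x : EReal)) →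
      ∃ i : ι, ∀ z ∈ sphere c ρ, (i.1 z).re < G z := by
    intro G hG hfG
    obtain ⟨Q, hQ, hQ2⟩ := between hρ husc htop (G := fun z => min (G z) M)
      (hG.min continuous_const) (fun x hx => by
        rcases min_choice (G x) M with h | h <;> simp only [h]
        · exact hfG x hx
        · exact hM x hx)
    exact ⟨⟨Q, hQ, fun z hz => ⟨(hQ2 z hz).1, (hQ2 z hz).2.trans_le (min_le_right _ _)⟩⟩,
      fun z hz => (hQ2 z hz).2.trans_le (min_le_left _ _)⟩
  have : Nonempty ι := ⟨(mk (fun _ => M) continuous_const hM).choose⟩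
  have hcont : ∀ i : ι, Continuous fun z => (i.1 z).re :=
    fun i => Complex.continuous_re.comp i.2.1.continuous
  let g : ℂ → EReal := fun z => ⨅ i : ι, ((i.1 z).re : EReal)
  have hg : SH g (ball c ρ) := by
    refine SH.iInf (fun i => SH_entire i.2.1 _) fun i j => ?_
    obtain ⟨k, hk⟩ := mk (fun z => min (i.1 z).re (j.1 z).re) ((hcont i).min (hcont j))
      (fun x hx => by
        rcases min_choice (i.1 x).re (j.1 x).re with h | h <;> simp only [h]
        · exact (i.2.2 x hx).1
        · exact (j.2.2 x hx).1)
    refine ⟨k, fun x hx => ⟨?_, ?_⟩⟩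
    · exact (SH_entire k.2.1 univ).maxp isOpen_univ hρ (subset_univ _) i.2.1 (fun z hz =>
        EReal.coe_lt_coe_iff.2 ((hk z hz).trans_le (min_le_left _ _))) x (ball_subset_closedBall hx)
    · exact (SH_entire k.2.1 univ).maxp isOpen_univ hρ (subset_univ _) j.2.1 (fun z hz =>
        EReal.coe_lt_coe_iff.2 ((hk z hz).trans_le (min_le_right _ _))) x (ball_subset_closedBall hx)
  have hfi : ∀ i : ι, ∀ z ∈ closedBall c ρ, f z ≤ ((i.1 z).re : EReal) :=
    fun i => hf.maxp hU hρ hcb i.2.1 fun z hz => (i.2.2 z hz).1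
  have hiM : ∀ i : ι, ∀ z ∈ closedBall c ρ, (i.1 z).re ≤ M := by
    intro i z hz
    have := (SH_entire i.2.1 univ).maxp isOpen_univ hρ (subset_univ _) (Q := fun _ => (M : ℂ))
      (by fun_prop) (fun z hz => by
        rw [Complex.ofReal_re]; exact EReal.coe_lt_coe_iff.2 (i.2.2 z hz).2) z hz
    rw [Complex.ofReal_re] at this
    exact EReal.coe_le_coe_iff.1 this
  let f' : ℂ → EReal := fun z => if z ∈ ball c ρ then g z else f z
  have hin : ∀ z ∈ ball c ρ, f' z = g z := fun z hz => if_pos hz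
  have hout : ∀ z, z ∉ ball c ρ → f' z = f z := fun z hz => if_neg hz
  have hle : ∀ z, f z ≤ f' z := by
    intro z
    by_cases hz : z ∈ ball c ρ
    · rw [hin z hz]
      exact le_iInf fun i => hfi i z (ball_subset_closedBall hz)
    · rw [hout z hz]
  have hnear : ∀ z ∈ ball c ρ, f' =ᶠ[𝓝 z] g := fun z hz => by
    filter_upwards [isOpen_ball.mem_nhds hz] with w hw using hin w hw
  refine ⟨f', SH.of_local ?_ ?_ ?_, hle, hout, ?_⟩
  · intro z hz
    by_cases hzb : z ∈ ball c ρ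
    · intro y hy
      rw [(hnear z hzb).eq_of_nhds] at hy
      filter_upwards [hg.1 z hzb y hy, hnear z hzb] with w h1 h2
      rwa [h2]
    · intro y hy
      rw [hout z hzb] at hy
      by_cases hzs : z ∈ sphere c ρ
      · obtain ⟨q, h1, h2⟩ := EReal.lt_iff_exists_real_btwn.1 hy
        obtain ⟨G, hG1, hG2, hG3⟩ := exists_majorant (isCompact_sphere c ρ) husc htop hzs h1
        obtain ⟨i, hi⟩ := mk G hG1 hG2
        have h3 : (i.1 z).re < q := by rw [← hG3]; exact hi z hzs
        filter_upwards [hf.1 z hz _ h1, (hcont i).continuousAt.eventually (gt_mem_nhds h3)]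
          with w hw1 hw2
        by_cases hw : w ∈ ball c ρ
        · rw [hin w hw]
          exact (iInf_le _ i).trans_lt ((EReal.coe_lt_coe_iff.2 hw2).trans h2)
        · rw [hout w hw]; exact hw1.trans h2
      · have hzc : z ∉ closedBall c ρ := by
          intro h
          rw [← ball_union_sphere] at h
          exact h.elim hzb hzs
        filter_upwards [hf.1 z hz y hy, isClosed_closedBall.isOpen_compl.mem_nhds hzc] with w h1 h2
        rw [hout w fun h => h2 (ball_subset_closedBall h)]
        exact h1
  · intro z hz
    by_cases hzb : z ∈ ball c ρ
    · rw [hin z hzb]; exact hg.2.1 z hzb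
    · rw [hout z hzb]; exact hf.2.1 z hz
  · intro z hz
    by_cases hzb : z ∈ ball c ρ
    · exact (hg.locSM isOpen_ball hzb).congr (hnear z hzb).symm
    · obtain ⟨ε, hε, h⟩ := hf.locSM hU hz
      refine ⟨ε, hε, fun s hs hsε G hG hfG => ?_⟩
      rw [hout z hzb]
      exact h s hs hsε G hG fun w hw => (hle w).trans_lt (hfG w hw)
  · have hcU : c ∈ U := hcb (mem_closedBall_self hρ.le)
    obtain ⟨k, hk⟩ : ∃ k : ℝ, f c = k :=
      ⟨(f c).toReal, (EReal.coe_toReal (hf.2.1 c hcU) hc).symm⟩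
    refine ⟨k - 2 * (M - k + 1), fun z hz => ?_⟩
    have hzρ : z ∈ ball c ρ := ball_subset_ball (by linarith) hz
    rw [hin z hzρ]
    refine le_iInf fun i => EReal.coe_le_coe_iff.2 ?_
    have hkc : k ≤ (i.1 c).re := by
      have := hfi i c (mem_closedBall_self hρ.le)
      rw [hk] at this
      exact EReal.coe_le_coe_iff.1 this
    have hMc := hiM i c (mem_closedBall_self hρ.le)
    have hzn : ‖z - c‖ < ρ / 2 := by rw [← dist_eq_norm]; exact hz
    have hBC := Complex.borelCaratheodory_zero (f := fun w => i.1 (c + w) - i.1 c) (R := ρ)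
      (M := M - k + 1) (z := z - c) (by linarith)
      (by
        have := i.2.1
        exact (by fun_prop : Differentiable ℂ fun w => i.1 (c + w) - i.1 c).differentiableOn)
      (by
        intro w hw
        have hw' : c + w ∈ closedBall c ρ := by
          rw [mem_ball_zero_iff] at hw
          rw [mem_closedBall, dist_eq_norm, add_sub_cancel_left]; exact hw.le
        have := hiM i _ hw'
        simp only [mem_ofPred_eq, Complex.sub_re]
        linarith) hρ (by rw [mem_ball_zero_iff]; linarith) (by simp)
    have h2 : 2 * (M - k + 1) * ‖z - c‖ / (ρ - ‖z - c‖) ≤ 2 * (M - k + 1) := by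
      rw [div_le_iff₀ (by linarith)]
      have : 0 < 2 * (M - k + 1) := by linarith
      apply mul_le_mul_of_nonneg_left _ this.le
      linarith
    have h3 := (Complex.abs_re_le_norm _).trans (hBC.trans h2)
    simp only [add_sub_cancel, Complex.sub_re] at h3
    have := (abs_le.1 h3).1
    linarith


theorem eq_bot_iff_nat {x : EReal} : x = ⊥ ↔ ∀ n : ℕ, x < ((-(n : ℝ) : ℝ) : EReal) := by
  constructor
  · rintro rfl n; exact EReal.bot_lt_coe _
  · intro h
    rw [EReal.eq_bot_iff_forall_lt]
    intro y
    obtain ⟨n, hn⟩ := exists_nat_gt (-y)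
    exact (h n).trans (EReal.coe_lt_coe_iff.2 (by linarith))

theorem isOpen_lt_of_usc {X : Type*} [TopologicalSpace X] {φ : X → ℂ} (hφ : Continuous φ)
    {f : ℂ → EReal} (hf : ∀ x, UpperSemicontinuousAt f (φ x)) (y : EReal) :
    IsOpen {x | f (φ x) < y} := by
  rw [isOpen_iff_mem_nhds]
  intro x hx
  exact hφ.continuousAt.eventually (hf x y hx)

theorem slice_null {f : ℂ → EReal} {U : Set ℂ} (hf : SH f U) {w : ℂ} {r : ℝ}
    (hr : 0 < r) (hwr : closedBall w r ⊆ U) (hw : f w ≠ ⊥) :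
    volume {θ : ℝ | θ ∈ Ioo (-Real.pi) Real.pi ∧ f (circleMap w r θ) = ⊥} = 0 := by
  have hsub : sphere w r ⊆ U := sphere_subset_closedBall.trans hwr
  have hmem : ∀ θ, circleMap w r θ ∈ sphere w r := circleMap_mem_sphere w hr.le
  have husc : ∀ x ∈ sphere w r, UpperSemicontinuousWithinAt f (sphere w r) x :=
    fun x hx => usc_within (hf.1 x (hsub hx)) _
  have htop : ∀ x ∈ sphere w r, f x ≠ ⊤ := fun x hx => hf.2.1 x (hsub hx)
  set T := {θ : ℝ | θ ∈ Ioo (-Real.pi) Real.pi ∧ f (circleMap w r θ) = ⊥} with hT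
  have hTm : MeasurableSet T := by
    have : T = Ioo (-Real.pi) Real.pi ∩
        ⋂ n : ℕ, {θ | f (circleMap w r θ) < ((-(n : ℝ) : ℝ) : EReal)} := by
      ext θ
      simp only [hT, mem_ofPred_eq, mem_inter_iff, mem_iInter, eq_bot_iff_nat]
    rw [this]
    refine measurableSet_Ioo.inter (MeasurableSet.iInter fun n => ?_)
    exact (isOpen_lt_of_usc (continuous_circleMap w r) (fun θ => hf.1 _ (hsub (hmem θ))) _).measurableSet
  by_contra hne
  obtain ⟨S, hST, hSc, hSpos⟩ := hTm.exists_lt_isCompact (pos_iff_ne_zero.2 hne)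
  have hSfin : volume S ≠ ⊤ := hSc.measure_lt_top.ne
  set σ : ℝ := (volume S).toReal with hσ
  have hσpos : 0 < σ := ENNReal.toReal_pos hSpos.ne' hSfin
  obtain ⟨M, hM⟩ := exists_bound (isCompact_sphere w r) husc htop
  set M0 : ℝ := max M 0 with hM0
  have hM00 : 0 ≤ M0 := le_max_right _ _
  obtain ⟨k, hk⟩ : ∃ k : ℝ, f w = k :=
    ⟨(f w).toReal, (EReal.coe_toReal (hf.2.1 w (hwr (mem_closedBall_self hr.le))) hw).symm⟩
  have hpi := Real.pi_pos
  obtain ⟨n, hn⟩ := exists_nat_gt ((2 * Real.pi * (M0 - k)) / σ)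
  have := maj_nonempty (isCompact_sphere w r) husc htop
  obtain ⟨A, hA⟩ := dini hSc (fun (A : Maj f (sphere w r)) θ => (A.1 (circleMap w r θ) : EReal))
    (fun i j => ⟨i.inf j, fun x _ => ⟨EReal.coe_le_coe_iff.2 (min_le_left _ _),
      EReal.coe_le_coe_iff.2 (min_le_right _ _)⟩⟩)
    (fun i x _ => usc_coe (i.2.1.comp (continuous_circleMap w r)).continuousWithinAt)
    (fun _ => -(n : ℝ)) continuousOn_const (by
      intro θ hθ
      have h1 : f (circleMap w r θ) < ((-(n : ℝ) - 1 : ℝ) : EReal) := by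
        rw [(hST hθ).2]; exact EReal.bot_lt_coe _
      obtain ⟨A, hA1, hA2, hA3⟩ := exists_majorant (isCompact_sphere w r) husc htop (hmem θ) h1
      refine ⟨⟨A, hA1, hA2⟩, ?_⟩
      simp only [hA3]
      exact EReal.coe_lt_coe_iff.2 (by linarith))
  let B : Maj f (sphere w r) := A.inf ⟨fun _ => M0, continuous_const, fun y hy =>
    (hM y hy).trans_le (EReal.coe_le_coe_iff.2 (le_max_left _ _))⟩
  have hB1 : ∀ z, B.1 z ≤ M0 := fun z => min_le_right _ _
  have hB2 : ∀ θ ∈ S, B.1 (circleMap w r θ) ≤ -(n : ℝ) := fun θ hθ =>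
    (min_le_left _ _).trans (EReal.coe_lt_coe_iff.1 (hA θ hθ)).le
  have h1 := hf.2.2 w r hr hwr B.1 B.2.1 B.2.2
  rw [hk, EReal.coe_le_coe_iff, Real.circleAverage_def, smul_eq_mul] at h1
  have hper : Function.Periodic (fun θ => B.1 (circleMap w r θ)) (2 * Real.pi) := fun θ => by
    simp only [periodic_circleMap w r θ]
  have h2 := hper.intervalIntegral_add_eq 0 (-Real.pi)
  rw [zero_add, show -Real.pi + 2 * Real.pi = Real.pi by ring] at h2
  rw [h2] at h1
  have hBc : Continuous fun θ => B.1 (circleMap w r θ) := B.2.1.comp (continuous_circleMap w r)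
  have hSsub : S ⊆ Ioc (-Real.pi) Real.pi := fun θ hθ => Ioo_subset_Ioc_self (hST hθ).1
  have h3 : (∫ θ in (-Real.pi)..Real.pi, B.1 (circleMap w r θ)) ≤ 2 * Real.pi * M0 - n * σ := by
    rw [intervalIntegral.integral_of_le (by linarith)]
    have hintg : IntegrableOn (fun θ => S.indicator (fun _ => -(n : ℝ) - M0) θ)
        (Ioc (-Real.pi) Real.pi) := by
      apply Integrable.integrableOn
      exact (integrable_indicator_iff hSc.measurableSet).2 (integrableOn_const hSfin)
    calc (∫ θ in Ioc (-Real.pi) Real.pi, B.1 (circleMap w r θ))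
        ≤ ∫ θ in Ioc (-Real.pi) Real.pi, (M0 + S.indicator (fun _ => -(n : ℝ) - M0) θ) := by
          apply setIntegral_mono_on
          · exact (hBc.integrableOn_Icc).mono_set Ioc_subset_Icc_self
          · exact (integrableOn_const (by simp)).add hintg
          · exact measurableSet_Ioc
          · intro θ _
            by_cases hθ : θ ∈ S
            · simp only [indicator_of_mem hθ]; linarith [hB2 θ hθ]
            · simp only [indicator_of_notMem hθ]; linarith [hB1 (circleMap w r θ)]
      _ = 2 * Real.pi * M0 + σ * (-(n : ℝ) - M0) := by
          rw [integral_add (integrable_const M0) hintg,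
            setIntegral_indicator hSc.measurableSet, inter_eq_self_of_subset_right hSsub]
          simp only [integral_const, smul_eq_mul, MeasurableSet.univ, measureReal_restrict_apply,
            univ_inter, Real.volume_real_Ioc]
          rw [max_eq_left (by linarith), measureReal_def]
          ring
      _ ≤ _ := by nlinarith
  have h4 : k ≤ (2 * Real.pi)⁻¹ * (2 * Real.pi * M0 - n * σ) :=
    h1.trans (mul_le_mul_of_nonneg_left h3 (by positivity))
  rw [inv_mul_eq_div, le_div_iff₀ (by positivity)] at h4
  rw [div_lt_iff₀ hσpos] at hn
  linarith

theorem ball_null {f : ℂ → EReal} {U : Set ℂ} (hf : SH f U) {w : ℂ} {R : ℝ}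
    (hwR : ball w R ⊆ U) (hw : f w ≠ ⊥) :
    volume {z | z ∈ ball w R ∧ f z = ⊥} = 0 := by
  set N := {z | z ∈ ball w R ∧ f z = ⊥} with hN
  have hNm : MeasurableSet N := by
    have : N = ⋂ n : ℕ, {z | z ∈ ball w R ∧ f z < ((-(n : ℝ) : ℝ) : EReal)} := by
      ext z
      simp only [hN, mem_ofPred_eq, mem_iInter, eq_bot_iff_nat]
      constructor
      · exact fun h n => ⟨h.1, h.2 n⟩
      · exact fun h => ⟨(h 0).1, fun n => (h n).2⟩
    rw [this]
    refine MeasurableSet.iInter fun n => IsOpen.measurableSet ?_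
    rw [isOpen_iff_mem_nhds]
    rintro z ⟨h1, h2⟩
    filter_upwards [isOpen_ball.mem_nhds h1, hf.1 z (hwR h1) _ h2] with y h3 h4 using ⟨h3, h4⟩
  let φ : ℝ × ℝ → ℂ := fun p => w + p.1 * (Real.cos p.2 + Real.sin p.2 * Complex.I)
  have hφ : Continuous φ := by fun_prop
  have hφc : ∀ r θ, φ (r, θ) = circleMap w r θ := by
    intro r θ
    simp only [φ, circleMap, Complex.exp_mul_I, Complex.ofReal_cos, Complex.ofReal_sin]
  let B : Set (ℝ × ℝ) := (Ioi 0 ×ˢ Ioo (-Real.pi) Real.pi) ∩ φ ⁻¹' N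
  have hBm : MeasurableSet B :=
    (measurableSet_Ioi.prod measurableSet_Ioo).inter (hφ.measurable hNm)
  have hB : volume B = 0 := by
    rw [Measure.volume_eq_prod, Measure.measure_prod_null hBm]
    refine Eventually.of_forall fun r => ?_
    simp only [Pi.zero_apply]
    by_cases hr : 0 < r ∧ r < R
    · refine measure_mono_null ?_ (slice_null hf hr.1 ((closedBall_subset_ball hr.2).trans hwR) hw)
      rintro θ ⟨⟨-, h2⟩, h3⟩
      refine ⟨h2, ?_⟩
      have := h3.2
      rwa [hφc] at this
    · convert measure_empty (μ := (volume : Measure ℝ))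
      rw [eq_empty_iff_forall_notMem]
      rintro θ ⟨⟨h1, h2⟩, h3⟩
      have h1' : 0 < r := h1
      have h4 : φ (r, θ) ∈ ball w R := h3.1
      rw [hφc, mem_ball, dist_eq_norm, circleMap_sub_center, norm_circleMap_zero,
        abs_of_pos h1'] at h4
      exact hr ⟨h1', h4⟩
  have h1 : volume N = volume ((fun h => w + h) ⁻¹' N) := (measure_preimage_add _ _ _).symm
  have hm : MeasurableSet ((fun h => w + h) ⁻¹' N) := (measurable_const_add w) hNm
  rw [h1, ← lintegral_indicator_one hm, ← Complex.lintegral_comp_polarCoord_symm,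
    polarCoord_target]
  rw [lintegral_congr_ae (g := fun _ => 0), lintegral_zero]
  rw [EventuallyEq, ae_restrict_iff' (measurableSet_Ioi.prod measurableSet_Ioo)]
  filter_upwards [measure_eq_zero_iff_ae_notMem.1 hB] with p hp hpt
  rw [indicator_of_notMem, smul_zero]
  intro h
  refine hp ⟨hpt, ?_⟩
  rw [mem_preimage, Complex.polarCoord_symm_apply] at h
  exact h

theorem dense_near {f : ℂ → EReal} {U : Set ℂ} (hf : SH f U) {w : ℂ} {R : ℝ}
    (hwR : ball w R ⊆ U) (hw : f w ≠ ⊥) {p : ℂ} {ε : ℝ} (hε : 0 < ε) (hp : ball p ε ⊆ ball w R) :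
    ∃ q ∈ ball p ε, f q ≠ ⊥ := by
  by_contra h
  push Not at h
  have hs : ball p ε ⊆ {z | z ∈ ball w R ∧ f z = ⊥} := fun q hq => ⟨hp hq, h q hq⟩
  have h1 : volume (ball p ε) = 0 := measure_mono_null hs (ball_null hf hwR hw)
  exact (measure_ball_pos volume p hε).ne' h1


theorem log_cont {a z : ℂ} (hz : z ≠ a) (A B : ℝ) :
    ContinuousAt (fun z : ℂ => A * Real.log ‖z - a‖ + B) z := by
  have h : ‖z - a‖ ≠ 0 := norm_ne_zero_iff.2 (sub_ne_zero.2 hz)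
  have h1 : ContinuousAt (fun z : ℂ => ‖z - a‖) z := by fun_prop
  exact ((h1.log h).const_mul A).add_const B

theorem SH_log (a : ℂ) (A B : ℝ) :
    SH (fun z => ((A * Real.log ‖z - a‖ + B : ℝ) : EReal)) {a}ᶜ := by
  refine ⟨fun z hz => ?_, fun z _ => EReal.coe_ne_top _, fun c r hr hcr G hG h => ?_⟩
  · have : ContinuousAt (fun z : ℂ => ((A * Real.log ‖z - a‖ + B : ℝ) : EReal)) z :=
      ContinuousAt.comp (g := fun x : ℝ => (x : EReal))
        continuous_coe_real_ereal.continuousAt (log_cont hz A B)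
    exact this.upperSemicontinuousAt
  · have hca : r < ‖c - a‖ := by
      by_contra hh
      push Not at hh
      have : a ∈ closedBall c r := by rwa [mem_closedBall, dist_comm, dist_eq_norm]
      exact hcr this rfl
    have hne : ∀ w ∈ sphere c r, w ≠ a := fun w hw hwa => hcr (sphere_subset_closedBall hw) hwa
    have hc1 : CircleIntegrable (fun x : ℂ => Real.log ‖x - a‖) c r := by
      apply ContinuousOn.circleIntegrable'
      rw [abs_of_pos hr]
      intro w hw
      have := log_cont (hne w hw) 1 0
      simp only [one_mul, add_zero] at this
      exact this.continuousWithinAt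
    have hc2 : CircleIntegrable (fun x : ℂ => A * Real.log ‖x - a‖) c r := hc1.const_mul A
    have hc3 : CircleIntegrable (fun _ : ℂ => B) c r := circleIntegrable continuous_const c r
    have e1 : Real.circleAverage (fun x : ℂ => A * Real.log ‖x - a‖ + B) c r
        = A * Real.log ‖c - a‖ + B := by
      have h1 := Real.circleAverage_fun_add hc2 hc3
      rw [h1, Real.circleAverage_const]
      have h2 := Real.circleAverage_fun_smul (a := A) (f := fun x : ℂ => Real.log ‖x - a‖)
        (c := c) (R := r)
      simp only [smul_eq_mul] at h2
      rw [h2, circleAverage_log_norm_sub_const_eq_log_radius_add_posLog hr.ne',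
        Real.posLog_eq_log, Real.log_mul, Real.log_inv]
      · ring
      · positivity
      · linarith
      · rw [abs_of_nonneg (by positivity), ← div_eq_inv_mul, le_div_iff₀ hr]
        linarith
    have : A * Real.log ‖c - a‖ + B ≤ Real.circleAverage G c r := by
      rw [← e1]
      apply Real.circleAverage_mono (hc2.add hc3) (circleIntegrable hG c r)
      intro w hw
      rw [abs_of_pos hr] at hw
      have h5 := (h w hw).le
      exact EReal.coe_le_coe_iff.1 h5
    exact EReal.coe_le_coe_iff.2 this

theorem sphere_bdd {f : ℂ → EReal} {V : Set ℂ} (hV : IsOpen V) (hf : SH f V) {a : ℂ} {R : ℝ}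
    (hR : 0 < R) (hb : ball a (3 * R) ⊆ V) (ha : f a ≠ ⊥) :
    ∃ f' : ℂ → EReal, SH f' V ∧ (∀ z ∈ ball a R, f' z = f z) ∧
      ∃ m : ℝ, ∀ z ∈ sphere a (2 * R), ∀ᶠ w in 𝓝 z, (m : EReal) ≤ f' w := by
  suffices H : ∃ f' : ℂ → EReal, SH f' V ∧ (∀ z ∈ ball a R, f' z = f z) ∧
      ∃ m : ℝ, ∀ z ∈ sphere a (2 * R) ∩ sphere a (2 * R), ∀ᶠ w in 𝓝 z, (m : EReal) ≤ f' w by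
    simpa using H
  refine (isCompact_sphere a (2 * R)).induction_on
    (p := fun s => ∃ f' : ℂ → EReal, SH f' V ∧ (∀ z ∈ ball a R, f' z = f z) ∧
      ∃ m : ℝ, ∀ z ∈ s ∩ sphere a (2 * R), ∀ᶠ w in 𝓝 z, (m : EReal) ≤ f' w) ?_ ?_ ?_ ?_
  · exact ⟨f, hf, fun _ _ => rfl, 0, by simp⟩
  · rintro s t hst ⟨f', h1, h2, m, h3⟩
    exact ⟨f', h1, h2, m, fun z hz => h3 z ⟨hst hz.1, hz.2⟩⟩
  · rintro s t ⟨f', h1, h2, m, h3⟩ ⟨g', k1, k2, n, k3⟩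
    refine ⟨_, h1.sup k1, fun z hz => by rw [h2 z hz, k2 z hz, max_self], min m n, ?_⟩
    rintro z ⟨hz | hz, hz'⟩
    · filter_upwards [h3 z ⟨hz, hz'⟩] with w hw
      exact le_trans (by exact_mod_cast min_le_left m n) (hw.trans (le_max_left _ _))
    · filter_upwards [k3 z ⟨hz, hz'⟩] with w hw
      exact le_trans (by exact_mod_cast min_le_right m n) (hw.trans (le_max_right _ _))
  · intro z hz
    rw [mem_sphere] at hz
    obtain ⟨c, hc, hcb⟩ := dense_near hf hb ha (p := z) (ε := R / 16) (by positivity) (by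
      apply ball_subset_ball'
      rw [hz]; linarith)
    rw [mem_ball] at hc
    have hca : dist c a ≤ 2 * R + R / 16 := by
      have := dist_triangle c z a
      linarith
    have hca' : 2 * R - R / 16 ≤ dist c a := by
      have := dist_triangle z c a
      rw [dist_comm z c] at this
      linarith
    obtain ⟨f', h1, h2, h3, m, h4⟩ := poisson_mod hV hf (ρ := R / 4) (by positivity)
      (c := c) (by
        refine (closedBall_subset_ball' ?_).trans hb
        linarith) hcb
    refine ⟨ball z (R / 16), mem_nhdsWithin_of_mem_nhds (ball_mem_nhds _ (by positivity)),
      f', h1, fun w hw => h3 w fun hw' => ?_, m, ?_⟩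
    · rw [mem_ball] at hw hw'
      have := dist_triangle c w a
      rw [dist_comm c w] at this
      linarith
    · rintro w ⟨hw, -⟩
      have : w ∈ ball c (R / 4 / 2) := by
        rw [mem_ball] at hw ⊢
        have := dist_triangle w z c
        rw [dist_comm z c] at this
        linarith
      filter_upwards [isOpen_ball.mem_nhds this] with y hy using h4 y hy

theorem global_piece {f : ℂ → EReal} {V : Set ℂ} (hV : IsOpen V) (hf : SH f V) {a : ℂ} {R : ℝ}
    (hR : 0 < R) (hb : ball a (3 * R) ⊆ V) (ha : f a ≠ ⊥) :
    ∃ u : ℂ → EReal, SH u univ ∧ ∀ z ∈ ball a R, u z = f z := by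
  obtain ⟨f', h1, h2, m, h3⟩ := sphere_bdd hV hf hR hb ha
  have hVd : ∀ z, dist z a < 3 * R → z ∈ V := fun z hz => hb hz
  obtain ⟨M, hM⟩ := exists_bound (isCompact_sphere a (5 / 2 * R)) (f := f')
    (fun x hx => usc_within (h1.1 x (hVd x (by rw [mem_sphere.1 hx]; linarith))) _)
    (fun x hx => h1.2.1 x (hVd x (by rw [mem_sphere.1 hx]; linarith)))
  have hL : Real.log (2 * R) < Real.log (5 / 2 * R) :=
    Real.log_lt_log (by positivity) (by linarith)
  set A := (M - m + 1) / (Real.log (5 / 2 * R) - Real.log (2 * R)) with hA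
  set B := m - 1 - A * Real.log (2 * R) with hB
  have hA' : A * (Real.log (5 / 2 * R) - Real.log (2 * R)) = M - m + 1 := by
    rw [hA, div_mul_cancel₀ _ (sub_ne_zero.2 hL.ne')]
  let v : ℂ → ℝ := fun z => A * Real.log ‖z - a‖ + B
  have hv : SH (fun z => (v z : EReal)) {a}ᶜ := SH_log a A B
  have hvc : ∀ z, z ≠ a → ContinuousAt v z := fun z hz => log_cont hz A B
  have hv1 : ∀ z, dist z a = 2 * R → v z = m - 1 := by
    intro z hz
    simp only [v]
    rw [← dist_eq_norm, hz, hB]; ring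
  have hv2 : ∀ z, dist z a = 5 / 2 * R → v z = M := by
    intro z hz
    simp only [v]
    rw [← dist_eq_norm, hz, hB]; linarith
  have hne : ∀ z, 0 < dist z a → z ≠ a := fun z hz => dist_pos.1 hz
  let u : ℂ → EReal := fun z => if dist z a ≤ 2 * R then f' z else
    if dist z a < 5 / 2 * R then max (f' z) (v z) else (v z : EReal)
  have hcd : Continuous (fun z : ℂ => dist z a) := by fun_prop
  refine ⟨u, SH.glue fun z _ => ?_, fun z hz => ?_⟩
  · rcases lt_trichotomy (dist z a) (2 * R) with hz | hz | hz
    · refine ⟨f', V, hV, hVd z (by linarith), h1, ?_⟩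
      filter_upwards [(isOpen_lt hcd continuous_const).mem_nhds hz] with w hw
      have hw' : dist w a < 2 * R := hw
      simp only [u, if_pos hw'.le]
    · refine ⟨f', V, hV, hVd z (by linarith), h1, ?_⟩
      have hz5 : dist z a < 5 / 2 * R := by linarith
      have hvm : ∀ᶠ w in 𝓝 z, v w < m :=
        (hvc z (hne z (by linarith))).eventually_lt_const (by rw [hv1 z hz]; linarith)
      filter_upwards [(isOpen_lt hcd continuous_const).mem_nhds hz5, h3 z hz, hvm]
        with w hw hw1 hw2
      have hw' : dist w a < 5 / 2 * R := hw
      have : (v w : EReal) ≤ f' w := le_trans (by exact_mod_cast hw2.le) hw1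
      simp only [u, if_pos hw', max_eq_left this, ite_self]
    rcases lt_trichotomy (dist z a) (5 / 2 * R) with hz2 | hz2 | hz2
    · refine ⟨_, V ∩ {a}ᶜ, hV.inter isOpen_compl_singleton,
        ⟨hVd z (by linarith), hne z (by linarith)⟩,
        (h1.mono inter_subset_left).sup (hv.mono inter_subset_right), ?_⟩
      filter_upwards [(isOpen_lt hcd continuous_const).mem_nhds hz2,
        (isOpen_lt continuous_const hcd).mem_nhds hz] with w hw hw2
      have hw' : dist w a < 5 / 2 * R := hw
      have hw2' : 2 * R < dist w a := hw2
      simp only [u, if_pos hw', if_neg hw2'.not_ge]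
    · refine ⟨_, {a}ᶜ, isOpen_compl_singleton, hne z (by linarith), hv, ?_⟩
      have hlt := lt_nhds (K := univ) (x := z) (f := f') (G := v)
        (usc_within (h1.1 z (hVd z (by linarith))) _)
        (hvc z (hne z (by linarith))).continuousWithinAt
        (by rw [hv2 z hz2]; exact hM z hz2)
      rw [nhdsWithin_univ] at hlt
      filter_upwards [hlt, (isOpen_lt continuous_const hcd).mem_nhds hz] with w hw hw2
      have hw2' : 2 * R < dist w a := hw2
      simp only [u, if_neg hw2'.not_ge, max_eq_right hw.le, ite_self]
    · refine ⟨_, {a}ᶜ, isOpen_compl_singleton, hne z (by linarith), hv, ?_⟩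
      filter_upwards [(isOpen_lt continuous_const hcd).mem_nhds hz,
        (isOpen_lt continuous_const hcd).mem_nhds hz2] with w hw hw2
      have hw' : 2 * R < dist w a := hw
      have hw2' : 5 / 2 * R < dist w a := hw2
      simp only [u, if_neg hw'.not_ge, if_neg hw2'.not_gt]
  · rw [mem_ball] at hz
    have : dist z a ≤ 2 * R := by linarith
    simp only [u, if_pos this]
    exact h2 z hz


theorem null_univ {u : ℂ → EReal} (hu : SH u univ) {a : ℂ} (ha : u a ≠ ⊥) :
    volume {z | u z = ⊥} = 0 := by
  have : {z | u z = ⊥} ⊆ ⋃ n : ℕ, {z | z ∈ ball a n ∧ u z = ⊥} := by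
    intro z hz
    obtain ⟨n, hn⟩ := exists_nat_gt (dist z a)
    exact mem_iUnion.2 ⟨n, hn, hz⟩
  exact measure_mono_null this (measure_iUnion_null fun n => ball_null hu (subset_univ _) ha)

theorem sum_bot {g : ℕ → EReal} {n j : ℕ} (hj : j < n) (h : g j = ⊥) :
    ∑ i ∈ Finset.range n, g i = ⊥ := by
  rw [← Finset.add_sum_erase _ _ (Finset.mem_range.2 hj), h, EReal.bot_add]

theorem sum_coe (g : ℕ → ℝ) (n : ℕ) :
    ∑ i ∈ Finset.range n, (g i : EReal) = ((∑ i ∈ Finset.range n, g i : ℝ) : EReal) := by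
  induction n with
  | zero => simp
  | succ n ih => rw [Finset.sum_range_succ, Finset.sum_range_succ, ih, EReal.coe_add]

theorem iInf_shift {S : ℕ → EReal} {p q : ℕ} (hp : ∀ n, p ≤ n → S (n + 1) ≤ S n)
    (hq : ∀ n, q ≤ n → S (n + 1) ≤ S n) : ⨅ n, S (n + p) = ⨅ n, S (n + q) := by
  have key : ∀ p q : ℕ, (∀ n, q ≤ n → S (n + 1) ≤ S n) →
      ⨅ n, S (n + p) ≤ ⨅ n, S (n + q) := by
    intro p q hq
    refine le_iInf fun n => (iInf_le _ (n + q)).trans ?_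
    have : ∀ i, S (n + q + i) ≤ S (n + q) := by
      intro i
      induction i with
      | zero => exact le_rfl
      | succ i ih => exact (hq (n + q + i) (by omega)).trans ih
    exact this p
  exact le_antisymm (key p q hq) (key q p hp)

theorem sum_thm {u : ℕ → ℂ → EReal} (hu : ∀ j, SH (u j) univ) (ha : ∀ j, ∃ a, u j a ≠ ⊥) :
    ∃ μ : ℂ → EReal, SH μ univ ∧ (∀ j z, u j z = ⊥ → μ z = ⊥) ∧
      ∀ O : Set ℂ, IsOpen O → O.Nonempty → ∃ w ∈ O, μ w ≠ ⊥ := by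
  choose a ha using ha
  have hnull : volume (⋃ j, {z | u j z = ⊥}) = 0 :=
    measure_iUnion_null fun j => null_univ (hu j) (ha j)
  have hdense : Dense (⋃ j, {z | u j z = ⊥})ᶜ := by
    rw [← interior_eq_empty_iff_dense_compl]
    exact Measure.interior_eq_empty_of_null hnull
  obtain ⟨T, hTs, hTc, hTd⟩ := hdense.exists_countable_dense_subset
  obtain ⟨w, hw⟩ := hTc.exists_eq_range hTd.nonempty
  have hwb : ∀ j k, u j (w k) ≠ ⊥ := by
    intro j k h
    have : w k ∈ T := hw ▸ mem_range_self k
    exact hTs this (mem_iUnion.2 ⟨j, h⟩)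
  have hbd : ∀ j : ℕ, ∃ M : ℝ, ∀ z ∈ closedBall (0 : ℂ) j, u j z < (M : EReal) := fun j =>
    exists_bound (isCompact_closedBall _ _) (fun x _ => usc_within ((hu j).1 x (mem_univ _)) _)
      (fun x _ => (hu j).2.1 x (mem_univ _))
  choose M hM using hbd
  let x : ℕ → ℕ → ℝ := fun j k => (u j (w k)).toReal
  have hx : ∀ j k, u j (w k) = (x j k : EReal) := fun j k =>
    (EReal.coe_toReal ((hu j).2.1 _ (mem_univ _)) (hwb j k)).symm
  let D : ℕ → ℝ := fun j => 1 + ∑ k ∈ Finset.range (j + 1), |x j k - M j|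
  have hD : ∀ j, 0 < D j := fun j => by
    have : 0 ≤ ∑ k ∈ Finset.range (j + 1), |x j k - M j| :=
      Finset.sum_nonneg fun _ _ => abs_nonneg _
    simp only [D]; linarith
  have hDk : ∀ j k, k ≤ j → |x j k - M j| ≤ D j := fun j k hk => by
    have := Finset.single_le_sum (f := fun k => |x j k - M j|) (s := Finset.range (j + 1))
      (fun _ _ => abs_nonneg _) (Finset.mem_range.2 (Nat.lt_succ_of_le hk))
    simp only [D]
    linarith
  let e : ℕ → ℝ := fun j => (1 / 2) ^ j / D j
  have he : ∀ j, 0 < e j := fun j => div_pos (by positivity) (hD j)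
  let t : ℕ → ℂ → EReal := fun j z => (e j : EReal) * u j z + ((-(e j * M j) : ℝ) : EReal)
  have ht : ∀ j, SH (t j) univ := fun j => (hu j).affine (he j) _
  have htn : ∀ (j : ℕ) (z : ℂ), ‖z‖ ≤ j → t j z ≤ 0 := by
    intro j z hz
    have h1 := hM j z (by simpa using hz)
    have h2 : t j z < ((0 : ℝ) : EReal) := by
      refine (affine_lt (he j)).2 ?_
      convert h1 using 2
      have := (he j).ne'
      field_simp
      ring
    exact h2.le
  have htb : ∀ j z, u j z = ⊥ → t j z = ⊥ := by
    intro j z hz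
    simp only [t, hz, EReal.coe_mul_bot_of_pos (he j), EReal.bot_add]
  let S : ℕ → ℂ → EReal := fun n z => ∑ j ∈ Finset.range n, t j z
  have hS : ∀ n, SH (S n) univ := by
    intro n
    induction n with
    | zero =>
      have := (SH_entire (Q := fun _ => 0) (differentiable_const _) univ)
      simpa [S] using this
    | succ n ih =>
      have := ih.add (ht n)
      simpa only [S, Finset.sum_range_succ] using this
  have hSa : ∀ z n, ⌈‖z‖⌉₊ ≤ n → S (n + 1) z ≤ S n z := by
    intro z n hn
    simp only [S, Finset.sum_range_succ]
    have := htn n z (Nat.ceil_le.1 hn)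
    exact add_le_of_nonpos_right this
  let μ : ℂ → EReal := fun z => ⨅ n, S (n + ⌈‖z‖⌉₊) z
  refine ⟨μ, ?_, ?_, ?_⟩
  · refine SH.glue fun z _ => ?_
    obtain ⟨m, hm⟩ := exists_nat_gt ‖z‖
    have hSb : ∀ y ∈ ball (0 : ℂ) m, ∀ n, m ≤ n → S (n + 1) y ≤ S n y := by
      intro y hy n hn
      rw [mem_ball_zero_iff] at hy
      exact hSa y n ((Nat.ceil_le.2 hy.le).trans hn)
    refine ⟨fun z => ⨅ n, S (n + m) z, ball 0 m, isOpen_ball, by simpa using hm,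
      SH.iInf (fun n => (hS _).mono (subset_univ _)) ?_, ?_⟩
    · intro i j
      refine ⟨i + j, fun y hy => ?_⟩
      have : ∀ n k, S (n + m + k) y ≤ S (n + m) y := by
        intro n k
        induction k with
        | zero => exact le_rfl
        | succ k ih => exact (hSb y hy (n + m + k) (by omega)).trans ih
      constructor
      · have := this i j
        rwa [show i + m + j = i + j + m by omega] at this
      · have := this j i
        rwa [show j + m + i = i + j + m by omega] at this
    · filter_upwards [isOpen_ball.mem_nhds (show z ∈ ball (0 : ℂ) m by simpa using hm)] with y hy
      exact iInf_shift (S := fun n => S n y) (hSa y) (hSb y hy)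
  · intro j z hz
    have h1 : S (j + 1 + ⌈‖z‖⌉₊) z = ⊥ :=
      sum_bot (g := fun j => t j z) (j := j) (by omega) (htb j z hz)
    exact le_bot_iff.1 ((iInf_le _ (j + 1)).trans h1.le)
  · intro O hO hOne
    obtain ⟨p, hpO, hpT⟩ := hTd.inter_open_nonempty O hO hOne
    rw [hw] at hpT
    obtain ⟨k, rfl⟩ := hpT
    refine ⟨w k, hpO, ?_⟩
    let y : ℕ → ℝ := fun j => e j * (x j k - M j)
    have hy : ∀ j, t j (w k) = (y j : EReal) := by
      intro j
      simp only [t, y, hx]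
      rw [← EReal.coe_mul, ← EReal.coe_add]
      congr 1; ring
    have hyb : ∀ j, k ≤ j → |y j| ≤ (1 / 2) ^ j := by
      intro j hj
      simp only [y]
      rw [abs_mul, abs_of_pos (he j)]
      have h1 := hDk j k hj
      calc e j * |x j k - M j| ≤ e j * D j := mul_le_mul_of_nonneg_left h1 (he j).le
        _ = _ := div_mul_cancel₀ _ (hD j).ne'
    have hsum : Summable (fun j => |y j|) := by
      rw [← summable_nat_add_iff k]
      refine Summable.of_nonneg_of_le (fun _ => abs_nonneg _) (fun j => hyb (j + k) (by omega)) ?_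
      exact (summable_nat_add_iff k).2 (summable_geometric_of_lt_one (by norm_num) (by norm_num))
    have hlow : ∀ n, ((-(∑' j, |y j|) : ℝ) : EReal) ≤ S n (w k) := by
      intro n
      have h1 : S n (w k) = ((∑ j ∈ Finset.range n, y j : ℝ) : EReal) := by
        rw [← sum_coe]
        exact Finset.sum_congr rfl fun j _ => hy j
      rw [h1, EReal.coe_le_coe_iff]
      have h2 := hsum.sum_le_tsum (Finset.range n) (fun _ _ => abs_nonneg _)
      have h3 := Finset.abs_sum_le_sum_abs y (Finset.range n)
      have h4 := neg_abs_le (∑ j ∈ Finset.range n, y j)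
      linarith
    have h5 : ((-(∑' j, |y j|) : ℝ) : EReal) ≤ μ (w k) := le_iInf fun n => hlow _
    intro h6
    rw [h6] at h5
    exact EReal.coe_ne_bot _ (le_bot_iff.1 h5)

theorem piece {E : Set ℂ} {z : ℂ} {V : Set ℂ} (hV : IsOpen V) (hz : z ∈ V) {f : ℂ → EReal}
    (hf : SH f V) (hne : ∀ t ∈ 𝓝 z, ∃ w ∈ t ∩ V, f w ≠ ⊥) (hE : E ∩ V ⊆ f ⁻¹' {⊥}) :
    ∃ u : ℂ → EReal, ∃ W : Set ℂ, SH u univ ∧ (∃ a, u a ≠ ⊥) ∧ IsOpen W ∧ z ∈ W ∧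
      ∀ y ∈ E ∩ W, u y = ⊥ := by
  obtain ⟨ε, hε, hb⟩ := Metric.isOpen_iff.1 hV z hz
  obtain ⟨a, ⟨ha, -⟩, hab⟩ := hne (ball z (ε / 4)) (ball_mem_nhds _ (by positivity))
  have ha' : dist a z < ε / 4 := ha
  have hsub : ball a (3 * (ε / 4)) ⊆ V := (ball_subset_ball' (by linarith)).trans hb
  obtain ⟨u, hu, huf⟩ := global_piece hV hf (a := a) (R := ε / 4) (by positivity) hsub hab
  have hεp : 0 < ε / 4 := by positivity
  refine ⟨u, ball a (ε / 4), hu, ⟨a, ?_⟩, isOpen_ball, ?_, ?_⟩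
  · rw [huf a (mem_ball_self hεp)]; exact hab
  · rwa [mem_ball, dist_comm]
  · rintro y ⟨hy, hyb⟩
    rw [huf y hyb]
    exact hE ⟨hy, hsub (ball_subset_ball (by linarith) hyb)⟩

theorem main {E Ω : Set ℂ} (hE : E ⊆ Ω)
    (hp : ∀ z ∈ Ω, ∃ V : Set ℂ, IsOpen V ∧ z ∈ V ∧
      ∃ f : ℂ → EReal, SH f V ∧ (∀ t ∈ 𝓝 z, ∃ w ∈ t ∩ V, f w ≠ ⊥) ∧ E ∩ V ⊆ f ⁻¹' {⊥}) :
    ∃ μ : ℂ → EReal, SH μ univ ∧ (∀ O : Set ℂ, IsOpen O → O.Nonempty → ∃ w ∈ O, μ w ≠ ⊥) ∧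
      ∀ z ∈ E, μ z = ⊥ := by
  have h0 : SH (fun _ => (0 : EReal)) univ := by
    have := (SH_entire (Q := fun _ => 0) (differentiable_const _) univ)
    simpa using this
  have h : ∀ z : Ω, ∃ u : ℂ → EReal, ∃ W : Set ℂ, SH u univ ∧ (∃ a, u a ≠ ⊥) ∧ IsOpen W ∧
      (z : ℂ) ∈ W ∧ ∀ y ∈ E ∩ W, u y = ⊥ := by
    intro z
    obtain ⟨V, hV, hzV, f, hf, hne, hEf⟩ := hp z z.2
    exact piece hV hzV hf hne hEf
  choose u W hu hua hW hzW huE using h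
  obtain ⟨T, hTc, hT⟩ := TopologicalSpace.isOpen_iUnion_countable W hW
  rcases T.eq_empty_or_nonempty with rfl | hTne
  · refine ⟨fun _ => 0, h0, fun O _ ⟨x, hx⟩ => ⟨x, hx, by simp⟩, fun z hz => ?_⟩
    have : z ∈ ⋃ i, W i := mem_iUnion.2 ⟨⟨z, hE hz⟩, hzW _⟩
    rw [← hT] at this
    simp at this
  · obtain ⟨s, rfl⟩ := hTc.exists_eq_range hTne
    obtain ⟨μ, h1, h2, h3⟩ := sum_thm (u := fun j => u (s j)) (fun j => hu _) (fun j => hua _)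
    refine ⟨μ, h1, h3, fun z hz => ?_⟩
    have : z ∈ ⋃ i, W i := mem_iUnion.2 ⟨⟨z, hE hz⟩, hzW _⟩
    rw [← hT, biUnion_range] at this
    obtain ⟨j, hj⟩ := mem_iUnion.1 this
    exact h2 j z (huE _ z ⟨hz, hj⟩)

end PG

/-- **Local polarity implies global polarity.**  If `Ω ⊆ ℂ` is open and `E ⊆ Ω`
is polar, then there is a subharmonic function `μ` on `Ω`, not identically `−∞`
on any connected component of `Ω`, with `E ⊆ μ⁻¹(−∞)`. -/
theorem polar_global (Ω : Set ℂ) (hΩ : IsOpen Ω) (E : Set ℂ) (hE : E ⊆ Ω)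
    (hpolar : PolarIn E Ω) :
    ∃ μ : ℂ → EReal, SubharmonicERealOn μ Ω ∧
      (∀ z ∈ Ω, ∃ w ∈ connectedComponentIn Ω z, μ w ≠ ⊥) ∧
      (∀ z ∈ E, μ z = ⊥) := by
  obtain ⟨μ, h1, h2, h3⟩ := PG.main hE (fun z hz => by
    obtain ⟨V, hV, hzV, f, hf, hne, hEf⟩ := hpolar z hz
    exact ⟨V, hV, hzV, f, PG.SH.of_sub hV hf, hne, hEf⟩)
  refine ⟨μ, (h1.mono (subset_univ _)).to_sub, fun z hz => ?_, h3⟩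
  exact h2 _ hΩ.connectedComponentIn ⟨z, mem_connectedComponentIn hz⟩

end
end

section
/- Let Ω be an open set in ℂ and let E be a closed polar subset of Ω. If v is a continuous real-valued function on Ω that is subharmonic on Ω \ E, then v is subharmonic on Ω. -/
open MeasureTheory Metric Set

noncomputable section

/-- Mean value property of real parts of entire functions. -/
theorem avg_re_entire (F : ℂ → ℂ) (hF : Differentiable ℂ F) (p : ℂ) (r : ℝ) :
    (2 * Real.pi)⁻¹ * ∫ θ in (0:ℝ)..(2 * Real.pi), (F (circleMap p r θ)).re = (F p).re := by
  have h1 : Real.circleAverage F p r = F p := (hF.diffContOnCl).circleAverage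
  have h2 := Complex.reCLM.circleAverage_comp_comm (f := F) (c := p) (R := r)
    (hF.continuous.continuousOn.circleIntegrable')
  rw [h1] at h2
  simpa [Real.circleAverage_def] using h2

theorem fourier_entire (c : ℂ) (R : ℝ) (hR : 0 < R) (G : C(AddCircle (2 * Real.pi), ℂ))
    (hG : G ∈ Submodule.span ℂ (Set.range (@fourier (2 * Real.pi)))) :
    ∀ a : ℂ, ∃ F : ℂ → ℂ, Differentiable ℂ F ∧
      ∀ θ : ℝ, (F (circleMap c R θ)).re = (a * G (θ : AddCircle (2 * Real.pi))).re := by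
  have hRC : (R : ℂ) ≠ 0 := by exact_mod_cast hR.ne'
  have hpi : (Real.pi : ℂ) ≠ 0 := by exact_mod_cast Real.pi_ne_zero
  induction hG using Submodule.span_induction with
  | mem x hx =>
    obtain ⟨n, rfl⟩ := hx
    intro a
    have key : ∀ (m : ℕ) (θ : ℝ), ((circleMap c R θ - c) / R) ^ m
        = fourier (m : ℤ) (θ : AddCircle (2 * Real.pi)) := by
      intro m θ
      rw [fourier_coe_apply]
      simp only [circleMap, add_sub_cancel_left]
      rw [mul_div_cancel_left₀ _ hRC, ← Complex.exp_nat_mul]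
      congr 1
      push_cast
      field_simp
    obtain ⟨m, rfl | rfl⟩ := Int.eq_nat_or_neg n
    · refine ⟨fun z => a * ((z - c) / R) ^ m, by fun_prop, fun θ => ?_⟩
      simp only [key]
    · refine ⟨fun z => (starRingEnd ℂ) a * ((z - c) / R) ^ m, by fun_prop, fun θ => ?_⟩
      simp only [key]
      rw [fourier_neg]
      simp only [Complex.mul_re, Complex.conj_re, Complex.conj_im]
      ring
  | zero => exact fun a => ⟨0, by fun_prop, by simp⟩
  | add x y _ _ hx hy =>
    intro a
    obtain ⟨F, hF, h1⟩ := hx a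
    obtain ⟨F', hF', h2⟩ := hy a
    refine ⟨fun z => F z + F' z, by fun_prop, fun θ => ?_⟩
    simp only [Complex.add_re, h1, h2, ContinuousMap.add_apply, mul_add]
  | smul b x _ hx =>
    intro a
    obtain ⟨F, hF, h1⟩ := hx (a * b)
    refine ⟨F, hF, fun θ => ?_⟩
    rw [h1]
    simp [mul_assoc]

theorem approx_circle (c : ℂ) (R : ℝ) (hR : 0 < R) (v : ℂ → ℝ)
    (hv : ContinuousOn v (closedBall c R)) (δ : ℝ) (hδ : 0 < δ) :
    ∃ F : ℂ → ℂ, Differentiable ℂ F ∧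
      ∀ θ : ℝ, |(F (circleMap c R θ)).re - v (circleMap c R θ)| < δ := by
  have hcont : Continuous (fun θ : ℝ => v (circleMap c R θ)) :=
    hv.comp_continuous (continuous_circleMap c R) (circleMap_mem_closedBall c hR.le)
  have hper : Function.Periodic (fun θ : ℝ => (v (circleMap c R θ) : ℂ)) (2 * Real.pi) := by
    intro θ
    simp only [periodic_circleMap c R θ]
  let f : C(AddCircle (2 * Real.pi), ℂ) :=
    ⟨hper.lift, by
      refine (isQuotientMap_quotient_mk'.continuous_iff).2 ?_
      exact Complex.continuous_ofReal.comp hcont⟩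
  have : Fact (0 < 2 * Real.pi) := ⟨Real.two_pi_pos⟩
  have hf : f ∈ (Submodule.span ℂ (Set.range (@fourier (2 * Real.pi)))).topologicalClosure := by
    rw [span_fourier_closure_eq_top]; trivial
  have hf' : f ∈ closure ((Submodule.span ℂ (Set.range (@fourier (2 * Real.pi))) :
    Submodule ℂ C(AddCircle (2 * Real.pi), ℂ)) : Set C(AddCircle (2 * Real.pi), ℂ)) := hf
  obtain ⟨G, hG, hd⟩ := Metric.mem_closure_iff.1 hf' δ hδ
  obtain ⟨F, hF, h⟩ := fourier_entire c R hR G hG 1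
  refine ⟨F, hF, fun θ => ?_⟩
  rw [h θ, one_mul]
  have h1 : dist (f (θ : AddCircle (2 * Real.pi))) (G θ) < δ :=
    (ContinuousMap.dist_apply_le_dist _).trans_lt hd
  have h2 : f (θ : AddCircle (2 * Real.pi)) = (v (circleMap c R θ) : ℂ) := rfl
  rw [h2, dist_comm, dist_eq_norm] at h1
  refine lt_of_le_of_lt ?_ h1
  simpa using Complex.abs_re_le_norm (G (θ : AddCircle (2 * Real.pi)) - (v (circleMap c R θ) : ℂ))

theorem norm_sq_circle (c p : ℂ) (r θ : ℝ) :
    ‖circleMap p r θ - c‖ ^ 2 = ‖p - c‖ ^ 2 + r ^ 2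
      + ((fun z => 2 * (starRingEnd ℂ) (p - c) * (z - p)) (circleMap p r θ)).re := by
  have h : ‖circleMap p r θ - p‖ ^ 2 = r ^ 2 := by simp
  rw [← Complex.normSq_eq_norm_sq] at h ⊢
  rw [← Complex.normSq_eq_norm_sq, ← h]
  generalize circleMap p r θ = w
  simp [Complex.normSq_apply]
  ring

/-- Maximum principle step. -/
theorem main_ineq (c : ℂ) (R : ℝ) (hR : 0 < R) (v : ℂ → ℝ)
    (hv : ContinuousOn v (closedBall c R)) (lam : ℂ → EReal)
    (hl : SubharmonicERealOn lam (closedBall c R))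
    (hloc : ∀ p ∈ ball c R, lam p ≠ ⊥ → ∃ r > 0, closedBall p r ⊆ closedBall c R ∧
      v p ≤ (2 * Real.pi)⁻¹ * ∫ θ in (0:ℝ)..(2 * Real.pi), v (circleMap p r θ))
    (F : ℂ → ℂ) (hF : Differentiable ℂ F) (hb : ∀ z ∈ sphere c R, v z ≤ (F z).re)
    (q : ℂ) (hq : q ∈ closedBall c R) (hlq : lam q ≠ ⊥) : v q ≤ (F q).re := by
  obtain ⟨husc, htop, hmean⟩ := hl
  have hreal : ∀ z ∈ closedBall c R, lam z ≠ ⊥ → ∃ x : ℝ, lam z = x := fun z hz hb =>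
    ⟨(lam z).toReal, (EReal.coe_toReal (htop z hz) hb).symm⟩
  obtain ⟨p0, hp0, hmax0⟩ := husc.exists_isMaxOn ⟨q, hq⟩ (isCompact_closedBall c R)
  have hp0b : lam p0 ≠ ⊥ := fun h => hlq (le_bot_iff.1 (h ▸ hmax0 hq))
  obtain ⟨C, hC⟩ := hreal p0 hp0 hp0b
  obtain ⟨lq, hlq'⟩ := hreal q hq hlq
  have key : ∀ N : ℕ, N * (v q - (F q).re) ≤ C + R ^ 2 - lq := by
    intro N
    have hgc : ContinuousOn (fun z => N * (v z - (F z).re) + ‖z - c‖ ^ 2) (closedBall c R) := by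
      have := hF.continuous
      fun_prop
    obtain ⟨p, hp, hmax⟩ := UpperSemicontinuousOn.exists_isMaxOn
      (f := fun z => lam z + ((N * (v z - (F z).re) + ‖z - c‖ ^ 2 : ℝ) : EReal)) ⟨q, hq⟩
      (isCompact_closedBall c R) (by
        refine husc.add' ?_ ?_
        · exact (continuous_coe_real_ereal.comp_continuousOn hgc).upperSemicontinuousOn
        · intro x hx
          exact EReal.continuousAt_add (Or.inr (EReal.coe_ne_bot _)) (Or.inr (EReal.coe_ne_top _)))
    have hpq := hmax hq
    simp only [Set.mem_ofPred_eq, hlq'] at hpq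
    have hpb : lam p ≠ ⊥ := by
      intro h
      rw [h, EReal.bot_add, ← EReal.coe_add] at hpq
      exact EReal.coe_ne_bot _ (le_bot_iff.1 hpq)
    obtain ⟨lp, hlp⟩ := hreal p hp hpb
    have hpC : lp ≤ C := by
      have := hmax0 hp
      simp only [Set.mem_ofPred_eq, hlp, hC] at this
      exact_mod_cast this
    rw [hlp] at hpq
    have hpq' : lq + (N * (v q - (F q).re) + ‖q - c‖ ^ 2)
      ≤ lp + (N * (v p - (F p).re) + ‖p - c‖ ^ 2) := by exact_mod_cast hpq
    rcases (mem_closedBall.1 hp).lt_or_eq with hlt | heq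
    · exfalso
      obtain ⟨r, hr, hsubr, hvr⟩ := hloc p hlt hpb
      let H : ℂ → ℂ := fun z => N * F z - 2 * (starRingEnd ℂ) (p - c) * (z - p)
      have hH : Differentiable ℂ H := by fun_prop
      let K : ℝ := lp + (N * (v p - (F p).re) + ‖p - c‖ ^ 2) - ‖p - c‖ ^ 2 - r ^ 2
      have hvc : Continuous (fun θ : ℝ => v (circleMap p r θ)) :=
        hv.comp_continuous (continuous_circleMap p r)
          (fun θ => hsubr (circleMap_mem_closedBall p hr.le θ))
      have hHc : Continuous (fun θ : ℝ => (H (circleMap p r θ)).re) :=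
        Complex.continuous_re.comp (hH.continuous.comp (continuous_circleMap p r))
      have hm := hmean p r hr hsubr
        (fun θ => K - N * v (circleMap p r θ) + (H (circleMap p r θ)).re)
        ((continuous_const.sub (continuous_const.mul hvc)).add hHc) (by
          intro θ
          have hz := hsubr (circleMap_mem_closedBall p hr.le θ)
          by_cases hzb : lam (circleMap p r θ) = ⊥
          · rw [hzb]; exact bot_le
          obtain ⟨lz, hlz⟩ := hreal _ hz hzb
          have h1 := hmax hz
          simp only [Set.mem_ofPred_eq, hlz, hlp] at h1
          have h2 : lz + (N * (v (circleMap p r θ) - (F (circleMap p r θ)).re)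
              + ‖circleMap p r θ - c‖ ^ 2)
            ≤ lp + (N * (v p - (F p).re) + ‖p - c‖ ^ 2) := by exact_mod_cast h1
          rw [norm_sq_circle c p r θ] at h2
          rw [hlz]
          refine EReal.coe_le_coe_iff.2 ?_
          have h3 : (H (circleMap p r θ)).re = N * (F (circleMap p r θ)).re -
            ((fun z => 2 * (starRingEnd ℂ) (p - c) * (z - p)) (circleMap p r θ)).re := by
              simp only [H, Complex.sub_re, Complex.mul_re (N : ℂ), Complex.natCast_re,
                Complex.natCast_im, zero_mul, sub_zero]
          rw [h3]
          simp only [K]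
          linarith)
      rw [hlp] at hm
      have hm' := EReal.coe_le_coe_iff.1 hm
      have hc1 : Continuous (fun θ : ℝ => (N : ℝ) * v (circleMap p r θ)) :=
        continuous_const.mul hvc
      have hc2 : Continuous (fun θ : ℝ => K - (N : ℝ) * v (circleMap p r θ)) :=
        continuous_const.sub hc1
      have hc0 : Continuous (fun _ : ℝ => K) := continuous_const
      rw [intervalIntegral.integral_add (hc2.intervalIntegrable _ _)
        (hHc.intervalIntegrable _ _), intervalIntegral.integral_sub
        (hc0.intervalIntegrable _ _) (hc1.intervalIntegrable _ _),
        intervalIntegral.integral_const_mul, intervalIntegral.integral_const,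
        mul_add, avg_re_entire H hH, mul_sub, smul_eq_mul, sub_zero, ← mul_assoc,
        inv_mul_cancel₀ Real.two_pi_pos.ne', one_mul] at hm'
      have hHp : (H p).re = N * (F p).re := by simp [H]
      rw [hHp] at hm'
      have hN : (N : ℝ) * v p ≤ N * ((2 * Real.pi)⁻¹ *
        ∫ θ in (0:ℝ)..(2 * Real.pi), v (circleMap p r θ)) :=
        mul_le_mul_of_nonneg_left hvr (Nat.cast_nonneg N)
      simp only [K] at hm'
      have : 0 < r ^ 2 := by positivity
      linarith
    · have h1 := hb p heq
      have h2 : ‖p - c‖ = R := by rw [← dist_eq_norm]; exact heq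
      rw [h2] at hpq'
      have h3 : (N : ℝ) * (v p - (F p).re) ≤ 0 :=
        mul_nonpos_of_nonneg_of_nonpos (Nat.cast_nonneg N) (by linarith)
      have h4 := sq_nonneg ‖q - c‖
      linarith
  by_contra hcon
  push Not at hcon
  obtain ⟨N, hN⟩ := exists_nat_gt ((C + R ^ 2 - lq) / (v q - (F q).re))
  rw [div_lt_iff₀ (by linarith)] at hN
  linarith [key N]

theorem sub_mean (c : ℂ) (R : ℝ) (hR : 0 < R) (v : ℂ → ℝ)
    (hv : ContinuousOn v (closedBall c R)) (lam : ℂ → EReal)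
    (hl : SubharmonicERealOn lam (closedBall c R))
    (hloc : ∀ p ∈ ball c R, lam p ≠ ⊥ → ∃ r > 0, closedBall p r ⊆ closedBall c R ∧
      v p ≤ (2 * Real.pi)⁻¹ * ∫ θ in (0:ℝ)..(2 * Real.pi), v (circleMap p r θ))
    (hc : ∀ t ∈ nhds c, ∃ w ∈ t, lam w ≠ ⊥) :
    v c ≤ (2 * Real.pi)⁻¹ * ∫ θ in (0:ℝ)..(2 * Real.pi), v (circleMap c R θ) := by
  refine le_of_forall_pos_le_add fun δ hδ => ?_
  obtain ⟨F, hF, hap⟩ := approx_circle c R hR v hv (δ / 2) (by positivity)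
  have hvc : Continuous (fun θ : ℝ => v (circleMap c R θ)) :=
    hv.comp_continuous (continuous_circleMap c R) (circleMap_mem_closedBall c hR.le)
  let F' : ℂ → ℂ := fun z => F z + ((δ / 2 : ℝ) : ℂ)
  have hF' : Differentiable ℂ F' := by fun_prop
  have hre : ∀ z, (F' z).re = (F z).re + δ / 2 := fun z => by simp only [F', Complex.add_re, Complex.ofReal_re]
  have hb : ∀ z ∈ sphere c R, v z ≤ (F' z).re := by
    intro z hz
    rw [← abs_of_pos hR, ← range_circleMap] at hz
    obtain ⟨θ, rfl⟩ := hz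
    rw [hre]
    linarith [(abs_lt.1 (hap θ)).1]
  have hcle : v c ≤ (F' c).re := by
    by_contra hcon
    push Not at hcon
    have hvat : ContinuousAt v c := hv.continuousAt (closedBall_mem_nhds c hR)
    have hFat : ContinuousAt (fun z => (F' z).re) c :=
      (Complex.continuous_re.comp hF'.continuous).continuousAt
    have hev := (hFat.eventually_lt hvat hcon).and (closedBall_mem_nhds c hR)
    obtain ⟨w, ⟨hw1, hw2⟩, hw⟩ := hc _ hev
    exact absurd (main_ineq c R hR v hv lam hl hloc F' hF' hb w hw2 hw) (not_le.2 hw1)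
  refine hcle.trans ?_
  rw [← avg_re_entire F' hF' c R]
  have hFc : Continuous (fun θ : ℝ => (F' (circleMap c R θ)).re) :=
    Complex.continuous_re.comp (hF'.continuous.comp (continuous_circleMap c R))
  have h1 : ∫ θ in (0:ℝ)..(2 * Real.pi), (F' (circleMap c R θ)).re ≤
      ∫ θ in (0:ℝ)..(2 * Real.pi), (v (circleMap c R θ) + δ) := by
    refine intervalIntegral.integral_mono Real.two_pi_pos.le (hFc.intervalIntegrable _ _)
      ((hvc.add continuous_const).intervalIntegrable _ _) fun θ => ?_
    simp only [hre]
    linarith [(abs_lt.1 (hap θ)).2]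
  rw [intervalIntegral.integral_add (hvc.intervalIntegrable _ _)
    (continuous_const.intervalIntegrable _ _), intervalIntegral.integral_const, smul_eq_mul,
    sub_zero] at h1
  have h2 := mul_le_mul_of_nonneg_left h1 (inv_nonneg.2 Real.two_pi_pos.le)
  rwa [mul_add, ← mul_assoc _ _ δ, inv_mul_cancel₀ Real.two_pi_pos.ne', one_mul] at h2

theorem subharmonicEReal_mono {lam : ℂ → EReal} {U V : Set ℂ} (h : SubharmonicERealOn lam V)
    (hUV : U ⊆ V) : SubharmonicERealOn lam U :=
  ⟨h.1.mono hUV, fun z hz => h.2.1 z (hUV hz),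
    fun c r hr hs => h.2.2 c r hr (hs.trans hUV)⟩

theorem subharmonicEReal_zero (U : Set ℂ) : SubharmonicERealOn (fun _ => 0) U := by
  refine ⟨continuousOn_const.upperSemicontinuousOn, by simp, ?_⟩
  intro c r hr _ g hg h
  have h' : ∀ θ, 0 ≤ g θ := fun θ => EReal.coe_le_coe_iff.1 (h θ)
  have : 0 ≤ (2 * Real.pi)⁻¹ * ∫ θ in (0:ℝ)..(2 * Real.pi), g θ :=
    mul_nonneg (inv_nonneg.2 Real.two_pi_pos.le)
      (intervalIntegral.integral_nonneg Real.two_pi_pos.le fun θ _ => h' θ)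
  exact EReal.coe_le_coe_iff.2 this

/-- **Lemma 1 (Part Two).**  Let `Ω ⊆ ℂ` be open and `E` a closed polar subset of
`Ω`.  If `v` is a continuous real-valued function on `Ω` that is subharmonic on
`Ω \ E`, then `v` is subharmonic on `Ω`. -/
theorem lemma1_rado (Ω : Set ℂ) (hΩ : IsOpen Ω) (E : Set ℂ) (hE : E ⊆ Ω)
    (hEclosed : ∀ z ∈ Ω, z ∈ closure E → z ∈ E)
    (hpolar : PolarIn E Ω)
    (v : ℂ → ℝ) (hv : ContinuousOn v Ω)
    (hsub : SubharmonicRealOn v (Ω \ E)) :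
    SubharmonicRealOn v Ω := by
  have hopen : IsOpen (Ω \ E) := by
    have : Ω \ E = Ω ∩ (closure E)ᶜ := by
      ext z
      exact ⟨fun h => ⟨h.1, fun h' => h.2 (hEclosed z h.1 h')⟩,
        fun h => ⟨h.1, fun h' => h.2 (subset_closure h')⟩⟩
    rw [this]
    exact hΩ.inter isClosed_closure.isOpen_compl
  have hlocal : ∀ z ∈ Ω, ∀ W : Set ℂ, IsOpen W → z ∈ W → ∃ r > 0, closedBall z r ⊆ W ∧
      v z ≤ (2 * Real.pi)⁻¹ * ∫ θ in (0:ℝ)..(2 * Real.pi), v (circleMap z r θ) := by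
    intro z hz W hW hzW
    obtain ⟨V, hV, hzV, lam, hlam, hne, hEV⟩ := hpolar z hz
    obtain ⟨R, hR, hsubR⟩ := Metric.nhds_basis_closedBall.mem_iff.1
      (((hW.inter hV).inter hΩ).mem_nhds ⟨⟨hzW, hzV⟩, hz⟩)
    refine ⟨R, hR, fun w hw => (hsubR hw).1.1, ?_⟩
    refine sub_mean z R hR v (hv.mono fun w hw => (hsubR hw).2) lam
      (subharmonicEReal_mono hlam fun w hw => (hsubR hw).1.2) ?_ ?_
    · intro p hp hpb
      have hp' := hsubR (ball_subset_closedBall hp)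
      have hpE : p ∉ E := fun h => hpb (hEV ⟨h, hp'.1.2⟩)
      obtain ⟨r, hr, hsubr⟩ := Metric.nhds_basis_closedBall.mem_iff.1
        ((hopen.inter isOpen_ball).mem_nhds ⟨⟨hp'.2, hpE⟩, hp⟩)
      exact ⟨r, hr, fun w hw => ball_subset_closedBall (hsubr hw).2,
        hsub.2 p r hr fun w hw => (hsubr hw).1⟩
    · intro t ht
      obtain ⟨w, hw, hwb⟩ := hne t ht
      exact ⟨w, hw.1, hwb⟩
  refine ⟨hv.upperSemicontinuousOn, fun c r hr hs => ?_⟩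
  refine sub_mean c r hr v (hv.mono hs) (fun _ => 0) (subharmonicEReal_zero _) ?_ ?_
  · intro p hp _
    obtain ⟨ρ, hρ, h1, h2⟩ := hlocal p (hs (ball_subset_closedBall hp)) (ball c r) isOpen_ball hp
    exact ⟨ρ, hρ, h1.trans ball_subset_closedBall, h2⟩
  · intro t ht
    exact ⟨c, mem_of_mem_nhds ht, by simp⟩


end
end

section
/- Let Ω be an open set in ℂ and let E be a closed polar subset of Ω. If u is a bounded harmonic function defined on Ω \ E, then u extends to a harmonic function on Ω. -/
open MeasureTheory Metric Set

noncomputable section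

/-- The Laplacian of a function `u : ℂ → ℝ`, `Δu = ∂²u/∂x² + ∂²u/∂y²`. -/
def laplacianR (u : ℂ → ℝ) (z : ℂ) : ℝ :=
  fderiv ℝ (fun w => fderiv ℝ u w 1) z 1 +
    fderiv ℝ (fun w => fderiv ℝ u w Complex.I) z Complex.I

/-- `u` is harmonic on `U`: twice continuously differentiable with vanishing
Laplacian. -/
def HarmonicOnSet (u : ℂ → ℝ) (U : Set ℂ) : Prop :=
  ContDiffOn ℝ 2 u U ∧ ∀ z ∈ U, laplacianR u z = 0

open InnerProductSpace in
theorem harm_laplacian_eq {u : ℂ → ℝ} {z : ℂ} (h : ContDiffAt ℝ 2 u z) :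
    Laplacian.laplacian u z = laplacianR u z := by
  have hd : DifferentiableAt ℝ (fderiv ℝ u) z :=
    (h.fderiv_right (m := 1) (by norm_num)).differentiableAt (by norm_num)
  rw [laplacian_eq_iteratedFDeriv_complexPlane]
  simp only [iteratedFDeriv_two_apply, laplacianR]
  rw [fderiv_clm_apply hd (by fun_prop), fderiv_clm_apply hd (by fun_prop)]
  simp

open InnerProductSpace in
theorem harm_iff {u : ℂ → ℝ} {U : Set ℂ} (hU : IsOpen U) :
    HarmonicOnSet u U ↔ HarmonicOnNhd u U := by
  constructor
  · rintro ⟨h1, h2⟩ x hx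
    refine ⟨h1.contDiffAt (hU.mem_nhds hx), ?_⟩
    filter_upwards [hU.mem_nhds hx] with y hy
    rw [harm_laplacian_eq (h1.contDiffAt (hU.mem_nhds hy)), h2 y hy]
    rfl
  · intro h
    refine ⟨h.contDiffOn, fun z hz => ?_⟩
    rw [← harm_laplacian_eq (h z hz).1]
    exact (h z hz).2.self_of_nhds

/-- Poisson integral -/
def poissonInt (c : ℂ) (R : ℝ) (g : ℂ → ℝ) (w : ℂ) : ℝ :=
  Real.circleAverage (poissonKernel c w • g) c R

open InnerProductSpace in
theorem poissonInt_harmonic {c : ℂ} {R : ℝ} {g : ℂ → ℝ}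
    (hg : CircleIntegrable g c R) : HarmonicOnNhd (poissonInt c R g) (ball c R) := by
  intro w hw
  set g0 : ℂ → ℝ := fun z => g (z + c) with hg0
  have hg0i : CircleIntegrable g0 0 R := by
    unfold CircleIntegrable at hg ⊢
    convert hg using 2 with θ
    simp [hg0, circleMap, add_comm]
  have hg0c : CircleIntegrable (fun z => (g0 z : ℂ)) 0 R := by
    unfold CircleIntegrable at hg0i ⊢
    exact ⟨hg0i.1.ofReal, hg0i.2.ofReal⟩
  have hA := analyticOnNhd_circleAverage_herglotzRieszKernel_smul hg0c
  have key : ∀ v ∈ ball c R, poissonInt c R g v =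
      (Real.circleAverage (fun ζ ↦ herglotzRieszKernel 0 (v - c) ζ • (g0 ζ : ℂ)) 0 R).re := by
    intro v hv
    rw [re_circleAverage_herglotzRieszKernel_smul hg0i (by simpa [dist_eq_norm] using hv)]
    unfold poissonInt
    rw [← Real.circleAverage_map_add_const]
    congr 1
    ext z
    simp [poissonKernel_eq_re_herglotzRieszKernel, herglotzRieszKernel_add_const, hg0]
  have hw' : w - c ∈ ball (0:ℂ) R := by simpa [dist_eq_norm] using hw
  have h2 : AnalyticAt ℂ (fun v => Real.circleAverage
      (fun ζ ↦ herglotzRieszKernel 0 (v - c) ζ • (g0 ζ : ℂ)) 0 R) w := by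
    have := hA _ hw'
    exact AnalyticAt.fun_comp (f := fun v : ℂ => v - c) this (by fun_prop)
  rw [harmonicAt_congr_nhds (f₂ := _)]
  · exact h2.harmonicAt_re
  · filter_upwards [isOpen_ball.mem_nhds hw] with v hv using key v hv

theorem poissonKernel_contOn {c w : ℂ} {R : ℝ} (hw : w ∈ ball c R) :
    ContinuousOn (poissonKernel c w) (sphere c |R|) := by
  rw [poissonKernel_eq_re_herglotzRieszKernel]
  exact Complex.continuous_re.comp_continuousOn (continuousOn_herglotzRieszKernel_sphere hw)

theorem poissonKernel_integrable {c w : ℂ} {R : ℝ} (hw : w ∈ ball c R) {g : ℂ → ℝ}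
    (hg : CircleIntegrable g c R) : CircleIntegrable (poissonKernel c w • g) c R := by
  unfold CircleIntegrable at hg ⊢
  refine IntervalIntegrable.continuousOn_mul hg ?_
  refine Continuous.continuousOn ?_
  exact (poissonKernel_contOn hw).comp_continuous (continuous_circleMap c R)
    (fun θ => circleMap_mem_sphere' c R θ)

theorem poissonInt_const {c w : ℂ} {R : ℝ} (hw : w ∈ ball c R) (a : ℝ) :
    poissonInt c R (fun _ => a) w = a :=
  InnerProductSpace.HarmonicOnNhd.circleAverage_poissonKernel_smul
    (f := fun _ => a) (InnerProductSpace.harmonicOnNhd_const a) hw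

theorem poissonInt_sub_le {c w : ℂ} {R : ℝ} (hw : w ∈ ball c R) {g : ℂ → ℝ}
    (hg : CircleIntegrable g c R) (a η k : ℝ)
    (h : ∀ ζ ∈ sphere c R, poissonKernel c w ζ * |g ζ - a| ≤ η * poissonKernel c w ζ + k) :
    |poissonInt c R g w - a| ≤ η + k := by
  have hR : 0 < R := pos_of_mem_ball hw
  have hga : CircleIntegrable (fun z => g z - a) c R := hg.sub (circleIntegrable_const a c R)
  have e1 : poissonInt c R g w - a = Real.circleAverage (poissonKernel c w • fun z => g z - a) c R := by
    conv_lhs => rw [← poissonInt_const hw a]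
    unfold poissonInt
    rw [← Real.circleAverage_sub (poissonKernel_integrable hw hg)
      (poissonKernel_integrable hw (circleIntegrable_const a c R))]
    congr 1
    ext z
    simp [mul_sub]
  have e2 : η + k = Real.circleAverage ((poissonKernel c w • fun _ => η) + fun _ => k) c R := by
    rw [Real.circleAverage_add (poissonKernel_integrable hw (circleIntegrable_const η c R))
      (circleIntegrable_const k c R), Real.circleAverage_const]
    congr 1
    exact (poissonInt_const hw η).symm
  rw [e1, e2]
  refine Real.abs_circleAverage_le_circleAverage_abs.trans ?_
  refine Real.circleAverage_mono (poissonKernel_integrable hw hga).abs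
    ((poissonKernel_integrable hw (circleIntegrable_const η c R)).add
      (circleIntegrable_const k c R)) ?_
  intro ζ hζ
  rw [abs_of_pos hR] at hζ
  have hK : 0 ≤ poissonKernel c w ζ := by
    rw [poissonKernel_def]
    have h1 : ‖ζ - c‖ = R := by simpa [dist_eq_norm] using hζ
    have h2 : ‖w - c‖ < R := by simpa [dist_eq_norm] using hw
    apply div_nonneg _ (by positivity)
    rw [h1]
    nlinarith [norm_nonneg (w - c)]
  have := h ζ hζ
  simp only [Pi.abs_apply, Pi.mul_apply, Pi.add_apply, smul_eq_mul, abs_mul, abs_of_nonneg hK]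
  linarith

theorem poissonInt_bdd {c w : ℂ} {R : ℝ} (hw : w ∈ ball c R) {g : ℂ → ℝ}
    (hg : CircleIntegrable g c R) {C : ℝ} (hC : ∀ ζ, |g ζ| ≤ C) :
    |poissonInt c R g w| ≤ C := by
  have hR : 0 < R := pos_of_mem_ball hw
  have := poissonInt_sub_le hw hg 0 C 0 (fun ζ hζ => by
    have hK : 0 ≤ poissonKernel c w ζ := by
      rw [poissonKernel_def]
      have h1 : ‖ζ - c‖ = R := by simpa [dist_eq_norm] using hζ
      have h2 : ‖w - c‖ < R := by simpa [dist_eq_norm] using hw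
      apply div_nonneg _ (by positivity)
      rw [h1]
      nlinarith [norm_nonneg (w - c)]
    have := mul_le_mul_of_nonneg_left (hC ζ) hK
    simp only [sub_zero, add_zero]
    linarith)
  simpa using this

theorem poissonInt_boundary {c x : ℂ} {R : ℝ} (hR : 0 < R) (hx : x ∈ sphere c R) {g : ℂ → ℝ}
    (hg : CircleIntegrable g c R) {C : ℝ} (hC : ∀ ζ, |g ζ| ≤ C)
    (hc : ContinuousAt g x) {η : ℝ} (hη : 0 < η) :
    ∀ᶠ w in nhds x, w ∈ ball c R → |poissonInt c R g w - g x| < η := by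
  obtain ⟨δ, hδ, hgδ⟩ := Metric.continuousAt_iff.1 hc (η / 2) (by positivity)
  have hC0 : 0 ≤ C := (abs_nonneg _).trans (hC x)
  have hlim : Filter.Tendsto (fun w : ℂ => 2 * C * ((R ^ 2 - ‖w - c‖ ^ 2) * (4 / δ ^ 2)))
      (nhds x) (nhds (2 * C * ((R ^ 2 - ‖x - c‖ ^ 2) * (4 / δ ^ 2)))) := by
    apply Continuous.tendsto
    fun_prop
  have h0 : ‖x - c‖ = R := by simpa [dist_eq_norm] using hx
  rw [h0] at hlim
  simp only [sub_self, zero_mul, mul_zero] at hlim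
  filter_upwards [hlim.eventually (gt_mem_nhds (half_pos hη)),
    Metric.ball_mem_nhds x (half_pos hδ)] with w h1 h2 hw
  have h3 : ‖w - c‖ < R := by simpa [dist_eq_norm] using hw
  have h4 : 0 < R ^ 2 - ‖w - c‖ ^ 2 := by nlinarith [norm_nonneg (w - c)]
  refine lt_of_le_of_lt (poissonInt_sub_le hw hg (g x) (η / 2)
    (2 * C * ((R ^ 2 - ‖w - c‖ ^ 2) * (4 / δ ^ 2))) ?_) (by linarith)
  intro ζ hζ
  have h5 : ‖ζ - c‖ = R := by simpa [dist_eq_norm] using hζ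
  have hKdef : poissonKernel c w ζ = (R ^ 2 - ‖w - c‖ ^ 2) / ‖ζ - w‖ ^ 2 := by
    rw [poissonKernel_def, h5]; congr 3; ring
  have hK : 0 ≤ poissonKernel c w ζ := by
    rw [hKdef]; positivity
  have hk : 0 ≤ 2 * C * ((R ^ 2 - ‖w - c‖ ^ 2) * (4 / δ ^ 2)) := by positivity
  by_cases hζx : dist ζ x < δ
  · have := hgδ hζx
    rw [Real.dist_eq] at this
    have := mul_le_mul_of_nonneg_left this.le hK
    linarith
  · have h6 : δ / 2 ≤ ‖ζ - w‖ := by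
      rw [← dist_eq_norm]
      have := dist_triangle ζ w x
      have h2' : dist w x < δ / 2 := h2
      linarith
    have h7 : poissonKernel c w ζ ≤ (R ^ 2 - ‖w - c‖ ^ 2) * (4 / δ ^ 2) := by
      rw [hKdef]
      have : (R ^ 2 - ‖w - c‖ ^ 2) * (4 / δ ^ 2) = (R ^ 2 - ‖w - c‖ ^ 2) / (δ / 2) ^ 2 := by
        field_simp; ring
      rw [this]
      gcongr
    have h8 : |g ζ - g x| ≤ 2 * C := by
      have := abs_sub (g ζ) (g x)
      linarith [hC ζ, hC x]
    have h9 : poissonKernel c w ζ * |g ζ - g x| ≤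
        (R ^ 2 - ‖w - c‖ ^ 2) * (4 / δ ^ 2) * (2 * C) := by gcongr
    have : 0 ≤ η / 2 * poissonKernel c w ζ := by positivity
    linarith

theorem lam_bound {lam : ℂ → EReal} {V K : Set ℂ} (hl : SubharmonicERealOn lam V)
    (hK : IsCompact K) (hKV : K ⊆ V) : ∃ M : ℝ, ∀ w ∈ K, lam w ≤ (M : EReal) := by
  rcases K.eq_empty_or_nonempty with h | h
  · exact ⟨0, by simp [h]⟩
  · obtain ⟨a, ha, hmax⟩ := (hl.1.mono hKV).exists_isMaxOn h hK
    refine ⟨(lam a).toReal, fun w hw => (hmax hw).trans ?_⟩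
    exact EReal.le_coe_toReal (hl.2.1 a (hKV ha))

theorem lam_dense {lam : ℂ → EReal} {V : Set ℂ} (hl : SubharmonicERealOn lam V)
    {z w0 p : ℂ} {r : ℝ} (hV : closedBall z (3 * r) ⊆ V) (hw0 : w0 ∈ ball z r)
    (hne : lam w0 ≠ ⊥) (hp : p ∈ ball z r) : ∃ᶠ x in nhds p, lam x ≠ ⊥ := by
  intro hev
  simp only [not_not] at hev
  obtain ⟨δ, hδ, hball⟩ := Metric.eventually_nhds_iff_ball.1 hev
  have hwp : w0 ≠ p := by
    rintro rfl
    exact hne (hball _ (mem_ball_self hδ))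
  set R := dist p w0 with hRdef
  have hR : 0 < R := dist_pos.2 hwp.symm
  have hsub : closedBall w0 R ⊆ closedBall z (3 * r) := by
    apply closedBall_subset_closedBall'
    have h1 : dist w0 z < r := hw0
    have h2 : dist p z < r := hp
    have := dist_triangle_right p w0 z
    linarith
  obtain ⟨M, hM⟩ := lam_bound hl (isCompact_closedBall z (3 * r)) hV
  set b : ℂ → ℝ := fun x => max 0 (δ - dist x p) with hb
  have hbc : Continuous b := by fun_prop
  have hbθ : Continuous (fun θ : ℝ => b (circleMap w0 R θ)) :=
    hbc.comp (continuous_circleMap w0 R)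
  obtain ⟨θ0, hθ0, hθp⟩ : ∃ θ ∈ Ioc 0 (2 * Real.pi), circleMap w0 R θ = p := by
    have : p ∈ circleMap w0 R '' Ioc 0 (2 * Real.pi) := by
      rw [image_circleMap_Ioc]
      rw [abs_of_pos hR]; exact rfl
    exact this
  have hpos : 0 < ∫ θ in (0:ℝ)..(2 * Real.pi), b (circleMap w0 R θ) := by
    apply intervalIntegral.integral_pos Real.two_pi_pos hbθ.continuousOn
    · intro x _; exact le_max_left _ _
    · refine ⟨θ0, Ioc_subset_Icc_self hθ0, ?_⟩
      simp [hb, hθp, hδ]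
  apply hne
  rw [EReal.eq_bot_iff_forall_lt]
  intro y
  set I := ∫ θ in (0:ℝ)..(2 * Real.pi), b (circleMap w0 R θ) with hI
  have hβ : 0 < (2 * Real.pi)⁻¹ * I := mul_pos (inv_pos.2 Real.two_pi_pos) hpos
  set n : ℝ := (|M - y| + 1) / ((2 * Real.pi)⁻¹ * I) with hn
  have hn0 : 0 ≤ n := by positivity
  have key := hl.2.2 w0 R hR (hsub.trans hV) (fun θ => M - n * b (circleMap w0 R θ))
    (by fun_prop) (by
      intro θ
      have hmem : circleMap w0 R θ ∈ closedBall z (3 * r) :=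
        hsub (circleMap_mem_closedBall w0 hR.le θ)
      by_cases hd : dist (circleMap w0 R θ) p < δ
      · rw [hball _ hd]; exact bot_le
      · have : b (circleMap w0 R θ) = 0 := max_eq_left (by linarith)
        rw [this]; simpa using hM _ hmem)
  refine lt_of_le_of_lt key ?_
  rw [EReal.coe_lt_coe_iff, intervalIntegral.integral_sub (by simp)
    ((hbθ.const_mul n).intervalIntegrable _ _), intervalIntegral.integral_const_mul,
    intervalIntegral.integral_const]
  have h1 : n * ((2 * Real.pi)⁻¹ * I) = |M - y| + 1 := div_mul_cancel₀ _ hβ.ne'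
  have h2 : (2 * Real.pi)⁻¹ * ((2 * Real.pi - 0) • M - n * I) = M - n * ((2 * Real.pi)⁻¹ * I) := by
    have := Real.pi_pos
    simp only [smul_eq_mul]
    field_simp
    ring
  rw [h2, h1]
  have := le_abs_self (M - y)
  linarith

open InnerProductSpace in
theorem max_principle_aux {lam : ℂ → EReal} {V E : Set ℂ} (hl : SubharmonicERealOn lam V)
    {z : ℂ} {r : ℝ} (hV : closedBall z r ⊆ V) (hEo : IsOpen (ball z r \ E))
    (hE : ∀ x ∈ closedBall z r, x ∈ E → lam x = ⊥) {h : ℂ → ℝ}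
    (hh : HarmonicOnNhd h (ball z r \ E)) {B : ℝ} (hB : ∀ w ∈ ball z r \ E, h w ≤ B)
    (hbd : ∀ x ∈ sphere z r, x ∉ E → ∀ η : ℝ, 0 < η →
      ∀ᶠ w in nhds x, w ∈ ball z r \ E → h w < η)
    {M : ℝ} (hM : ∀ w ∈ closedBall z r, lam w ≤ (M : EReal))
    {t : ℝ} (ht : 0 < t) {w0 : ℂ} (hw0 : w0 ∈ ball z r \ E) (hne : lam w0 ≠ ⊥) :
    (lam w0).toReal + (‖w0 - z‖ ^ 2 - r ^ 2 - M) + t * h w0 ≤ 0 := by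
  by_contra! hη
  set q : ℂ → ℝ := fun w => ‖w - z‖ ^ 2 - r ^ 2 - M with hq
  have hqc : Continuous q := by fun_prop
  set v : ℂ → ℝ := fun w => (lam w).toReal + q w + t * h w with hv
  change 0 < v w0 at hη
  set η := v w0 with hηdef
  have hsubV : ball z r \ E ⊆ V := fun w hw => hV (ball_subset_closedBall hw.1)
  have hhc : ContinuousOn h (ball z r \ E) := hh.continuousOn
  set K : Set ℂ := {w | w ∈ ball z r \ E ∧ ((η - q w - t * h w : ℝ) : EReal) ≤ lam w} with hK
  have hKsub : K ⊆ ball z r \ E := fun w hw => hw.1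
  have hKr : ∀ w ∈ K, lam w = (((lam w).toReal : ℝ) : EReal) := by
    intro w hw
    refine (EReal.coe_toReal (hl.2.1 w (hsubV hw.1)) ?_).symm
    intro hbot
    have := hw.2
    rw [hbot] at this
    exact EReal.coe_ne_bot _ (le_bot_iff.1 this)
  have hw0K : w0 ∈ K := by
    refine ⟨hw0, ?_⟩
    rw [← EReal.coe_toReal (hl.2.1 w0 (hsubV hw0)) hne, EReal.coe_le_coe_iff]
    simp only [hηdef, hv]
    linarith
  -- K is closed
  have hKcl : IsClosed K := by
    rw [isClosed_iff_frequently]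
    intro x hx
    have hxcl : x ∈ closedBall z r := by
      apply isClosed_closedBall.mem_of_frequently_of_tendsto (f := id) _ Filter.tendsto_id
      exact hx.mono fun w hw => ball_subset_closedBall hw.1.1
    have husc : ∀ y : EReal, lam x < y → ∀ᶠ w in nhds x, w ∈ V → lam w < y := by
      intro y hy
      exact eventually_nhdsWithin_iff.1 (hl.1 x (hV hxcl) y hy)
    by_cases hxE : x ∈ E
    · exfalso
      have hb := hE x hxcl hxE
      have h1 : ∀ᶠ w in nhds x, q w < q x + 1 :=
        hqc.continuousAt.eventually (gt_mem_nhds (by linarith))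
      have h2 := husc ((η - (q x + 1) - t * B : ℝ) : EReal) (by rw [hb]; exact EReal.bot_lt_coe _)
      obtain ⟨w, ⟨hwb, hwl⟩, h1, h2⟩ := (hx.and_eventually (h1.and h2)).exists
      have h3 := lt_of_le_of_lt hwl (h2 (hsubV hwb))
      rw [EReal.coe_lt_coe_iff] at h3
      have := mul_le_mul_of_nonneg_left (hB w hwb) ht.le
      linarith
    · by_cases hxs : x ∈ ball z r
      · have hxo : x ∈ ball z r \ E := ⟨hxs, hxE⟩
        refine ⟨hxo, ?_⟩
        by_contra! hlt
        obtain ⟨y, hy1, hy2⟩ := EReal.lt_iff_exists_real_btwn.1 hlt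
        rw [EReal.coe_lt_coe_iff] at hy2
        have hc : ContinuousAt (fun w => η - q w - t * h w) x := by
          have := hhc.continuousAt (hEo.mem_nhds hxo)
          fun_prop
        obtain ⟨w, ⟨hwb, hwl⟩, h1, h2⟩ :=
          (hx.and_eventually ((hc.eventually (lt_mem_nhds hy2)).and (husc _ hy1))).exists
        have h3 := lt_of_le_of_lt hwl (h2 (hsubV hwb))
        rw [EReal.coe_lt_coe_iff] at h3
        linarith
      · exfalso
        have hxsph : x ∈ sphere z r := by
          rw [mem_sphere]
          exact le_antisymm hxcl (not_lt.1 hxs)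
        have h1 := hbd x hxsph hxE (η / t) (by positivity)
        obtain ⟨w, ⟨hwb, hwl⟩, h1⟩ := (hx.and_eventually h1).exists
        have h2 := h1 hwb
        rw [lt_div_iff₀ ht] at h2
        have h3 := hwl.trans (hM w (ball_subset_closedBall hwb.1))
        rw [EReal.coe_le_coe_iff] at h3
        have h4 : ‖w - z‖ < r := by simpa [dist_eq_norm] using hwb.1
        simp only [hq] at h3
        nlinarith [norm_nonneg (w - z)]
  have hKc : IsCompact K := (isCompact_closedBall z r).of_isClosed_subset hKcl
    (fun w hw => ball_subset_closedBall hw.1.1)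
  have hvusc : UpperSemicontinuousOn v K := by
    have h1 : UpperSemicontinuousOn (fun w => (lam w).toReal) K := by
      intro x hx y hy
      have hy' : lam x < (y : EReal) := by
        rw [hKr x hx, EReal.coe_lt_coe_iff]; exact hy
      have h2 := (hl.1.mono (hKsub.trans hsubV)) x hx _ hy'
      filter_upwards [h2, self_mem_nhdsWithin] with w hw hwK
      rw [hKr w hwK, EReal.coe_lt_coe_iff] at hw
      exact hw
    have h2 : ContinuousOn (fun w => q w + t * h w) K := by
      have := hhc.mono hKsub
      fun_prop
    have h3 := h1.add h2.upperSemicontinuousOn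
    intro x hx y hy
    have := h3 x hx y (by simpa [hv, add_assoc] using hy)
    simpa [hv, add_assoc] using this
  obtain ⟨p, hpK, hpmax⟩ := hvusc.exists_isMaxOn ⟨w0, hw0K⟩ hKc
  have hηp : η ≤ v p := hpmax hw0K
  have hle : ∀ w ∈ ball z r \ E, lam w ≤ ((v p - q w - t * h w : ℝ) : EReal) := by
    intro w hw
    by_cases hwK : w ∈ K
    · have := hpmax hwK
      rw [hKr w hwK, EReal.coe_le_coe_iff]
      change v w ≤ v p at this
      simp only [hv] at this ⊢
      linarith
    · have : lam w < ((η - q w - t * h w : ℝ) : EReal) := by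
        by_contra! hcon
        exact hwK ⟨hw, hcon⟩
      refine this.le.trans ?_
      rw [EReal.coe_le_coe_iff]
      linarith
  obtain ⟨s, hs, hsb⟩ := Metric.nhds_basis_closedBall.mem_iff.1 (hEo.mem_nhds hpK.1)
  set H : ℂ → ℝ := (fun w => v p + r ^ 2 + M - s ^ 2 - ‖p - z‖ ^ 2) -
    (fun w : ℂ => (2 * (starRingEnd ℂ (p - z)) * (w - p)).re) - t • h with hH
  have hHh : HarmonicOnNhd H (closedBall p |s|) := by
    rw [abs_of_pos hs]
    intro w hw
    have a1 : HarmonicAt (fun w : ℂ => (2 * (starRingEnd ℂ (p - z)) * (w - p)).re) w :=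
      AnalyticAt.harmonicAt_re (f := fun w : ℂ => (2 * (starRingEnd ℂ (p - z)) * (w - p)))
        (by fun_prop)
    exact ((harmonicAt_const _).sub a1).sub ((hh w (hsb hw)).const_smul)
  have hHeq : ∀ w ∈ sphere p s, H w = v p - q w - t * h w := by
    intro w hw
    have h1 : ‖w - p‖ = s := by simpa [dist_eq_norm] using hw
    have h2 : ‖w - z‖ ^ 2 = ‖w - p‖ ^ 2 + ‖p - z‖ ^ 2 +
        (2 * (starRingEnd ℂ (p - z)) * (w - p)).re := by
      simp only [← Complex.normSq_eq_norm_sq, Complex.normSq_apply]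
      simp
      ring
    simp only [hH, hq, h2, h1, Pi.sub_apply, Pi.smul_apply, smul_eq_mul]
    ring
  have hmv := hHh.circleAverage_eq
  rw [Real.circleAverage_def, smul_eq_mul] at hmv
  have key := hl.2.2 p s hs (hsb.trans hsubV) (fun θ => H (circleMap p s θ))
    ((hHh.continuousOn).comp_continuous (continuous_circleMap p s)
      (fun θ => sphere_subset_closedBall (circleMap_mem_sphere' p s θ)))
    (by
      intro θ
      have hm := circleMap_mem_sphere p hs.le θ
      rw [hHeq _ hm]
      exact hle _ (hsb (sphere_subset_closedBall hm)))
  rw [hmv, hKr p hpK, EReal.coe_le_coe_iff] at key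
  have : 0 < s ^ 2 := by positivity
  simp [hH, hv, hq] at key
  linarith

open InnerProductSpace in
theorem max_principle {lam : ℂ → EReal} {V E : Set ℂ} (hl : SubharmonicERealOn lam V)
    {z : ℂ} {r : ℝ} (hV : closedBall z r ⊆ V) (hEo : IsOpen (ball z r \ E))
    (hE : ∀ x ∈ closedBall z r, x ∈ E → lam x = ⊥) {h : ℂ → ℝ}
    (hh : HarmonicOnNhd h (ball z r \ E)) {B : ℝ} (hB : ∀ w ∈ ball z r \ E, h w ≤ B)
    (hbd : ∀ x ∈ sphere z r, x ∉ E → ∀ η : ℝ, 0 < η →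
      ∀ᶠ w in nhds x, w ∈ ball z r \ E → h w < η)
    {w0 : ℂ} (hw0 : w0 ∈ ball z r \ E) (hne : lam w0 ≠ ⊥) : h w0 ≤ 0 := by
  obtain ⟨M, hM⟩ := lam_bound hl (isCompact_closedBall z r) hV
  by_contra! hpos
  set A := (lam w0).toReal + (‖w0 - z‖ ^ 2 - r ^ 2 - M) with hA
  have := max_principle_aux hl hV hEo hE hh hB hbd hM (t := (|A| + 1) / h w0)
    (by positivity) hw0 hne
  rw [div_mul_cancel₀ _ hpos.ne'] at this
  have := neg_abs_le A
  linarith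

open InnerProductSpace in
theorem local_ext (Ω : Set ℂ) (hΩ : IsOpen Ω) (E : Set ℂ) (hO : IsOpen (Ω \ E))
    (hpolar : PolarIn E Ω) (u : ℂ → ℝ) (hu : HarmonicOnNhd u (Ω \ E)) {C : ℝ}
    (hC : ∀ z ∈ Ω \ E, |u z| ≤ C) (z : ℂ) (hz : z ∈ Ω) :
    ∃ r > 0, ball z r ⊆ Ω ∧ ∃ P : ℂ → ℝ, HarmonicOnNhd P (ball z r) ∧
      (∀ w ∈ ball z r \ E, P w = u w) ∧ ∀ w ∈ ball z r, ∃ᶠ x in nhds w, x ∉ E := by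
  obtain ⟨V, hVo, hzV, lam, hl, hnb, hEV⟩ := hpolar z hz
  obtain ⟨s, hs, hsb⟩ := Metric.nhds_basis_closedBall.mem_iff.1
    ((hVo.inter hΩ).mem_nhds ⟨hzV, hz⟩)
  set r := s / 3 with hr
  have hr0 : 0 < r := by positivity
  have h3r : 3 * r = s := by rw [hr]; ring
  have hrs : closedBall z r ⊆ closedBall z s := closedBall_subset_closedBall (by linarith)
  have hV3 : closedBall z (3 * r) ⊆ V := by rw [h3r]; exact hsb.trans inter_subset_left
  have hVr : closedBall z r ⊆ V := (hrs.trans hsb).trans inter_subset_left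
  have hΩr : closedBall z r ⊆ Ω := (hrs.trans hsb).trans inter_subset_right
  have hbΩ : ball z r ⊆ Ω := ball_subset_closedBall.trans hΩr
  obtain ⟨a, ⟨ha, -⟩, hane⟩ := hnb _ (ball_mem_nhds z hr0)
  have hdense : ∀ p ∈ ball z r, ∃ᶠ x in nhds p, lam x ≠ ⊥ :=
    fun p hp => lam_dense hl hV3 ha hane hp
  have hEl : ∀ x ∈ closedBall z r, x ∈ E → lam x = ⊥ := fun x hx hxE => hEV ⟨hxE, hVr hx⟩
  have hsubO : ball z r \ E ⊆ Ω \ E := fun w hw => ⟨hbΩ hw.1, hw.2⟩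
  have hEo : IsOpen (ball z r \ E) := by
    have : ball z r \ E = ball z r ∩ (Ω \ E) := by
      ext w
      exact ⟨fun h => ⟨h.1, hsubO h⟩, fun h => ⟨h.1, h.2.2⟩⟩
    rw [this]
    exact isOpen_ball.inter hO
  have hC0 : ∀ w, |(Ω \ E).indicator u w| ≤ |C| := by
    intro w
    by_cases hw : w ∈ Ω \ E
    · rw [indicator_of_mem hw]; exact (hC w hw).trans (le_abs_self C)
    · rw [indicator_of_notMem hw]; simp
  set g : ℂ → ℝ := (Ω \ E).indicator u with hg
  have hgm : Measurable g := by
    classical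
    rw [hg, ← piecewise_eq_indicator]
    convert ContinuousOn.measurable_piecewise (f := u) (g := (0 : ℂ → ℝ)) hu.continuousOn
      continuousOn_const hO.measurableSet
  have hgi : CircleIntegrable g z r := by
    unfold CircleIntegrable
    rw [intervalIntegrable_iff, uIoc_of_le Real.two_pi_pos.le]
    refine Integrable.of_bound (C := |C|) ?_ ?_
    · exact (hgm.comp (continuous_circleMap z r).measurable).aestronglyMeasurable
    · exact Filter.Eventually.of_forall fun θ => hC0 _
  set P := poissonInt z r g with hP
  have hPh : HarmonicOnNhd P (ball z r) := poissonInt_harmonic hgi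
  have huh : HarmonicOnNhd u (ball z r \ E) := hu.mono hsubO
  have hPh' : HarmonicOnNhd P (ball z r \ E) := hPh.mono sdiff_subset
  have hbdry : ∀ x ∈ sphere z r, x ∉ E → ∀ η : ℝ, 0 < η →
      ∀ᶠ w in nhds x, w ∈ ball z r \ E → |u w - P w| < η := by
    intro x hx hxE η hη
    have hxO : x ∈ Ω \ E := ⟨hΩr (sphere_subset_closedBall hx), hxE⟩
    have huc : ContinuousAt u x := hu.continuousOn.continuousAt (hO.mem_nhds hxO)
    have hgu : g =ᶠ[nhds x] u := by
      filter_upwards [hO.mem_nhds hxO] with w hw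
      exact indicator_of_mem hw u
    have hgc : ContinuousAt g x := huc.congr hgu.symm
    have h1 := poissonInt_boundary hr0 hx hgi hC0 hgc (half_pos hη)
    have h2 := Metric.continuousAt_iff'.1 huc (η / 2) (half_pos hη)
    filter_upwards [h1, h2] with w h1 h2 hw
    have h3 := h1 hw.1
    rw [Real.dist_eq] at h2
    rw [hgu.self_of_nhds] at h3
    rw [abs_lt] at h2 h3 ⊢
    simp only [hP]
    constructor <;> linarith [h2.1, h2.2, h3.1, h3.2]
  have hPb : ∀ w ∈ ball z r, |P w| ≤ |C| := fun w hw => poissonInt_bdd hw hgi hC0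
  have heq : ∀ w ∈ ball z r \ E, lam w ≠ ⊥ → P w = u w := by
    intro w hw hne
    have h1 : (u - P) w ≤ 0 := by
      refine max_principle hl hVr hEo hEl (h := u - P) (B := |C| + |C|)
        (fun x hx => (huh x hx).sub (hPh' x hx)) ?_ ?_ hw hne
      · intro x hx
        have a1 := (abs_le.1 (hPb x hx.1)).1
        have a2 := (le_abs_self _).trans ((hC x (hsubO hx)).trans (le_abs_self C))
        simp only [Pi.sub_apply]; linarith
      · intro x hx hxE η hη
        filter_upwards [hbdry x hx hxE η hη] with y hy hy'
        exact (le_abs_self _).trans_lt (hy hy')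
    have h2 : (P - u) w ≤ 0 := by
      refine max_principle hl hVr hEo hEl (h := P - u) (B := |C| + |C|)
        (fun x hx => (hPh' x hx).sub (huh x hx)) ?_ ?_ hw hne
      · intro x hx
        have a1 := (abs_le.1 (hPb x hx.1)).2
        have a2 := (neg_le_abs _).trans ((hC x (hsubO hx)).trans (le_abs_self C))
        simp only [Pi.sub_apply]; linarith
      · intro x hx hxE η hη
        filter_upwards [hbdry x hx hxE η hη] with y hy hy'
        have := hy hy'
        rw [abs_sub_comm] at this
        exact (le_abs_self _).trans_lt this
    simp only [Pi.sub_apply] at h1 h2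
    linarith
  refine ⟨r, hr0, hbΩ, P, hPh, ?_, ?_⟩
  · intro w hw
    have hPc : ContinuousAt P w := (hPh' w hw).1.continuousAt
    have huc : ContinuousAt u w := (huh w hw).1.continuousAt
    refine tendsto_nhds_unique_of_frequently_eq hPc huc ?_
    refine ((hdense w hw.1).and_eventually (hEo.mem_nhds hw)).mono ?_
    rintro x ⟨hx1, hx2⟩
    exact heq x hx2 hx1
  · intro w hw
    refine ((hdense w hw).and_eventually (isOpen_ball.mem_nhds hw)).mono ?_
    rintro x ⟨hx1, hx2⟩ hxE
    exact hx1 (hEl x (ball_subset_closedBall hx2) hxE)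

/-- **Lemma 2 (Part Two).**  Let `Ω ⊆ ℂ` be open and `E` a closed polar subset of
`Ω`.  A bounded harmonic function on `Ω \ E` extends to a harmonic function on `Ω`. -/
theorem lemma2_rado (Ω : Set ℂ) (hΩ : IsOpen Ω) (E : Set ℂ) (hE : E ⊆ Ω)
    (hEclosed : ∀ z ∈ Ω, z ∈ closure E → z ∈ E)
    (hpolar : PolarIn E Ω)
    (u : ℂ → ℝ) (hu : HarmonicOnSet u (Ω \ E))
    (hbd : ∃ C : ℝ, ∀ z ∈ Ω \ E, |u z| ≤ C) :
    ∃ u2 : ℂ → ℝ, HarmonicOnSet u2 Ω ∧ ∀ z ∈ Ω \ E, u2 z = u z := by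
  obtain ⟨C, hC⟩ := hbd
  have hO : IsOpen (Ω \ E) := by
    have : Ω \ E = Ω \ closure E := by
      ext z
      exact ⟨fun h => ⟨h.1, fun h2 => h.2 (hEclosed z h.1 h2)⟩,
        fun h => ⟨h.1, fun h2 => h.2 (subset_closure h2)⟩⟩
    rw [this]
    exact hΩ.sdiff isClosed_closure
  rw [harm_iff hO] at hu
  have hloc := fun z : Ω => local_ext Ω hΩ E hO hpolar u hu hC z z.2
  choose r hr hrΩ P hPh hPu hfr using hloc
  classical
  refine ⟨fun w => if hw : w ∈ Ω then P ⟨w, hw⟩ w else 0, ?_, ?_⟩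
  · rw [harm_iff hΩ]
    intro z hz
    refine (InnerProductSpace.harmonicAt_congr_nhds ?_).1
      (hPh ⟨z, hz⟩ z (mem_ball_self (hr ⟨z, hz⟩)))
    filter_upwards [ball_mem_nhds z (hr ⟨z, hz⟩)] with w hw
    have hwΩ : w ∈ Ω := hrΩ ⟨z, hz⟩ hw
    simp only [hwΩ, dif_pos]
    have hw' : w ∈ ball w (r ⟨w, hwΩ⟩) := mem_ball_self (hr ⟨w, hwΩ⟩)
    refine tendsto_nhds_unique_of_frequently_eq (hPh ⟨z, hz⟩ w hw).1.continuousAt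
      (hPh ⟨w, hwΩ⟩ w hw').1.continuousAt ?_
    refine ((hfr ⟨z, hz⟩ w hw).and_eventually (Filter.inter_mem (isOpen_ball.mem_nhds hw)
      (isOpen_ball.mem_nhds hw'))).mono ?_
    rintro x ⟨hx, hx1, hx2⟩
    rw [hPu ⟨z, hz⟩ x ⟨hx1, hx⟩, hPu ⟨w, hwΩ⟩ x ⟨hx2, hx⟩]
  · intro z hz
    simp only [hz.1, dif_pos]
    exact hPu ⟨z, hz.1⟩ z ⟨mem_ball_self (hr _), hz.2⟩

end
end

section
/- Let Ω be a domain in ℂ and let E be a closed polar subset of Ω. Let g be a bounded subharmonic function on Ω and let μ = Δg be its distributional Laplacian, which is a positive measure on Ω. Then μ(E) = 0. -/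
open MeasureTheory Metric Set

noncomputable section

/-- A real-valued test function on `U ⊆ ℂ`. -/
def IsTestR (U : Set ℂ) (φ : ℂ → ℝ) : Prop :=
  ContDiff ℝ (⊤ : ℕ∞) φ ∧ HasCompactSupport φ ∧ tsupport φ ⊆ U

/-- Directional derivative. -/
def ddR (v : ℂ) (f : ℂ → ℝ) : ℂ → ℝ := fun z => fderiv ℝ f z v

theorem laplacianR_eq (u : ℂ → ℝ) (z : ℂ) :
    laplacianR u z = ddR 1 (ddR 1 u) z + ddR Complex.I (ddR Complex.I u) z := rfl

theorem ddR_smooth {f : ℂ → ℝ} (hf : ContDiff ℝ (⊤ : ℕ∞) f) (v : ℂ) :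
    ContDiff ℝ (⊤ : ℕ∞) (ddR v f) := by
  have := hf.fderiv_right (m := (⊤ : ℕ∞)) (by simp)
  exact this.clm_apply contDiff_const

theorem smooth_diff {f : ℂ → ℝ} (hf : ContDiff ℝ (⊤ : ℕ∞) f) : Differentiable ℝ f :=
  hf.differentiable (by simp)

theorem ddR_add {f g : ℂ → ℝ} (hf : ContDiff ℝ (⊤ : ℕ∞) f) (hg : ContDiff ℝ (⊤ : ℕ∞) g) (v : ℂ) :
    ddR v (fun z => f z + g z) = fun z => ddR v f z + ddR v g z := by
  funext z
  unfold ddR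
  rw [fderiv_fun_add (smooth_diff hf z) (smooth_diff hg z)]; rfl

theorem ddR_mul {f g : ℂ → ℝ} (hf : ContDiff ℝ (⊤ : ℕ∞) f) (hg : ContDiff ℝ (⊤ : ℕ∞) g) (v : ℂ) :
    ddR v (fun z => f z * g z) = fun z => f z * ddR v g z + g z * ddR v f z := by
  funext z
  unfold ddR
  rw [fderiv_fun_mul (smooth_diff hf z) (smooth_diff hg z)]; rfl

theorem ddR2_mul {f g : ℂ → ℝ} (hf : ContDiff ℝ (⊤ : ℕ∞) f) (hg : ContDiff ℝ (⊤ : ℕ∞) g) (v : ℂ) (z : ℂ) :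
    ddR v (ddR v (fun z => f z * g z)) z =
      f z * ddR v (ddR v g) z + 2 * (ddR v f z * ddR v g z) + g z * ddR v (ddR v f) z := by
  rw [ddR_mul hf hg, ddR_add (hf.mul (ddR_smooth hg v)) (hg.mul (ddR_smooth hf v)),
    ddR_mul hf (ddR_smooth hg v), ddR_mul hg (ddR_smooth hf v)]
  ring

theorem lap_mul {f g : ℂ → ℝ} (hf : ContDiff ℝ (⊤ : ℕ∞) f) (hg : ContDiff ℝ (⊤ : ℕ∞) g) (z : ℂ) :
    laplacianR (fun z => f z * g z) z =
      f z * laplacianR g z + 2 * (ddR 1 f z * ddR 1 g z + ddR Complex.I f z * ddR Complex.I g z)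
        + g z * laplacianR f z := by
  simp only [laplacianR_eq, ddR2_mul hf hg]; ring

theorem ddR_const (v : ℂ) (c : ℝ) : ddR v (fun _ => c) = fun _ => 0 := by
  funext z; simp [ddR]

theorem lap_const (c : ℝ) (z : ℂ) : laplacianR (fun _ => c) z = 0 := by
  simp [laplacianR_eq, ddR_const]

theorem lap_add {f g : ℂ → ℝ} (hf : ContDiff ℝ (⊤ : ℕ∞) f) (hg : ContDiff ℝ (⊤ : ℕ∞) g) (z : ℂ) :
    laplacianR (fun z => f z + g z) z = laplacianR f z + laplacianR g z := by
  simp only [laplacianR_eq, ddR_add hf hg, ddR_add (ddR_smooth hf _) (ddR_smooth hg _)]; ring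

theorem lap_smooth {f : ℂ → ℝ} (hf : ContDiff ℝ (⊤ : ℕ∞) f) :
    ContDiff ℝ (⊤ : ℕ∞) (laplacianR f) :=
  (ddR_smooth (ddR_smooth hf 1) 1).add (ddR_smooth (ddR_smooth hf Complex.I) Complex.I)

theorem ddR_tsupport (f : ℂ → ℝ) (v : ℂ) : tsupport (ddR v f) ⊆ tsupport f := by
  apply closure_minimal _ (isClosed_tsupport f)
  intro z hz
  by_contra h
  have : fderiv ℝ f z = 0 := by
    by_contra h2
    exact h (support_fderiv_subset ℝ h2)
  apply hz
  simp [ddR, this]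

theorem ddR_compact {f : ℂ → ℝ} (hf : HasCompactSupport f) (v : ℂ) :
    HasCompactSupport (ddR v f) :=
  hf.of_isClosed_subset (isClosed_tsupport _) (ddR_tsupport f v)

theorem lap_zero_off (f : ℂ → ℝ) {z : ℂ} (hz : z ∉ tsupport f) : laplacianR f z = 0 := by
  have h1 : ∀ v, ddR v (ddR v f) z = 0 := fun v => by
    by_contra h
    exact hz (ddR_tsupport f v (ddR_tsupport _ v (subset_tsupport _ h)))
  simp [laplacianR_eq, h1]

theorem lap_compact {f : ℂ → ℝ} (hf : HasCompactSupport f) :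
    HasCompactSupport (laplacianR f) :=
  HasCompactSupport.intro hf (fun _ hz => lap_zero_off f hz)

theorem ibp1 {f χ : ℂ → ℝ} (hf : ContDiff ℝ (⊤ : ℕ∞) f) (hχ : ContDiff ℝ (⊤ : ℕ∞) χ)
    (hc : HasCompactSupport χ) (v : ℂ) :
    ∫ z, f z * ddR v χ z = - ∫ z, ddR v f z * χ z := by
  apply integral_mul_fderiv_eq_neg_fderiv_mul_of_integrable
  · exact ((ddR_smooth hf v).continuous.mul hχ.continuous).integrable_of_hasCompactSupport
      (hc.mul_left)
  · exact (hf.continuous.mul (ddR_smooth hχ v).continuous).integrable_of_hasCompactSupport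
      ((ddR_compact hc v).mul_left)
  · exact (hf.continuous.mul hχ.continuous).integrable_of_hasCompactSupport
      (hc.mul_left)
  · exact fun x _ => smooth_diff hf x
  · exact fun x _ => smooth_diff hχ x

theorem ibp_lap {f χ : ℂ → ℝ} (hf : ContDiff ℝ (⊤ : ℕ∞) f) (hχ : ContDiff ℝ (⊤ : ℕ∞) χ)
    (hc : HasCompactSupport χ) :
    ∫ z, f z * laplacianR χ z = ∫ z, laplacianR f z * χ z := by
  have h : ∀ v, ∫ z, f z * ddR v (ddR v χ) z = ∫ z, ddR v (ddR v f) z * χ z := fun v => by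
    rw [ibp1 hf (ddR_smooth hχ v) (ddR_compact hc v), ibp1 (ddR_smooth hf v) hχ hc, neg_neg]
  simp only [laplacianR_eq, mul_add, add_mul]
  rw [integral_add, integral_add, h, h]
  · exact ((ddR_smooth (ddR_smooth hf _) _).continuous.mul
      hχ.continuous).integrable_of_hasCompactSupport (hc.mul_left)
  · exact ((ddR_smooth (ddR_smooth hf _) _).continuous.mul
      hχ.continuous).integrable_of_hasCompactSupport (hc.mul_left)
  · exact (hf.continuous.mul (ddR_smooth (ddR_smooth hχ _) _).continuous).integrable_of_hasCompactSupport
      ((ddR_compact (ddR_compact hc _) _).mul_left)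
  · exact (hf.continuous.mul (ddR_smooth (ddR_smooth hχ _) _).continuous).integrable_of_hasCompactSupport
      ((ddR_compact (ddR_compact hc _) _).mul_left)

theorem int_lap_zero {χ : ℂ → ℝ} (hχ : ContDiff ℝ (⊤ : ℕ∞) χ)
    (hc : HasCompactSupport χ) : ∫ z, laplacianR χ z = 0 := by
  have := ibp_lap (f := fun _ => 1) contDiff_const hχ hc
  simpa [lap_const] using this

/-- Sub-mean value on circle. -/
def SubMeanAt (s : ℂ → ℝ) (c : ℂ) (r : ℝ) : Prop :=
  s c ≤ (2 * Real.pi)⁻¹ * ∫ θ in (0:ℝ)..(2 * Real.pi), s (circleMap c r θ)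

theorem taylor2 {s : ℂ → ℝ} (hs : ContDiff ℝ (⊤ : ℕ∞) s) (c : ℂ) {η : ℝ} (hη : 0 < η) :
    ∃ δ > 0, ∀ z, ‖z‖ < δ →
      |s (c + z) - s c - fderiv ℝ s c z - (1/2) * fderiv ℝ (fderiv ℝ s) c z z| ≤ η * ‖z‖ ^ 2 := by
  have hsd : ContDiff ℝ (⊤ : ℕ∞) (fderiv ℝ s) := hs.fderiv_right (by simp)
  have hD : HasFDerivAt (fderiv ℝ s) (fderiv ℝ (fderiv ℝ s) c) c :=
    (hsd.differentiable (by simp) c).hasFDerivAt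
  have hsym : IsSymmSndFDerivAt ℝ s c := hs.contDiffAt.isSymmSndFDerivAt (by
    simp only [minSmoothness_of_isRCLikeNormedField]
    exact WithTop.coe_le_coe.2 le_top)
  set D := fderiv ℝ (fderiv ℝ s) c
  have h1 := hasFDerivAt_iff_isLittleO_nhds_zero.1 hD
  have h2 := h1.def hη
  obtain ⟨δ, hδ, h3⟩ := Metric.eventually_nhds_iff_ball.1 h2
  refine ⟨δ, hδ, fun z hz => ?_⟩
  set F : ℂ → ℝ := fun z => s (c + z) - s c - fderiv ℝ s c z - (1/2) * D z z with hF
  have hFd : ∀ y, HasFDerivAt F (fderiv ℝ s (c + y) - fderiv ℝ s c - D y) y := by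
    intro y
    have e1 : HasFDerivAt (fun z => s (c + z)) (fderiv ℝ s (c + y)) y := by
      have := (smooth_diff hs (c + y)).hasFDerivAt.comp y ((hasFDerivAt_id y).const_add c)
      rw [ContinuousLinearMap.comp_id] at this
      exact this
    have e2 : HasFDerivAt (fun z => D z z) (D y + D.flip y) y := by
      have := (D.hasFDerivAt (x := y)).clm_apply (hasFDerivAt_id y)
      refine this.congr_fderiv ?_
      ext <;> simp
    have := ((e1.sub_const (s c)).sub (fderiv ℝ s c).hasFDerivAt).sub (e2.const_mul (1/2))
    refine this.congr_fderiv ?_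
    ext
    all_goals
      simp
      rw [hsym.eq]
      ring
  have := (convex_ball (0:ℂ) δ |>.inter (convex_closedBall (0:ℂ) ‖z‖)).norm_image_sub_le_of_norm_hasFDerivWithin_le
    (f := F) (f' := fun y => fderiv ℝ s (c + y) - fderiv ℝ s c - D y) (C := η * ‖z‖) (x := 0) (y := z)
    (fun y _ => (hFd y).hasFDerivWithinAt)
    (fun y hy => (h3 y hy.1).trans (by
      have : ‖y‖ ≤ ‖z‖ := by simpa using hy.2
      gcongr)) (by simp [hδ]) (by simpa using hz)
  have hF0 : F 0 = 0 := by simp [hF]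
  rw [hF0] at this
  simp only [sub_zero] at this
  calc _ = ‖F z‖ := rfl
    _ ≤ _ := this
    _ = _ := by ring

theorem lap_eq_hess {s : ℂ → ℝ} (hs : ContDiff ℝ (⊤ : ℕ∞) s) (c : ℂ) :
    laplacianR s c = fderiv ℝ (fderiv ℝ s) c 1 1 +
      fderiv ℝ (fderiv ℝ s) c Complex.I Complex.I := by
  have hsd : ContDiff ℝ (⊤ : ℕ∞) (fderiv ℝ s) := hs.fderiv_right (by simp)
  have h : ∀ v, fderiv ℝ (fun w => fderiv ℝ s w v) c v = fderiv ℝ (fderiv ℝ s) c v v := by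
    intro v
    rw [fderiv_clm_apply (hsd.differentiable (by simp) c) (by fun_prop)]
    simp
  rw [laplacianR, h, h]

theorem lap_nonneg {s : ℂ → ℝ} (hs : ContDiff ℝ (⊤ : ℕ∞) s) (c : ℂ) {r₀ : ℝ} (hr₀ : 0 < r₀)
    (hm : ∀ r, 0 < r → r < r₀ → SubMeanAt s c r) : 0 ≤ laplacianR s c := by
  by_contra! hneg
  obtain ⟨δ, hδ, hT⟩ := taylor2 hs c (η := - laplacianR s c / 8) (by linarith)
  set D := fderiv ℝ (fderiv ℝ s) c with hD
  have hL := lap_eq_hess hs c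
  rw [← hD] at hL
  have hsym : IsSymmSndFDerivAt ℝ s c := hs.contDiffAt.isSymmSndFDerivAt (by
    simp only [minSmoothness_of_isRCLikeNormedField]
    exact WithTop.coe_le_coe.2 le_top)
  set l := fderiv ℝ s c with hl
  set L := laplacianR s c with hLL
  obtain ⟨r, hr, hrr⟩ := exists_between (lt_min hr₀ hδ)
  have hm := hm r hr (hrr.trans_le (min_le_left _ _))
  have hrδ : r < δ := hrr.trans_le (min_le_right _ _)
  unfold SubMeanAt at hm
  have key : ∀ θ : ℝ, s (circleMap c r θ) ≤ s c + r * (l 1 * Real.cos θ + l Complex.I * Real.sin θ)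
      + r^2/2 * (D 1 1 * Real.cos θ ^ 2 + 2 * D 1 Complex.I * (Real.sin θ * Real.cos θ)
        + D Complex.I Complex.I * Real.sin θ ^ 2) - L / 8 * r ^ 2 := by
    intro θ
    have hz : (r : ℂ) * Complex.exp (θ * Complex.I)
        = (r * Real.cos θ) • (1 : ℂ) + (r * Real.sin θ) • Complex.I := by
      rw [Complex.exp_mul_I]; simp; ring
    have hn : ‖(r : ℂ) * Complex.exp (θ * Complex.I)‖ = r := by
      simp [Complex.norm_exp_ofReal_mul_I, abs_of_pos hr]
    have := hT ((r : ℂ) * Complex.exp (θ * Complex.I)) (by rw [hn]; exact hrδ)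
    rw [hn] at this
    have := (abs_le.1 this).2
    rw [circleMap]
    rw [hz] at this ⊢
    have hs1 : D Complex.I 1 = D 1 Complex.I := hsym.eq _ _
    simp only [map_add, map_smul, add_apply, smul_apply,
      smul_eq_mul, hs1] at this
    nlinarith [this]
  have hint : ∫ θ in (0:ℝ)..(2 * Real.pi), s (circleMap c r θ) ≤
      ∫ θ in (0:ℝ)..(2 * Real.pi), (s c + r * (l 1 * Real.cos θ + l Complex.I * Real.sin θ)
      + r^2/2 * (D 1 1 * Real.cos θ ^ 2 + 2 * D 1 Complex.I * (Real.sin θ * Real.cos θ)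
        + D Complex.I Complex.I * Real.sin θ ^ 2) - L / 8 * r ^ 2) := by
    apply intervalIntegral.integral_mono_on (by positivity)
    · exact (hs.continuous.comp (continuous_circleMap c r)).intervalIntegrable _ _
    · apply Continuous.intervalIntegrable; fun_prop
    · exact fun θ _ => key θ
  have hval : ∫ θ in (0:ℝ)..(2 * Real.pi), (s c + r * (l 1 * Real.cos θ + l Complex.I * Real.sin θ)
      + r^2/2 * (D 1 1 * Real.cos θ ^ 2 + 2 * D 1 Complex.I * (Real.sin θ * Real.cos θ)
        + D Complex.I Complex.I * Real.sin θ ^ 2) - L / 8 * r ^ 2)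
      = 2 * Real.pi * (s c + r^2/4 * L - L/8 * r^2) := by
    rw [intervalIntegral.integral_sub, intervalIntegral.integral_add, intervalIntegral.integral_add,
      intervalIntegral.integral_const_mul, intervalIntegral.integral_const_mul,
      intervalIntegral.integral_add, intervalIntegral.integral_add, intervalIntegral.integral_add,
      intervalIntegral.integral_const_mul, intervalIntegral.integral_const_mul,
      intervalIntegral.integral_const_mul, intervalIntegral.integral_const_mul,
      intervalIntegral.integral_const_mul, integral_cos_sq, integral_sin_sq,
      integral_sin_mul_cos₁, integral_cos, integral_sin]
    · simp; rw [hL]; ring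
    all_goals (apply Continuous.intervalIntegrable; fun_prop)
  rw [hval] at hint
  have hpi := Real.pi_pos
  have : s c ≤ (2 * Real.pi)⁻¹ * (2 * Real.pi * (s c + r^2/4 * L - L/8 * r^2)) :=
    hm.trans (by gcongr)
  rw [inv_mul_cancel_left₀ (by positivity)] at this
  nlinarith [mul_pos hr hr, mul_pos (mul_pos hr hr) (neg_pos.2 hneg)]

theorem area_mean {s : ℂ → ℝ} (hs : Continuous s) (h0 : ∀ z, s z ≤ 0) {w : ℂ} {ρ : ℝ} (hρ : 0 < ρ)
    (hm : ∀ r, 0 < r → r < ρ → SubMeanAt s w r) :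
    ∫ z in ball w ρ, (- s z) ≤ 2 * Real.pi * ρ ^ 2 * (- s w) := by
  have hpi := Real.pi_pos
  have e1 : ∫ z in ball w ρ, (- s z) = ∫ z, (ball (0:ℂ) ρ).indicator (fun z => - s (w + z)) z := by
    rw [← integral_indicator measurableSet_ball, ← integral_add_left_eq_self _ w]
    congr 1
    funext z
    simp [indicator]
  have e2 : ∀ p ∈ polarCoord.target,
      p.1 • (ball (0:ℂ) ρ).indicator (fun z => - s (w + z)) (Complex.polarCoord.symm p)
      = (Ioo (0:ℝ) ρ ×ˢ Ioo (-Real.pi) Real.pi).indicator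
        (fun p : ℝ × ℝ => p.1 * (- s (circleMap w p.1 p.2))) p := by
    rintro ⟨r, θ⟩ hp
    simp only [polarCoord_target, mem_prod, mem_Ioi, mem_Ioo] at hp
    have hx : Complex.polarCoord.symm (r, θ) = (r : ℂ) * Complex.exp (θ * Complex.I) := by
      rw [Complex.polarCoord_symm_apply, Complex.exp_mul_I]; simp
    rw [hx]
    by_cases hr : r < ρ
    · rw [indicator_of_mem, indicator_of_mem]
      · rfl
      · exact ⟨⟨hp.1, hr⟩, hp.2⟩
      · simp [Complex.norm_exp_ofReal_mul_I, abs_of_pos hp.1, hr]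
    · rw [indicator_of_notMem, indicator_of_notMem]
      · simp
      · exact fun h => hr h.1.2
      · simpa [Complex.norm_exp_ofReal_mul_I, abs_of_pos hp.1] using hr
  have hcont : Continuous (fun p : ℝ × ℝ => p.1 * (- s (circleMap w p.1 p.2))) := by
    unfold circleMap; fun_prop
  have hIo : IntegrableOn (fun p : ℝ × ℝ => p.1 * (- s (circleMap w p.1 p.2)))
      (Ioo (0:ℝ) ρ ×ˢ Ioo (-Real.pi) Real.pi) (volume.prod volume) := by
    rw [← Measure.volume_eq_prod]
    exact (hcont.continuousOn.integrableOn_compact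
      ((isCompact_Icc (a := (0:ℝ)) (b := ρ)).prod
        (isCompact_Icc (a := -Real.pi) (b := Real.pi)))).mono_set
      (prod_mono Ioo_subset_Icc_self Ioo_subset_Icc_self)
  rw [e1, ← Complex.integral_comp_polarCoord_symm,
    setIntegral_congr_fun polarCoord.open_target.measurableSet e2,
    setIntegral_indicator (measurableSet_Ioo.prod measurableSet_Ioo), inter_eq_right.2 (by
      rw [polarCoord_target]
      exact prod_mono (fun x hx => hx.1) subset_rfl), Measure.volume_eq_prod,
    setIntegral_prod _ hIo]
  have inner : ∀ r ∈ Ioo (0:ℝ) ρ, ∫ θ in Ioo (-Real.pi) Real.pi, r * (- s (circleMap w r θ)) ≤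
      2 * Real.pi * ρ * (- s w) := by
    intro r hr
    have h := hm r hr.1 hr.2
    unfold SubMeanAt at h
    rw [integral_const_mul, ← integral_Ioc_eq_integral_Ioo,
      ← intervalIntegral.integral_of_le (by linarith), intervalIntegral.integral_neg]
    have hper : ∫ θ in (-Real.pi)..Real.pi, s (circleMap w r θ) =
        ∫ θ in (0:ℝ)..(2 * Real.pi), s (circleMap w r θ) := by
      have hp : Function.Periodic (fun θ => s (circleMap w r θ)) (2 * Real.pi) := fun θ => by
        simp [(periodic_circleMap w r) θ]
      have := hp.intervalIntegral_add_eq (-Real.pi) 0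
      rw [zero_add] at this
      rw [← this]; congr 1; ring
    rw [hper]
    set J := ∫ θ in (0:ℝ)..(2 * Real.pi), s (circleMap w r θ)
    have h' : 2 * Real.pi * s w ≤ J := by
      calc _ ≤ 2 * Real.pi * ((2 * Real.pi)⁻¹ * J) := by gcongr
        _ = J := by field_simp
    have hsw := h0 w
    calc r * -J ≤ r * (2 * Real.pi * (- s w)) := by
          apply mul_le_mul_of_nonneg_left _ hr.1.le; linarith
      _ ≤ ρ * (2 * Real.pi * (- s w)) := by
          apply mul_le_mul_of_nonneg_right hr.2.le
          have : 0 ≤ - s w := by linarith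
          positivity
      _ = _ := by ring
  calc _ ≤ ∫ r in Ioo (0:ℝ) ρ, 2 * Real.pi * ρ * (- s w) := by
        apply setIntegral_mono_on _ _ measurableSet_Ioo inner
        · have h := hIo
          unfold IntegrableOn at h
          rw [← Measure.prod_restrict] at h
          exact Integrable.integral_prod_left h
        · exact integrableOn_const (by simp)
    _ = _ := by simp [hρ.le]; ring

theorem supconv (u : ℂ → ℝ) (h1 : ∀ z, -1 ≤ u z) (h0 : ∀ z, u z ≤ 0) {k : ℝ} (hk : 0 < k) :
    ∃ v : ℂ → ℝ, (∀ z, v z ≤ 0) ∧ (∀ z, -1 ≤ v z) ∧ (∀ z, u z ≤ v z) ∧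
      (∀ x y, |v x - v y| ≤ k * ‖x - y‖) ∧
      (∀ z ζ, u ζ - k * ‖ζ - z‖ ≤ v z) ∧
      (∀ z a, -1 ≤ a → (∀ ζ, ‖ζ - z‖ ≤ 1 / k → u ζ - k * ‖ζ - z‖ ≤ a) → v z ≤ a) := by
  have hbd : ∀ z, BddAbove (range fun ζ => u ζ - k * ‖ζ - z‖) := fun z => ⟨0, by
    rintro _ ⟨ζ, rfl⟩
    have := h0 ζ
    have : 0 ≤ k * ‖ζ - z‖ := by positivity
    simp only; linarith⟩
  have hge : ∀ z ζ, u ζ - k * ‖ζ - z‖ ≤ ⨆ ζ, (u ζ - k * ‖ζ - z‖) := fun z ζ =>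
    le_ciSup (hbd z) ζ
  have hu : ∀ z, u z ≤ ⨆ ζ, (u ζ - k * ‖ζ - z‖) := fun z => by simpa using hge z z
  have hlip : ∀ x y, (⨆ ζ, (u ζ - k * ‖ζ - x‖)) ≤ (⨆ ζ, (u ζ - k * ‖ζ - y‖)) + k * ‖x - y‖ := by
    intro x y
    apply ciSup_le
    intro ζ
    have := hge y ζ
    have h3 : ‖ζ - y‖ ≤ ‖ζ - x‖ + ‖x - y‖ := norm_sub_le_norm_sub_add_norm_sub _ _ _
    have h4 := mul_le_mul_of_nonneg_left h3 hk.le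
    linarith
  refine ⟨fun z => ⨆ ζ, (u ζ - k * ‖ζ - z‖), ?_, ?_, hu, ?_, hge, ?_⟩
  · intro z
    apply ciSup_le
    intro ζ
    have := h0 ζ
    have : 0 ≤ k * ‖ζ - z‖ := by positivity
    linarith
  · exact fun z => (h1 z).trans (hu z)
  · intro x y
    have a := hlip x y
    have b := hlip y x
    rw [norm_sub_rev y x] at b
    rw [abs_le]; constructor <;> linarith
  · intro z a ha h
    apply ciSup_le
    intro ζ
    by_cases hζ : ‖ζ - z‖ ≤ 1 / k
    · exact h ζ hζ
    · have hb := h0 ζ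
      have : 1 ≤ k * ‖ζ - z‖ := by
        rw [not_le, div_lt_iff₀ hk] at hζ; linarith
      linarith

open scoped Convolution in
theorem mollify {v : ℂ → ℝ} {k ε : ℝ} (h1 : ∀ z, -1 ≤ v z) (h0 : ∀ z, v z ≤ 0)
    (hv : ∀ x y, |v x - v y| ≤ k * ‖x - y‖) (hk : 0 < k) (hε : 0 < ε) :
    ∃ s : ℂ → ℝ, ContDiff ℝ (⊤ : ℕ∞) s ∧ (∀ z, -1 ≤ s z) ∧ (∀ z, s z ≤ 0) ∧
      (∀ z, |s z - v z| ≤ k * ε) ∧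
      (∀ x, (∀ y ∈ ball x ε, v y = -1) → s x = -1) ∧
      (∀ c r, (∀ t, ‖t‖ ≤ ε → SubMeanAt v (c - t) r) → SubMeanAt s c r) := by
  have hpi := Real.pi_pos
  let φ : ContDiffBump (0:ℂ) := ⟨ε / 2, ε, by positivity, by linarith⟩
  have hvc : Continuous v := by
    have : LipschitzWith k.toNNReal v := by
      apply LipschitzWith.of_dist_le_mul
      intro x y
      rw [Real.dist_eq, dist_eq_norm, Real.coe_toNNReal _ hk.le]
      exact hv x y
    exact this.continuous
  set ψ := φ.normed (volume : Measure ℂ) with hψ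
  have hψc : Continuous ψ := φ.continuous_normed
  have hψ0 : ∀ t, 0 ≤ ψ t := fun t => φ.nonneg_normed t
  have hψi : Integrable ψ := φ.integrable_normed
  have hψ1 : ∫ t, ψ t = 1 := φ.integral_normed
  have hψs : ∀ t, ¬ ‖t‖ ≤ ε → ψ t = 0 := fun t ht => by
    by_contra h
    have : t ∈ Function.support ψ := h
    rw [hψ, φ.support_normed_eq] at this
    simp at this
    exact ht this.le
  have hint : ∀ x, Integrable (fun t => ψ t * v (x - t)) := fun x =>
    (hψc.mul (hvc.comp (by fun_prop))).integrable_of_hasCompactSupport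
      (φ.hasCompactSupport_normed.mul_right)
  set s := (ψ ⋆[ContinuousLinearMap.lsmul ℝ ℝ, volume] v) with hs
  have hsx : ∀ x, s x = ∫ t, ψ t * v (x - t) := fun x => rfl
  have hsm : ContDiff ℝ (⊤ : ℕ∞) s :=
    φ.hasCompactSupport_normed.contDiff_convolution_left _ φ.contDiff_normed
      hvc.locallyIntegrable
  refine ⟨s, hsm, ?_, ?_, ?_, ?_, ?_⟩
  · intro z
    rw [hsx]
    calc (-1 : ℝ) = ∫ t, ψ t * (-1) := by rw [integral_mul_const, hψ1]; simp
      _ ≤ _ := integral_mono (hψi.mul_const _) (hint z)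
        (fun t => mul_le_mul_of_nonneg_left (h1 _) (hψ0 t))
  · intro z
    rw [hsx]
    exact integral_nonpos (fun t => mul_nonpos_of_nonneg_of_nonpos (hψ0 t) (h0 _))
  · intro z
    have := φ.dist_normed_convolution_le (μ := (volume : Measure ℂ)) (g := v) (x₀ := z) (ε := k * ε)
      hvc.aestronglyMeasurable (fun x hx => by
        rw [Real.dist_eq]
        refine (hv x z).trans ?_
        have : ‖x - z‖ < ε := by rw [← dist_eq_norm]; exact hx
        gcongr)
    rw [Real.dist_eq] at this
    exact this
  · intro x hx
    have hxx : v x = -1 := hx x (mem_ball_self hε)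
    have := φ.normed_convolution_eq_right (μ := (volume : Measure ℂ)) (g := v) (x₀ := x)
      (fun y hy => by rw [hxx]; exact hx y hy)
    rw [← hxx, ← this]
  · intro c r h
    unfold SubMeanAt at h ⊢
    have hswap : ∫ θ in (0:ℝ)..(2 * Real.pi), s (circleMap c r θ) =
        ∫ t, ψ t * ∫ θ in (0:ℝ)..(2 * Real.pi), v (circleMap (c - t) r θ) := by
      simp only [hsx, intervalIntegral.integral_of_le (show (0:ℝ) ≤ 2 * Real.pi by positivity)]
      rw [integral_integral_swap]
      · congr 1; funext t
        rw [← integral_const_mul]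
        congr 1; funext θ
        simp only [circleMap]; congr 2; ring
      · have hb : Integrable (fun p : ℝ × ℂ => (1:ℝ) * ψ p.2)
            ((volume.restrict (Ioc 0 (2 * Real.pi))).prod volume) :=
          (integrable_const (1:ℝ)).mul_prod hψi
        refine hb.mono' ?_ ?_
        · apply Continuous.aestronglyMeasurable
          unfold Function.uncurry circleMap
          fun_prop
        · refine Filter.Eventually.of_forall (fun p => ?_)
          simp only [Function.uncurry, Real.norm_eq_abs, abs_mul, abs_of_nonneg (hψ0 _), one_mul]
          apply mul_le_of_le_one_right (hψ0 _)
          rw [abs_le]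
          exact ⟨h1 _, (h0 _).trans zero_le_one⟩
    rw [hswap, hsx, ← integral_const_mul]
    have hcJ : Continuous (fun t : ℂ => ∫ θ in (0:ℝ)..(2 * Real.pi), v (circleMap (c - t) r θ)) := by
      apply intervalIntegral.continuous_parametric_intervalIntegral_of_continuous'
      unfold Function.uncurry circleMap
      fun_prop
    apply integral_mono (hint c)
    · apply Integrable.const_mul
      exact (hψc.mul hcJ).integrable_of_hasCompactSupport (φ.hasCompactSupport_normed.mul_right)
    · intro t
      by_cases ht : ‖t‖ ≤ ε
      · have := mul_le_mul_of_nonneg_left (h t ht) (hψ0 t)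
        simp only
        linarith
      · simp [hψs t ht]

theorem exists_smooth {lam : ℂ → EReal} {V : Set ℂ} (hl : SubharmonicERealOn lam V)
    {z₀ : ℂ} {R : ℝ} (hR : 0 < R) (hB : closedBall z₀ (4 * R) ⊆ V) {M : ℝ}
    (hM : ∀ z ∈ closedBall z₀ (4 * R), lam z ≤ (M : EReal))
    {K : Set ℂ} (hK : IsCompact K) (hKR : K ⊆ closedBall z₀ R) (hKl : ∀ z ∈ K, lam z = ⊥)
    {w : ℂ} (hw : w ∈ closedBall z₀ (4 * R)) {C₀ : ℝ} (hC₀ : ((M - C₀ : ℝ) : EReal) ≤ lam w)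
    {N : ℝ} (hN : 0 < N) :
    ∃ s : ℂ → ℝ, ContDiff ℝ (⊤ : ℕ∞) s ∧ (∀ z, -1 ≤ s z) ∧ (∀ z, s z ≤ 0) ∧
      (∀ z ∈ K, s z = -1) ∧ -(C₀ + 1) / N ≤ s w ∧
      ∀ c r, 0 < r → dist c z₀ + r ≤ 3 * R → SubMeanAt s c r := by
  classical
  have hpi := Real.pi_pos
  obtain ⟨husc, htop, hmean⟩ := hl
  let u : ℂ → ℝ := fun z =>
    if z ∈ closedBall z₀ (4 * R) ∧ ((M - N : ℝ) : EReal) < lam z then ((lam z).toReal - M) / N else -1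
  -- on the good set, `lam` is real
  have hreal : ∀ z, z ∈ closedBall z₀ (4 * R) → ((M - N : ℝ) : EReal) < lam z →
      ∃ x : ℝ, lam z = (x : EReal) ∧ M - N < x ∧ x ≤ M ∧ u z = (x - M) / N := by
    intro z hz hlz
    have hne : lam z ≠ ⊥ := (lt_of_le_of_lt bot_le hlz).ne'
    have hnt : lam z ≠ ⊤ := htop z (hB hz)
    have hx := EReal.coe_toReal hnt hne
    refine ⟨(lam z).toReal, hx.symm, ?_, ?_, ?_⟩
    · rw [← hx] at hlz; exact_mod_cast hlz
    · have := hM z hz; rw [← hx] at this; exact_mod_cast this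
    · simp only [u]; rw [if_pos ⟨hz, hlz⟩]
  have hu_else : ∀ z, ¬ (z ∈ closedBall z₀ (4 * R) ∧ ((M - N : ℝ) : EReal) < lam z) → u z = -1 := by
    intro z hz; simp only [u]; rw [if_neg hz]
  have hu1 : ∀ z, -1 ≤ u z := by
    intro z
    by_cases h : z ∈ closedBall z₀ (4 * R) ∧ ((M - N : ℝ) : EReal) < lam z
    · obtain ⟨x, -, h1, h2, h3⟩ := hreal z h.1 h.2
      rw [h3, le_div_iff₀ hN]; linarith
    · rw [hu_else z h]
  have hu0 : ∀ z, u z ≤ 0 := by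
    intro z
    by_cases h : z ∈ closedBall z₀ (4 * R) ∧ ((M - N : ℝ) : EReal) < lam z
    · obtain ⟨x, -, h1, h2, h3⟩ := hreal z h.1 h.2
      rw [h3, div_le_iff₀ hN]; linarith
    · rw [hu_else z h]; norm_num
  have hlam_le : ∀ z ∈ closedBall z₀ (4 * R), lam z ≤ ((M + N * u z : ℝ) : EReal) := by
    intro z hz
    by_cases h : ((M - N : ℝ) : EReal) < lam z
    · obtain ⟨x, h0, h1, h2, h3⟩ := hreal z hz h
      rw [h0, h3]
      apply EReal.coe_le_coe_iff.2
      rw [mul_div_cancel₀ _ hN.ne']; linarith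
    · rw [hu_else z (fun h' => h h'.2)]
      refine (not_lt.1 h).trans ?_
      apply EReal.coe_le_coe_iff.2; linarith
  -- neighbourhood of K
  have hUopen : IsOpen {z | z ∈ ball z₀ (4 * R) ∧ lam z < ((M - N : ℝ) : EReal)} := by
    rw [isOpen_iff_mem_nhds]
    rintro z ⟨hz, hlz⟩
    have h1 := husc z (hB (ball_subset_closedBall hz)) _ hlz
    have hV : V ∈ nhds z := Filter.mem_of_superset (isOpen_ball.mem_nhds hz)
      (ball_subset_closedBall.trans hB)
    rw [nhdsWithin_eq_nhds.2 hV] at h1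
    filter_upwards [h1, isOpen_ball.mem_nhds hz] with y h1 h2 using ⟨h2, h1⟩
  obtain ⟨τ, hτ, hτU⟩ := hK.exists_thickening_subset_open hUopen (fun z hz => by
    refine ⟨?_, ?_⟩
    · have := hKR hz
      rw [mem_closedBall] at this
      rw [mem_ball]; linarith
    · rw [hKl z hz]; exact EReal.bot_lt_coe _)
  have hτ1 : ∀ z ∈ thickening τ K, u z = -1 := fun z hz =>
    hu_else z (fun h => (lt_asymm h.2 (hτU hz).2))
  -- parameters
  set m := min (τ / 3) (R / 2) with hm
  have hm0 : 0 < m := by positivity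
  have hm1 : m ≤ τ / 3 := min_le_left _ _
  have hm2 : m ≤ R / 2 := min_le_right _ _
  set k := 1 / m with hk
  have hk0 : 0 < k := by positivity
  have hkm : 1 / k = m := by rw [hk]; field_simp
  obtain ⟨v, hv0, hv1, huv, hvl, hvge, hvle⟩ := supconv u hu1 hu0 hk0
  rw [hkm] at hvle
  have hvc : Continuous v := by
    have : LipschitzWith k.toNNReal v := by
      apply LipschitzWith.of_dist_le_mul
      intro x y
      rw [Real.dist_eq, dist_eq_norm, Real.coe_toNNReal _ hk0.le]
      exact hvl x y
    exact this.continuous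
  set ε := min m (1 / (k * N)) with hεd
  have hε : 0 < ε := by positivity
  have hεm : ε ≤ m := min_le_left _ _
  have hkε : k * ε ≤ 1 / N := by
    calc k * ε ≤ k * (1 / (k * N)) := by gcongr; exact min_le_right _ _
      _ = 1 / N := by field_simp
  obtain ⟨s, hs, hs1, hs0, hsv, hsK, hsm⟩ := mollify hv1 hv0 hvl hk0 hε
  refine ⟨s, hs, hs1, hs0, ?_, ?_, ?_⟩
  · intro z hz
    apply hsK
    intro y hy
    apply le_antisymm _ (hv1 y)
    apply hvle y _ le_rfl
    intro ζ hζ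
    have : u ζ = -1 := hτ1 ζ (by
      rw [mem_thickening_iff]
      refine ⟨z, hz, ?_⟩
      have h1 : dist ζ y ≤ m := by rw [dist_eq_norm]; exact hζ
      have h2 : dist y z < ε := hy
      have := dist_triangle ζ y z
      linarith)
    rw [this]
    have : 0 ≤ k * ‖ζ - y‖ := by positivity
    linarith
  · have h1 := (abs_le.1 (hsv w)).1
    have h2 := huv w
    have h3 : - C₀ / N ≤ u w := by
      by_cases h : ((M - N : ℝ) : EReal) < lam w
      · obtain ⟨x, h0, -, -, h3⟩ := hreal w hw h
        rw [h0] at hC₀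
        have : M - C₀ ≤ x := by exact_mod_cast hC₀
        rw [h3]; gcongr; linarith
      · rw [hu_else w (fun h' => h h'.2)]
        have := hC₀.trans (not_lt.1 h)
        have : M - C₀ ≤ M - N := by exact_mod_cast this
        rw [div_le_iff₀ hN]; linarith
    have : -(C₀ + 1) / N = - C₀ / N - 1 / N := by ring
    linarith
  · intro c r hr hcr
    apply hsm
    intro t ht
    unfold SubMeanAt
    set a := c - t with ha
    set J := (2 * Real.pi)⁻¹ * ∫ θ in (0:ℝ)..(2 * Real.pi), v (circleMap a r θ) with hJ
    have hvci : IntervalIntegrable (fun θ => v (circleMap a r θ)) volume 0 (2 * Real.pi) :=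
      (hvc.comp (continuous_circleMap a r)).intervalIntegrable _ _
    have hJ1 : -1 ≤ J := by
      have : ∫ θ in (0:ℝ)..(2 * Real.pi), (-1 : ℝ) ≤
          ∫ θ in (0:ℝ)..(2 * Real.pi), v (circleMap a r θ) := by
        apply intervalIntegral.integral_mono_on (by positivity) (by simp) hvci
        exact fun θ _ => hv1 _
      rw [hJ]
      calc (-1 : ℝ) = (2 * Real.pi)⁻¹ * ∫ θ in (0:ℝ)..(2 * Real.pi), (-1 : ℝ) := by
            simp; field_simp
        _ ≤ _ := by gcongr
    apply hvle a J hJ1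
    intro ζ hζ
    have hζz : dist ζ z₀ + r ≤ 4 * R := by
      have h1 : dist ζ a ≤ m := by rw [dist_eq_norm]; exact hζ
      have h2 : dist a c ≤ ε := by rw [dist_eq_norm, ha]; simpa using ht
      have h3 := dist_triangle4 ζ a c z₀
      linarith
    have hsub : closedBall ζ r ⊆ closedBall z₀ (4 * R) := by
      apply closedBall_subset_closedBall'
      linarith
    have hζB : ζ ∈ closedBall z₀ (4 * R) := hsub (mem_closedBall_self hr.le)
    by_cases h : ((M - N : ℝ) : EReal) < lam ζ
    swap
    · rw [hu_else ζ (fun h' => h h'.2)]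
      have : 0 ≤ k * ‖ζ - a‖ := by positivity
      linarith
    obtain ⟨x, hx, -, -, hux⟩ := hreal ζ hζB h
    have hmaj := hmean ζ r hr (hsub.trans hB)
      (fun θ => (M + N * (k * ‖ζ - a‖)) + N * v (circleMap a r θ))
      (continuous_const.add (continuous_const.mul (hvc.comp (continuous_circleMap a r))))
      (fun θ => by
        have hmem : circleMap ζ r θ ∈ closedBall z₀ (4 * R) :=
          hsub (circleMap_mem_closedBall ζ hr.le θ)
        refine (hlam_le _ hmem).trans ?_
        apply EReal.coe_le_coe_iff.2
        have h1 := hvge (circleMap a r θ) (circleMap ζ r θ)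
        have h2 : circleMap ζ r θ - circleMap a r θ = ζ - a := by simp [circleMap]
        rw [h2] at h1
        have := mul_le_mul_of_nonneg_left h1 hN.le
        linarith)
    rw [hx] at hmaj
    have hmaj := EReal.coe_le_coe_iff.1 hmaj
    rw [intervalIntegral.integral_add (by simp) (hvci.const_mul N),
      intervalIntegral.integral_const_mul] at hmaj
    have e : (2 * Real.pi)⁻¹ * ((∫ θ in (0:ℝ)..(2 * Real.pi), (M + N * (k * ‖ζ - a‖)))
        + N * ∫ θ in (0:ℝ)..(2 * Real.pi), v (circleMap a r θ)) =
        (M + N * (k * ‖ζ - a‖)) + N * J := by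
      rw [hJ]; simp; field_simp
    rw [e] at hmaj
    rw [hux]
    have : (x - M) / N ≤ k * ‖ζ - a‖ + J := by
      rw [div_le_iff₀ hN]; linarith
    linarith

theorem estimate {Ω : Set ℂ} (hΩ : IsOpen Ω) {g : ℂ → ℝ} {C : ℝ}
    (hC : ∀ z ∈ Ω, |g z| ≤ C) (hgm : AEStronglyMeasurable g (volume.restrict Ω))
    {μ : Measure ℂ} [IsLocallyFiniteMeasure μ]
    (hμ : ∀ φ : ℂ → ℝ, IsTestR Ω φ →
      ∫ z in Ω, g z * laplacianR φ z = ∫ z, φ z ∂μ)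
    {z₀ : ℂ} {R : ℝ} (hR : 0 < R) (hB : closedBall z₀ (2 * R) ⊆ Ω) :
    ∃ P : ℝ, 0 ≤ P ∧ ∀ (w : ℂ) (t : ℂ → ℝ) (K : Set ℂ) (T δ : ℝ), dist w z₀ < R / 2 →
      ContDiff ℝ (⊤ : ℕ∞) t → (∀ z, 0 ≤ t z) → (∀ z, t z ≤ 1) →
      (∀ z ∈ closedBall z₀ (3 * R / 2), laplacianR t z ≤ 0) →
      IsCompact K → K ⊆ closedBall z₀ R → (∀ z ∈ K, t z = 1) →
      ∫ z in ball w (2 * R), t z ≤ T → 0 < δ → μ.real K ≤ P * (δ + T / δ + T) := by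
  let χ : ContDiffBump z₀ := ⟨R, 5 * R / 4, hR, by linarith⟩
  let χ' : ContDiffBump z₀ := ⟨5 * R / 4, 3 * R / 2, by linarith, by linarith⟩
  have hχ : ContDiff ℝ (⊤ : ℕ∞) χ := χ.contDiff
  have hχ' : ContDiff ℝ (⊤ : ℕ∞) χ' := χ'.contDiff
  have hχs : tsupport χ = closedBall z₀ (5 * R / 4) := χ.tsupport_eq
  have hχs' : tsupport χ' = closedBall z₀ (3 * R / 2) := χ'.tsupport_eq
  have hχc : HasCompactSupport χ := χ.hasCompactSupport
  have hχc' : HasCompactSupport χ' := χ'.hasCompactSupport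
  set q : ℂ → ℝ := fun z => ddR 1 χ z ^ 2 + ddR Complex.I χ z ^ 2 with hq
  have hqc : Continuous q := ((ddR_smooth hχ 1).continuous.pow 2).add
    ((ddR_smooth hχ Complex.I).continuous.pow 2)
  have hqs : HasCompactSupport q := HasCompactSupport.intro hχc (fun z hz => by
    have h : ∀ v, ddR v χ z = 0 := fun v => by
      by_contra h
      exact hz (ddR_tsupport _ v (subset_tsupport _ h))
    simp [hq, h])
  have hqi : Integrable q := hqc.integrable_of_hasCompactSupport hqs
  have hq0 : ∀ z, 0 ≤ q z := fun z => by positivity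
  obtain ⟨A, hA⟩ := (lap_compact hχc).exists_bound_of_continuous (lap_smooth hχ).continuous
  obtain ⟨A', hA'⟩ := (lap_compact hχc').exists_bound_of_continuous (lap_smooth hχ').continuous
  have hA0 : 0 ≤ A := (norm_nonneg _).trans (hA 0)
  have hA0' : 0 ≤ A' := (norm_nonneg _).trans (hA' 0)
  have hC0 : 0 ≤ C := (abs_nonneg _).trans (hC z₀ (hB (mem_closedBall_self (by linarith))))
  set Q := ∫ z, q z with hQ
  have hQ0 : 0 ≤ Q := integral_nonneg hq0
  refine ⟨2 * C * (Q + A' + A), by positivity, ?_⟩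
  intro w t K T δ hw ht ht0 ht1 htl hK hKR htK hT hδ
  have hT0 : 0 ≤ T := (setIntegral_nonneg measurableSet_ball (fun z _ => ht0 z)).trans hT
  have hsubw : closedBall z₀ (3 * R / 2) ⊆ ball w (2 * R) := by
    intro z hz
    rw [mem_closedBall] at hz
    rw [mem_ball]
    have := dist_triangle z z₀ w
    rw [dist_comm z₀ w] at this
    linarith
  -- f = t (t - 2)
  set f : ℂ → ℝ := fun z => t z * (t z + (-2)) with hf
  have hfs : ContDiff ℝ (⊤ : ℕ∞) f := ht.mul (ht.add contDiff_const)
  set G : ℂ → ℝ := fun z => ddR 1 t z ^ 2 + ddR Complex.I t z ^ 2 with hG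
  have hfl : ∀ z, laplacianR f z = 2 * G z + (2 * t z - 2) * laplacianR t z := by
    intro z
    rw [hf, lap_mul ht (ht.add contDiff_const), lap_add ht contDiff_const,
      ddR_add ht contDiff_const, ddR_add ht contDiff_const, ddR_const, ddR_const, lap_const]
    simp only [hG]; ring
  have hG0 : ∀ z, 0 ≤ G z := fun z => by positivity
  have hfG : ∀ z ∈ closedBall z₀ (3 * R / 2), 2 * G z ≤ laplacianR f z := by
    intro z hz
    rw [hfl]
    nlinarith [htl z hz, ht1 z]
  -- test function
  set φ : ℂ → ℝ := fun z => χ z * t z with hφ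
  have hφs : ContDiff ℝ (⊤ : ℕ∞) φ := hχ.mul ht
  have hφc : HasCompactSupport φ := hχc.mul_right
  have hφt : tsupport φ ⊆ tsupport χ := tsupport_mul_subset_left
  have hφΩ : tsupport φ ⊆ Ω := by
    refine hφt.trans ?_
    rw [hχs]
    exact (closedBall_subset_closedBall (by linarith)).trans hB
  have hφ0 : ∀ z, 0 ≤ φ z := fun z => mul_nonneg χ.nonneg (ht0 z)
  have hφK : ∀ z ∈ K, φ z = 1 := fun z hz => by
    simp only [hφ, htK z hz, mul_one]
    exact χ.one_of_mem_closedBall (hKR hz)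
  have hμK : μ.real K ≤ ∫ z, φ z ∂μ := by
    have hφi : Integrable φ μ := hφs.continuous.integrable_of_hasCompactSupport hφc
    rw [← integral_indicator_one hK.measurableSet]
    apply integral_mono _ hφi
    · intro z
      by_cases hz : z ∈ K
      · simp [hz, hφK z hz]
      · simpa [hz] using hφ0 z
    · exact (integrable_indicator_iff hK.measurableSet).2
        (integrableOn_const hK.measure_lt_top.ne)
  rw [← hμ φ ⟨hφs, hφc, hφΩ⟩] at hμK
  -- dominating function
  set H : ℂ → ℝ := fun z => δ * q z + 1 / (2 * δ) * (laplacianR f z * χ' z)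
    + |laplacianR χ z| * t z with hH
  have hχ'0 : ∀ z, 0 ≤ laplacianR f z * χ' z := by
    intro z
    by_cases hz : z ∈ closedBall z₀ (3 * R / 2)
    · exact mul_nonneg (by have := hfG z hz; have := hG0 z; linarith) χ'.nonneg
    · rw [← hχs'] at hz
      simp [image_eq_zero_of_notMem_tsupport hz]
  have hH0 : ∀ z, 0 ≤ H z := by
    intro z
    have h1 := hχ'0 z
    have h2 := hq0 z
    have h3 := ht0 z
    positivity
  have hφH : ∀ z, laplacianR φ z ≤ H z := by
    intro z
    by_cases hz : z ∈ closedBall z₀ (5 * R / 4)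
    · have hz2 : z ∈ closedBall z₀ (3 * R / 2) := closedBall_subset_closedBall (by linarith) hz
      have hχ1 : χ' z = 1 := χ'.one_of_mem_closedBall hz
      rw [hφ, lap_mul hχ ht]
      simp only [hH, hχ1, mul_one]
      have h1 : χ z * laplacianR t z ≤ 0 :=
        mul_nonpos_of_nonneg_of_nonpos χ.nonneg (htl z hz2)
      have h2 : t z * laplacianR χ z ≤ |laplacianR χ z| * t z := by
        rw [mul_comm]; exact mul_le_mul_of_nonneg_right (le_abs_self _) (ht0 z)
      have h3 : 2 * (ddR 1 χ z * ddR 1 t z + ddR Complex.I χ z * ddR Complex.I t z) ≤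
          δ * q z + 1 / δ * G z := by
        have hyoung : ∀ a b : ℝ, 2 * (a * b) ≤ δ * a ^ 2 + 1 / δ * b ^ 2 := by
          intro a b
          have : 0 ≤ (δ * a - b) ^ 2 / δ := by positivity
          have e : (δ * a - b) ^ 2 / δ = δ * a ^ 2 + 1 / δ * b ^ 2 - 2 * (a * b) := by
            field_simp; ring
          linarith
        have y1 := hyoung (ddR 1 χ z) (ddR 1 t z)
        have y2 := hyoung (ddR Complex.I χ z) (ddR Complex.I t z)
        simp only [hq, hG]; linarith
      have h4 : 1 / δ * G z ≤ 1 / (2 * δ) * laplacianR f z := by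
        have := mul_le_mul_of_nonneg_left (hfG z hz2) (show 0 ≤ 1 / (2 * δ) by positivity)
        calc 1 / δ * G z = 1 / (2 * δ) * (2 * G z) := by field_simp
          _ ≤ _ := this
      linarith
    · rw [lap_zero_off φ (fun h => hz (hχs ▸ hφt h))]
      exact hH0 z
  have hi2 : Integrable (fun z => laplacianR f z * χ' z) :=
    ((lap_smooth hfs).continuous.mul hχ'.continuous).integrable_of_hasCompactSupport
      hχc'.mul_left
  have hi3 : ∀ ξ : ℂ → ℝ, ContDiff ℝ (⊤ : ℕ∞) ξ → HasCompactSupport ξ →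
      Integrable (fun z => |laplacianR ξ z| * t z) := fun ξ h1 h2 =>
    ((lap_smooth h1).continuous.abs.mul ht.continuous).integrable_of_hasCompactSupport
      (HasCompactSupport.mul_right (HasCompactSupport.intro h2 (fun z hz => by
        simp [lap_zero_off ξ hz])))
  have hHi : Integrable H := ((hqi.const_mul δ).add (hi2.const_mul _)).add (hi3 χ hχ hχc)
  -- integrals against t
  have hbound : ∀ (ξ : ℂ → ℝ) (B : ℝ), ContDiff ℝ (⊤ : ℕ∞) ξ → HasCompactSupport ξ →
      tsupport ξ ⊆ closedBall z₀ (3 * R / 2) → (∀ z, ‖laplacianR ξ z‖ ≤ B) → 0 ≤ B →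
      ∫ z, |laplacianR ξ z| * t z ≤ B * T := by
    intro ξ B h1 h2 h3 h4 hB0
    rw [← setIntegral_eq_integral_of_forall_compl_eq_zero (s := ball w (2 * R))
      (fun z hz => by
        rw [lap_zero_off ξ (fun h => hz (hsubw (h3 h)))]; simp)]
    calc _ ≤ ∫ z in ball w (2 * R), B * t z := by
          apply setIntegral_mono_on (hi3 ξ h1 h2).integrableOn _ measurableSet_ball
          · exact fun z _ => mul_le_mul_of_nonneg_right (h4 z) (ht0 z)
          · exact ((ht.continuous.continuousOn.integrableOn_compact
              (isCompact_closedBall w (2 * R))).mono_set ball_subset_closedBall).const_mul B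
      _ = B * ∫ z in ball w (2 * R), t z := integral_const_mul _ _
      _ ≤ _ := by gcongr
  have hIf : ∫ z, laplacianR f z * χ' z ≤ 2 * (A' * T) := by
    rw [← ibp_lap hfs hχ' hχc']
    calc _ ≤ ∫ z, 2 * (|laplacianR χ' z| * t z) := by
          apply integral_mono
          · exact (hfs.continuous.mul (lap_smooth hχ').continuous).integrable_of_hasCompactSupport
              (lap_compact hχc').mul_left
          · exact (hi3 χ' hχ' hχc').const_mul 2
          · intro z
            simp only
            calc f z * laplacianR χ' z ≤ |f z| * |laplacianR χ' z| := by
                  rw [← abs_mul]; exact le_abs_self _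
              _ ≤ (2 * t z) * |laplacianR χ' z| := by
                  apply mul_le_mul_of_nonneg_right _ (abs_nonneg _)
                  rw [abs_le]
                  have h0 := ht0 z
                  have h1 := ht1 z
                  constructor <;> simp only [hf] <;> nlinarith
              _ = _ := by ring
      _ = 2 * ∫ z, |laplacianR χ' z| * t z := integral_const_mul _ _
      _ ≤ _ := by
          have := hbound χ' A' hχ' hχc' hχs'.le hA' hA0'
          linarith
  have hIχ : ∫ z, |laplacianR χ z| * t z ≤ A * T :=
    hbound χ A hχ hχc (hχs.le.trans (closedBall_subset_closedBall (by linarith))) hA hA0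
  have hIH : ∫ z, H z ≤ δ * Q + A' * (T / δ) + A * T := by
    have : ∫ z, H z = δ * Q + 1 / (2 * δ) * (∫ z, laplacianR f z * χ' z)
        + ∫ z, |laplacianR χ z| * t z := by
      have h12 : Integrable (fun z => δ * q z + 1 / (2 * δ) * (laplacianR f z * χ' z)) :=
        (hqi.const_mul δ).add (hi2.const_mul _)
      simp only [hH]
      rw [integral_add h12 (hi3 χ hχ hχc),
        integral_add (hqi.const_mul δ) (hi2.const_mul _), integral_const_mul, integral_const_mul]
    rw [this]
    have h5 := mul_le_mul_of_nonneg_left hIf (show 0 ≤ 1 / (2 * δ) by positivity)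
    have h6 : 1 / (2 * δ) * (2 * (A' * T)) = A' * (T / δ) := by field_simp
    linarith
  -- conclusion
  have hLi : Integrable (laplacianR φ) :=
    (lap_smooth hφs).continuous.integrable_of_hasCompactSupport (lap_compact hφc)
  have hL0 : ∫ z in Ω, laplacianR φ z = 0 := by
    rw [setIntegral_eq_integral_of_forall_compl_eq_zero
      (fun z hz => lap_zero_off φ (fun h => hz (hφΩ h)))]
    exact int_lap_zero hφs hφc
  have hfin : ∫ z in Ω, g z * laplacianR φ z ≤
      ∫ z in Ω, (2 * C * H z - C * laplacianR φ z) := by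
    apply setIntegral_mono_on _ _ hΩ.measurableSet
    · intro z hz
      have hg := abs_le.1 (hC z hz)
      have h1 := hφH z
      have h2 := hH0 z
      nlinarith [mul_le_mul_of_nonneg_left h1 (show 0 ≤ g z + C by linarith),
        mul_nonneg (show 0 ≤ C - g z by linarith) h2]
    · apply Integrable.bdd_mul (c := C) hLi.integrableOn hgm
      exact (ae_restrict_iff' hΩ.measurableSet).2 (Filter.Eventually.of_forall hC)
    · exact ((hHi.const_mul _).sub (hLi.const_mul _)).integrableOn
  rw [integral_sub (hHi.const_mul _).integrableOn (hLi.const_mul _).integrableOn,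
    integral_const_mul, integral_const_mul, hL0] at hfin
  have hHΩ : ∫ z in Ω, H z ≤ ∫ z, H z :=
    setIntegral_le_integral hHi (Filter.Eventually.of_forall hH0)
  have h7 : 2 * C * ∫ z in Ω, H z ≤ 2 * C * (δ * Q + A' * (T / δ) + A * T) := by
    gcongr; exact hHΩ.trans hIH
  have hTδ : 0 ≤ T / δ := by positivity
  have h8 : δ * Q + A' * (T / δ) + A * T ≤ (Q + A' + A) * (δ + T / δ + T) := by
    have : (Q + A' + A) * (δ + T / δ + T) - (δ * Q + A' * (T / δ) + A * T) =
      Q * (T / δ) + Q * T + A' * δ + A' * T + A * δ + A * (T / δ) := by ring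
    have : 0 ≤ Q * (T / δ) + Q * T + A' * δ + A' * T + A * δ + A * (T / δ) := by positivity
    linarith
  calc μ.real K ≤ 2 * C * (δ * Q + A' * (T / δ) + A * T) := by linarith
    _ ≤ 2 * C * ((Q + A' + A) * (δ + T / δ + T)) := by gcongr
    _ = _ := by ring

/-- **Lemma 3 (Part Two).**  Let `Ω ⊆ ℂ` be a domain and `E` a closed polar subset
of `Ω`.  Let `g` be a bounded subharmonic function on `Ω` and let `μ = Δg` be its
distributional Laplacian (a positive measure).  Then `μ(E) = 0`. -/
theorem lemma3_rado (Ω : Set ℂ) (hΩ : IsOpen Ω) (hconn : IsConnected Ω)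
    (E : Set ℂ) (hE : E ⊆ Ω)
    (hEclosed : ∀ z ∈ Ω, z ∈ closure E → z ∈ E)
    (hpolar : PolarIn E Ω)
    (g : ℂ → ℝ) (hsub : SubharmonicRealOn g Ω)
    (hbd : ∃ C : ℝ, ∀ z ∈ Ω, |g z| ≤ C)
    (μ : Measure ℂ) [IsLocallyFiniteMeasure μ]
    (hμ : ∀ φ : ℂ → ℝ, IsTestR Ω φ →
      ∫ z in Ω, g z * laplacianR φ z = ∫ z, φ z ∂μ) :
    μ E = 0 := by
  obtain ⟨C, hC⟩ := hbd
  have hgm : AEStronglyMeasurable g (volume.restrict Ω) := by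
    have h1 : UpperSemicontinuous (fun x : Ω => g x) := upperSemicontinuousOn_iff_restrict.2 hsub.1
    exact (aemeasurable_restrict_of_measurable_subtype hΩ.measurableSet
      h1.measurable).aestronglyMeasurable
  apply measure_null_of_locally_null
  intro z₀ hz₀E
  have hz₀ := hE hz₀E
  obtain ⟨V, hV, hzV, lam, hlam, hne, hEV⟩ := hpolar z₀ hz₀
  obtain ⟨R', hR', hball'⟩ := Metric.nhds_basis_closedBall.mem_iff.1
    ((hΩ.inter hV).mem_nhds ⟨hz₀, hzV⟩)
  obtain ⟨R, hR, hRR⟩ : ∃ R : ℝ, 0 < R ∧ 4 * R = R' := ⟨R' / 4, by positivity, by ring⟩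
  rw [← hRR] at hball'
  have hBΩ : closedBall z₀ (4 * R) ⊆ Ω := hball'.trans inter_subset_left
  have hBV : closedBall z₀ (4 * R) ⊆ V := hball'.trans inter_subset_right
  have hKeq : E ∩ closedBall z₀ R = closure E ∩ closedBall z₀ R := by
    apply Subset.antisymm (inter_subset_inter_left _ subset_closure)
    rintro z ⟨h1, h2⟩
    exact ⟨hEclosed z (hBΩ (closedBall_subset_closedBall (by linarith) h2)) h1, h2⟩
  set K := E ∩ closedBall z₀ R with hKdef
  have hK : IsCompact K := by
    rw [hKeq]
    exact (isCompact_closedBall z₀ R).inter_left isClosed_closure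
  refine ⟨K, inter_mem_nhdsWithin E (closedBall_mem_nhds z₀ hR), ?_⟩
  have hKR : K ⊆ closedBall z₀ R := inter_subset_right
  have hKl : ∀ z ∈ K, lam z = ⊥ := fun z hz =>
    hEV ⟨hz.1, hBV (closedBall_subset_closedBall (by linarith) hz.2)⟩
  -- upper bound
  obtain ⟨M, hM⟩ : ∃ M : ℝ, ∀ z ∈ closedBall z₀ (4 * R), lam z ≤ (M : EReal) := by
    obtain ⟨a, ha, hmax⟩ := UpperSemicontinuousOn.exists_isMaxOn
      (⟨z₀, mem_closedBall_self (by linarith)⟩ : (closedBall z₀ (4 * R)).Nonempty)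
      (isCompact_closedBall z₀ (4 * R)) (hlam.1.mono hBV)
    refine ⟨(lam a).toReal, fun z hz => (hmax hz).trans ?_⟩
    exact EReal.le_coe_toReal (hlam.2.1 a (hBV ha))
  obtain ⟨w, ⟨hwR, hwV⟩, hwl⟩ := hne (ball z₀ (R / 2)) (ball_mem_nhds z₀ (by positivity))
  have hw4 : w ∈ closedBall z₀ (4 * R) := by
    rw [mem_ball] at hwR
    rw [mem_closedBall]; linarith
  have hwt := EReal.coe_toReal (hlam.2.1 w hwV) hwl
  set C₀ := M - (lam w).toReal with hC₀
  have hC₀0 : 0 ≤ C₀ := by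
    have := hM w hw4
    rw [← hwt] at this
    have := EReal.coe_le_coe_iff.1 this
    linarith
  obtain ⟨P, hP, hest⟩ := estimate hΩ hC hgm hμ hR
    ((closedBall_subset_closedBall (by linarith)).trans hBΩ : closedBall z₀ (2 * R) ⊆ Ω)
  set D := 2 * Real.pi * (2 * R) ^ 2 * (C₀ + 1) with hD
  have hpi := Real.pi_pos
  have hD0 : 0 ≤ D := by positivity
  have key : ∀ x : ℝ, 0 < x → x ≤ 1 → μ.real K ≤ P * (1 + 2 * D) * x := by
    intro x hx hx1
    obtain ⟨s, hs, hs1, hs0, hsK, hsw, hsm⟩ := exists_smooth hlam hR hBV hM hK hKR hKl hw4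
      (C₀ := C₀) (by rw [hC₀, sub_sub_cancel, hwt]) (N := (x ^ 2)⁻¹) (by positivity)
    have harea := area_mean hs.continuous hs0 (w := w) (ρ := 2 * R) (by linarith)
      (fun r hr hr2 => hsm w r hr (by rw [mem_ball] at hwR; linarith))
    have hT : ∫ z in ball w (2 * R), (-1) * s z ≤ D * x ^ 2 := by
      have e : -(C₀ + 1) / (x ^ 2)⁻¹ = -((C₀ + 1) * x ^ 2) := by field_simp
      rw [e] at hsw
      simp only [neg_one_mul]
      refine harea.trans ?_
      calc _ ≤ 2 * Real.pi * (2 * R) ^ 2 * ((C₀ + 1) * x ^ 2) := by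
            gcongr; linarith
        _ = _ := by rw [hD]; ring
    have hfin := hest w (fun z => (-1) * s z) K (D * x ^ 2) x hwR (contDiff_const.mul hs)
      (fun z => by have := hs0 z; linarith) (fun z => by have := hs1 z; linarith)
      (fun z hz => by
        rw [lap_mul contDiff_const hs, lap_const, ddR_const, ddR_const]
        have := lap_nonneg hs z hR (fun r hr hr2 => hsm z r hr (by
          rw [mem_closedBall] at hz; linarith))
        linarith)
      hK hKR (fun z hz => by rw [hsK z hz]; norm_num) hT hx
    refine hfin.trans ?_
    rw [mul_assoc P]
    apply mul_le_mul_of_nonneg_left _ hP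
    have e : D * x ^ 2 / x = D * x := by field_simp
    rw [e]
    nlinarith [mul_nonneg hD0 (mul_nonneg hx.le (sub_nonneg.2 hx1))]
  have hle : μ.real K ≤ 0 := by
    by_contra! hpos
    set Z := P * (1 + 2 * D) with hZ
    have hZ0 : 0 ≤ Z := by positivity
    set m := μ.real K
    have h1 := key (min 1 (m / (2 * (Z + 1)))) (by positivity) (min_le_left _ _)
    have h2 : Z * min 1 (m / (2 * (Z + 1))) ≤ Z * (m / (2 * (Z + 1))) :=
      mul_le_mul_of_nonneg_left (min_le_right _ _) hZ0
    have h3 : Z * (m / (2 * (Z + 1))) < m := by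
      rw [← mul_div_assoc, div_lt_iff₀ (by positivity)]
      nlinarith
    linarith
  have h0 : μ.real K = 0 := le_antisymm hle measureReal_nonneg
  rw [measureReal_eq_zero_iff hK.measure_lt_top.ne] at h0
  exact h0

end
end
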